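/- Let D ⊂ ℂⁿ (n ≥ 2) be a smooth connected non-bifurcated hypersurface, and let F : X → ℂⁿ be a local diffeomorphism of simply connected manifolds which restricts to a d-sheeted covering map X − F⁻¹(D) → ℂⁿ − D. Then d = 1 or d = ∞. -/

import Mathlib

open scoped Manifold
open Set

/-- Evaluation of a polynomial `f : ℂⁿ → ℂ`. -/
noncomputable def polyMap (n : ℕ) (f : MvPolynomial (Fin n) ℂ) : (Fin n → ℂ) → ℂ :=
  fun z => MvPolynomial.eval z f

section Preliminaries

open Set Topology Metric Polynomial

/-- `p` is a covering map onto (part of) the subset `U` of its codomain. -/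
structure CoveringOnto {E Z : Type*} [TopologicalSpace E] [TopologicalSpace Z]
    (p : E → Z) (U : Set Z) : Prop where
  mem : ∀ e, p e ∈ U
  cov : IsCoveringMap (U.codRestrict p mem)

namespace CoveringOnto

section General

variable {E Z : Type*} [TopologicalSpace E] [TopologicalSpace Z] {p : E → Z} {U : Set Z}

theorem continuous (hp : CoveringOnto p U) : Continuous p :=
  continuous_subtype_val.comp hp.cov.continuous

theorem exists_sections (hp : CoveringOnto p U) (hU : IsOpen U) {z : Z} (hz : z ∈ U) :
    ∃ N, IsOpen N ∧ z ∈ N ∧ N ⊆ U ∧ ∀ e, p e ∈ N → ∃ σ : Z → E, ContinuousOn σ N ∧ σ (p e) = e ∧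
      (∀ x ∈ N, p (σ x) = x) ∧ ∀ N' ⊆ N, IsOpen N' → IsOpen (σ '' N') := by
  obtain ⟨-, N, hzN, hN, hfN, H, hH⟩ := hp.cov ⟨z, hz⟩
  have hdisc := (hp.cov ⟨z, hz⟩).1
  refine ⟨Subtype.val '' N, hU.isOpenMap_subtype_val _ hN, ⟨_, hzN, rfl⟩, by
    rintro _ ⟨x, -, rfl⟩; exact x.2, ?_⟩
  intro e he
  have he' : U.codRestrict p hp.mem e ∈ N := by
    obtain ⟨x, hx, hxe⟩ := he
    have : U.codRestrict p hp.mem e = x := Subtype.ext hxe.symm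
    rwa [this]
  set i := (H ⟨e, he'⟩).2 with hi
  classical
  have key : ∀ x, x ∈ Subtype.val '' N → ∃ h : x ∈ U, (⟨x, h⟩ : U) ∈ N := by
    rintro _ ⟨x, hx, rfl⟩; exact ⟨x.2, hx⟩
  let σ : Z → E := fun x => if h : ∃ h : x ∈ U, (⟨x, h⟩ : U) ∈ N then
    (H.symm (⟨⟨x, h.1⟩, h.2⟩, i) : E) else e
  have hσ : ∀ x (h : ∃ h : x ∈ U, (⟨x, h⟩ : U) ∈ N), σ x = (H.symm (⟨⟨x, h.1⟩, h.2⟩, i) : E) :=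
    fun x h => dif_pos h
  have hpH : ∀ y, p (H.symm y : E) = y.1.1.1 := by
    intro y
    have := hH (H.symm y)
    rw [H.apply_symm_apply] at this
    exact (congrArg Subtype.val this).symm
  have hpσ : ∀ x ∈ Subtype.val '' N, p (σ x) = x := by
    intro x hx
    rw [hσ x (key x hx), hpH]
  refine ⟨σ, ?_, ?_, hpσ, ?_⟩
  · rw [continuousOn_iff_continuous_domRestrict]
    have : (Subtype.val '' N).domRestrict σ = fun x : Subtype.val '' N =>
        (H.symm (⟨⟨x, (key x x.2).1⟩, (key x x.2).2⟩, i) : E) := by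
      funext x; exact hσ x (key x x.2)
    change Continuous ((Subtype.val '' N).domRestrict σ)
    rw [this]; fun_prop
  · rw [hσ _ (key _ he)]
    have : ((⟨⟨p e, (key _ he).1⟩, (key _ he).2⟩, i) : N × _) = H ⟨e, he'⟩ := by
      refine Prod.ext (Subtype.ext ?_) rfl
      rw [hH]; rfl
    rw [this, H.symm_apply_apply]
  · intro N' hN' hN'o
    have : σ '' N' = p ⁻¹' N' ∩ Subtype.val '' {x | (H x).2 = i} := by
      ext y; constructor
      · rintro ⟨x, hx, rfl⟩
        refine ⟨by rw [mem_preimage, hpσ x (hN' hx)]; exact hx, ?_⟩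
        rw [hσ x (key x (hN' hx))]
        exact ⟨_, by simp, rfl⟩
      · rintro ⟨hy, ⟨y', hy', rfl⟩⟩
        refine ⟨p y', hy, ?_⟩
        have h1 := key _ (hN' hy)
        rw [hσ _ h1]
        have : ((⟨⟨p y', h1.1⟩, h1.2⟩, i) : N × _) = H y' := by
          refine Prod.ext (Subtype.ext ?_) hy'.symm
          rw [hH]; rfl
        rw [this, H.symm_apply_apply]
    rw [this]
    refine (hN'o.preimage hp.continuous).inter (hfN.isOpenMap_subtype_val _ ?_)
    exact (isOpen_discrete {i}).preimage (continuous_snd.comp H.continuous)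

theorem isOpenMap (hp : CoveringOnto p U) (hU : IsOpen U) : IsOpenMap p :=
  (hU.isOpenMap_subtype_val).comp hp.cov.isOpenMap

/-- Small sections through a given point, with image in a given neighbourhood. -/
theorem exists_section_nhds (hp : CoveringOnto p U) (hU : IsOpen U) {e : E} {O : Set E}
    (hO : O ∈ 𝓝 e) :
    ∃ N, IsOpen N ∧ p e ∈ N ∧ N ⊆ U ∧ ∃ σ : Z → E, ContinuousOn σ N ∧ σ (p e) = e ∧
      (∀ x ∈ N, p (σ x) = x) ∧ (∀ N' ⊆ N, IsOpen N' → IsOpen (σ '' N')) ∧ MapsTo σ N O := by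
  obtain ⟨N, hN, heN, hNU, hs⟩ := hp.exists_sections hU (hp.mem e)
  obtain ⟨σ, hσ, hσe, hpσ, hop⟩ := hs e heN
  obtain ⟨O', hO'O, hO', heO'⟩ := mem_nhds_iff.1 hO
  have h1 : IsOpen (N ∩ σ ⁻¹' O') := hσ.isOpen_inter_preimage hN hO'
  exact ⟨N ∩ σ ⁻¹' O', h1, ⟨heN, by simpa [hσe] using heO'⟩, inter_subset_left.trans hNU, σ,
    hσ.mono inter_subset_left, hσe, fun x hx => hpσ x hx.1,
    fun N' hN' => hop N' (hN'.trans inter_subset_left), fun x hx => hO'O hx.2⟩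

/-- The image of a relatively clopen set is relatively clopen. -/
theorem isOpen_diff_image (hp : CoveringOnto p U) (hU : IsOpen U) [LocallyConnectedSpace Z]
    {O : Set Z} (hO : IsOpen O) (hOU : O ⊆ U) {A : Set E}
    (hA : IsOpen A) (hA' : IsOpen (p ⁻¹' O \ A)) : IsOpen (O \ p '' A) := by
  rw [isOpen_iff_mem_nhds]
  rintro z ⟨hzO, hzA⟩
  obtain ⟨N, hN, hzN, hNU, hs⟩ := hp.exists_sections hU (hOU hzO)
  obtain ⟨C, hC, hCo, hzC, hCc⟩ :=
    locallyConnectedSpace_iff_subsets_isOpen_isConnected.1 inferInstance z (N ∩ O)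
      ((hN.inter hO).mem_nhds ⟨hzN, hzO⟩)
  refine Filter.mem_of_superset (hCo.mem_nhds hzC) fun x hx => ⟨(hC hx).2, ?_⟩
  rintro ⟨e, he, rfl⟩
  obtain ⟨σ, hσ, hσe, hpσ, -⟩ := hs e (hC hx).1
  have hσC : ContinuousOn σ C := hσ.mono (hC.trans inter_subset_left)
  have hsub : C ⊆ σ ⁻¹' A := by
    by_contra hne
    obtain ⟨x', hx', hx'A⟩ := not_subset.1 hne
    obtain ⟨y, hyC, hyA, hyA'⟩ := hCc.isPreconnected (C ∩ σ ⁻¹' A) (C ∩ σ ⁻¹' (p ⁻¹' O \ A))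
      (hσC.isOpen_inter_preimage hCo hA) (hσC.isOpen_inter_preimage hCo hA')
      (fun y hy => by
        by_cases h : σ y ∈ A
        · exact Or.inl ⟨hy, h⟩
        · refine Or.inr ⟨hy, ?_, h⟩
          rw [mem_preimage, hpσ y (hC hy).1]; exact (hC hy).2)
      ⟨p e, hx, hx, by rw [mem_preimage, hσe]; exact he⟩
      ⟨x', hx', hx', by rw [mem_preimage, hpσ x' (hC hx').1]; exact (hC hx').2, hx'A⟩
    exact hyA'.2.2 hyA.2
  exact hzA ⟨σ z, hsub hzC, hpσ z hzN⟩

/-- Homotopy lifting. -/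
theorem exists_lift (hp : CoveringOnto p U) {A : Type*} [TopologicalSpace A]
    (H : unitInterval × A → Z) (hH : Continuous H) (hHU : ∀ x, H x ∈ U) (f : A → E)
    (hf : Continuous f) (h0 : ∀ a, H (0, a) = p (f a)) :
    ∃ K : unitInterval × A → E, Continuous K ∧ (∀ x, p (K x) = H x) ∧ (∀ a, K (0, a) = f a) ∧
      ∀ a, (∀ s, H (s, a) = H (0, a)) → ∀ s, K (s, a) = f a := by
  let H' : C(unitInterval × A, U) := ⟨fun x => ⟨H x, hHU x⟩, by fun_prop⟩
  have h0' : ∀ a, H' (0, a) = U.codRestrict p hp.mem ((⟨f, hf⟩ : C(A, E)) a) :=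
    fun a => Subtype.ext (h0 a)
  let K := hp.cov.liftHomotopy H' ⟨f, hf⟩ h0'
  have hK : ∀ x, p (K x) = H x := fun x =>
    congrArg Subtype.val (congrFun (hp.cov.liftHomotopy_lifts H' ⟨f, hf⟩ h0') x)
  have hK0 : ∀ a, K (0, a) = f a := hp.cov.liftHomotopy_zero H' ⟨f, hf⟩ h0'
  refine ⟨K, K.continuous, hK, hK0, fun a ha s => ?_⟩
  rw [← hK0 a]
  refine hp.cov.const_of_comp (g := fun s => K (s, a)) (by fun_prop) (fun s s' => Subtype.ext ?_) s 0
  change p (K (s, a)) = p (K (s', a))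
  rw [hK, hK, ha s, ha s']

theorem eqOn_of_comp_eqOn (hp : CoveringOnto p U) {A : Type*} [TopologicalSpace A] {s : Set A}
    (hs : IsPreconnected s) {g₁ g₂ : A → E} (h₁ : ContinuousOn g₁ s) (h₂ : ContinuousOn g₂ s)
    (he : ∀ a ∈ s, p (g₁ a) = p (g₂ a)) {a : A} (has : a ∈ s) (ha : g₁ a = g₂ a) :
    EqOn g₁ g₂ s :=
  hp.cov.eqOn_of_comp_eqOn hs h₁ h₂ (fun a h => Subtype.ext (he a h)) has ha

theorem pullback (hp : CoveringOnto p U) {Y : Type*} [TopologicalSpace Y] {φ : Y → Z}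
    (hφ : Continuous φ) :
    CoveringOnto (fun x : {x : E × Y // p x.1 = φ x.2} => x.1.2) (φ ⁻¹' U) where
  mem x := by rw [mem_preimage, ← x.2]; exact hp.mem _
  cov := by
    intro ⟨y, hy⟩
    suffices h : IsEvenlyCovered _ (⟨y, hy⟩ : φ ⁻¹' U) (U.codRestrict p hp.mem ⁻¹' {⟨φ y, hy⟩}) from
      h.to_isEvenlyCovered_preimage
    obtain ⟨hI, N, hzN, hN, hfN, H, hH⟩ := hp.cov ⟨φ y, hy⟩
    have hpH : ∀ y, p (H.symm y : E) = y.1.1.1 := by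
      intro y
      have := hH (H.symm y)
      rw [H.apply_symm_apply] at this
      exact (congrArg Subtype.val this).symm
    let φ' : φ ⁻¹' U → U := fun y => ⟨φ y, y.2⟩
    have hφ' : Continuous φ' := by fun_prop
    have hsnd : Continuous (fun x : {x : E × Y // p x.1 = φ x.2} => (⟨x.1.2, by
        rw [mem_preimage, ← x.2]; exact hp.mem _⟩ : φ ⁻¹' U)) := by fun_prop
    refine ⟨hI, φ' ⁻¹' N, hzN, hN.preimage hφ', (hN.preimage hφ').preimage hsnd, ?_⟩
    have hmem : ∀ x : {x : E × Y // p x.1 = φ x.2}, ∀ hx : x.1.2 ∈ φ ⁻¹' U,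
        (⟨x.1.2, hx⟩ : φ ⁻¹' U) ∈ φ' ⁻¹' N → x.1.1 ∈ U.codRestrict p hp.mem ⁻¹' N := by
      intro x hx h
      have : U.codRestrict p hp.mem x.1.1 = φ' ⟨x.1.2, hx⟩ := Subtype.ext x.2
      rw [mem_preimage, this]; exact h
    refine ⟨{ toFun := fun x => (⟨⟨x.1.1.2, by rw [mem_preimage, ← x.1.2]; exact hp.mem _⟩, x.2⟩,
                (H ⟨x.1.1.1, hmem _ _ x.2⟩).2)
              invFun := fun w => ⟨⟨⟨(H.symm (⟨φ' w.1.1, w.1.2⟩, w.2) : E), w.1.1.1⟩, hpH _⟩, w.1.2⟩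
              left_inv := ?_
              right_inv := ?_
              continuous_toFun := by fun_prop
              continuous_invFun := by fun_prop }, ?_⟩
    · rintro ⟨⟨⟨e, y'⟩, hey⟩, h⟩
      apply Subtype.ext; apply Subtype.ext
      refine Prod.ext ?_ rfl
      dsimp only
      have : ∀ h1 h2, ((⟨φ' ⟨y', h1⟩, h2⟩, (H ⟨e, hmem ⟨⟨e, y'⟩, hey⟩ _ h⟩).2) : N × _)
          = H ⟨e, hmem ⟨⟨e, y'⟩, hey⟩ _ h⟩ := by
        intro h1 h2
        refine Prod.ext (Subtype.ext ?_) rfl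
        rw [hH]; exact Subtype.ext hey.symm
      rw [this, H.symm_apply_apply]
    · rintro ⟨⟨y', h⟩, i⟩
      simp
    · intro x; rfl

end General

end CoveringOnto

/-- `L` is a relatively clopen subset of the (usually open) set `S`. -/
structure ClopenIn {Y : Type*} [TopologicalSpace Y] (L S : Set Y) : Prop where
  subset : L ⊆ S
  isOpen : IsOpen L
  isOpen_diff : IsOpen (S \ L)

namespace ClopenIn

variable {Y : Type*} [TopologicalSpace Y] {L L' S S' : Set Y}

theorem diff (h : ClopenIn L S) : ClopenIn (S \ L) S :=
  ⟨sdiff_subset, h.isOpen_diff, by rw [sdiff_sdiff_cancel_left h.subset]; exact h.isOpen⟩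

theorem restrict (h : ClopenIn L S) (hS' : IsOpen S') (hSS : S' ⊆ S) : ClopenIn (L ∩ S') S' :=
  ⟨inter_subset_right, h.isOpen.inter hS', by
    have : S' \ (L ∩ S') = (S \ L) ∩ S' := by
      ext x; simp only [mem_sdiff, mem_inter_iff]; have := @hSS x; tauto
    rw [this]; exact h.isOpen_diff.inter hS'⟩

theorem inter (h : ClopenIn L S) (h' : ClopenIn L' S) : ClopenIn (L ∩ L') S :=
  ⟨inter_subset_left.trans h.subset, h.isOpen.inter h'.isOpen, by
    rw [sdiff_inter]; exact h.isOpen_diff.union h'.isOpen_diff⟩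

theorem sdiff (h : ClopenIn L S) (h' : ClopenIn L' S) : ClopenIn (L \ L') S := by
  have : L \ L' = L ∩ (S \ L') := by
    ext x; simp only [mem_sdiff, mem_inter_iff]; have := @h.subset x; tauto
  rw [this]; exact h.inter h'.diff

theorem preimage {Y' : Type*} [TopologicalSpace Y'] {g : Y' → Y} (h : ClopenIn L S)
    (hg : Continuous g) : ClopenIn (g ⁻¹' L) (g ⁻¹' S) :=
  ⟨preimage_mono h.subset, h.isOpen.preimage hg, by
    rw [← preimage_sdiff]; exact h.isOpen_diff.preimage hg⟩

theorem subset_of_isPreconnected (h : ClopenIn L S) {C : Set Y} (hC : IsPreconnected C)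
    (hCS : C ⊆ S) (hne : (C ∩ L).Nonempty) : C ⊆ L := by
  intro x hx
  by_contra hxL
  obtain ⟨y, -, hy, hy'⟩ := hC L (S \ L) h.isOpen h.isOpen_diff
    (fun y hy => by by_cases h : y ∈ L; exacts [Or.inl h, Or.inr ⟨hCS hy, h⟩]) hne
    ⟨x, hx, hCS hx, hxL⟩
  exact hy'.2 hy

theorem iUnion {ι : Type*} {L S : ι → Set Y} (h : ∀ i, ClopenIn (L i) (S i))
    (hc : ∀ i j, L i ∩ S j ⊆ L j) :
    ClopenIn (⋃ i, L i) (⋃ i, S i) ∧ ∀ j, (⋃ i, L i) ∩ S j = L j := by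
  have h2 : ∀ j, (⋃ i, L i) ∩ S j = L j := by
    intro j
    refine Subset.antisymm ?_ fun x hx => ⟨mem_iUnion.2 ⟨j, hx⟩, (h j).subset hx⟩
    rintro x ⟨hx, hxj⟩
    obtain ⟨i, hi⟩ := mem_iUnion.1 hx
    exact hc i j ⟨hi, hxj⟩
  refine ⟨⟨iUnion_mono fun i => (h i).subset, isOpen_iUnion fun i => (h i).isOpen, ?_⟩, h2⟩
  have : (⋃ i, S i) \ (⋃ i, L i) = ⋃ i, (S i \ L i) := by
    ext x; constructor
    · rintro ⟨hx, hxL⟩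
      obtain ⟨i, hi⟩ := mem_iUnion.1 hx
      exact mem_iUnion.2 ⟨i, hi, fun h => hxL (mem_iUnion.2 ⟨i, h⟩)⟩
    · intro hx
      obtain ⟨i, hi, hiL⟩ := mem_iUnion.1 hx
      refine ⟨mem_iUnion.2 ⟨i, hi⟩, fun hxL => hiL ?_⟩
      rw [← h2 i]; exact ⟨hxL, hi⟩
  rw [this]; exact isOpen_iUnion fun i => (h i).isOpen_diff

/-- Relatively clopen subsets extend over thin sets. -/
theorem exists_extend_thin {T S : Set Y} (hT : IsOpen T) (hST : S ⊆ T)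
    (hthin : ∀ y ∈ T, ∀ O ∈ 𝓝 y, ∃ O' ∈ 𝓝 y, O' ⊆ O ∧ (O' ∩ S).Nonempty ∧ IsPreconnected (O' ∩ S))
    (h : ClopenIn L S) : ∃ L', ClopenIn L' T ∧ L' ∩ S = L := by
  refine ⟨{y | y ∈ T ∧ ∃ O ∈ 𝓝 y, O ∩ S ⊆ L}, ⟨fun y hy => hy.1, ?_, ?_⟩, ?_⟩
  · rw [isOpen_iff_mem_nhds]
    rintro y ⟨hyT, O, hO, hOL⟩
    obtain ⟨O', hO'O, hO', hy⟩ := mem_nhds_iff.1 hO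
    filter_upwards [hT.mem_nhds hyT, hO'.mem_nhds hy] with x hx hxO'
    exact ⟨hx, O', hO'.mem_nhds hxO', (inter_subset_inter_left _ hO'O).trans hOL⟩
  · rw [isOpen_iff_mem_nhds]
    rintro y ⟨hyT, hy⟩
    obtain ⟨O, hO, -, -, hOc⟩ := hthin y hyT univ Filter.univ_mem
    have hdisj : ¬ ((O ∩ S) ∩ L).Nonempty := fun hne =>
      hy ⟨hyT, O, hO, h.subset_of_isPreconnected hOc inter_subset_right hne⟩
    filter_upwards [hT.mem_nhds hyT, eventually_mem_nhds_iff.2 hO] with x hx hxO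
    refine ⟨hx, ?_⟩
    rintro ⟨-, O₂, hO₂, hO₂L⟩
    obtain ⟨O₃, -, hO₃, ⟨w, hw, hwS⟩, -⟩ := hthin x hx _ (Filter.inter_mem hxO hO₂)
    exact hdisj ⟨w, ⟨(hO₃ hw).1, hwS⟩, hO₂L ⟨(hO₃ hw).2, hwS⟩⟩
  · ext y; constructor
    · rintro ⟨⟨-, O, hO, hOL⟩, hyS⟩
      exact hOL ⟨mem_of_mem_nhds hO, hyS⟩
    · intro hy
      exact ⟨⟨hST (h.subset hy), L, h.isOpen.mem_nhds hy, inter_subset_left⟩, h.subset hy⟩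

end ClopenIn

namespace CoveringOnto

variable {E Z : Type*} [TopologicalSpace E] [TopologicalSpace Z] {p : E → Z} {U : Set Z}

theorem clopenIn_image (hp : CoveringOnto p U) (hU : IsOpen U) [LocallyConnectedSpace Z]
    {O : Set Z} (hO : IsOpen O) (hOU : O ⊆ U) {A : Set E} (hA : ClopenIn A (p ⁻¹' O)) :
    ClopenIn (p '' A) O :=
  ⟨image_subset_iff.2 hA.subset, hp.isOpenMap hU _ hA.isOpen,
    hp.isOpen_diff_image hU hO hOU hA.isOpen hA.isOpen_diff⟩

end CoveringOnto

section Extension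

variable {Y Z : Type*} [TopologicalSpace Y] [NormedAddCommGroup Z]

/-- Relatively clopen sets over preconnected open subsets of `Ω` are determined over
nonempty open subsets. -/
def UniqueExt (φ : Y → Z) (Ω : Set Z) : Prop :=
  ∀ W W' : Set Z, IsOpen W → W ⊆ Ω → IsPreconnected W → W' ⊆ W → IsOpen W' → W'.Nonempty →
    ∀ A, ClopenIn A (φ ⁻¹' W) → A ∩ φ ⁻¹' W' = ∅ → A = ∅

/-- Relatively clopen sets over nonempty open subsets of `Ω` extend to `Ω`, after shrinking. -/
def ExistsExt (φ : Y → Z) (Ω : Set Z) : Prop :=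
  ∀ W' : Set Z, IsOpen W' → W' ⊆ Ω → W'.Nonempty → ∀ L, ClopenIn L (φ ⁻¹' W') →
    ∃ W'' ⊆ W', IsOpen W'' ∧ W''.Nonempty ∧
      ∃ L', ClopenIn L' (φ ⁻¹' Ω) ∧ L' ∩ φ ⁻¹' W'' = L ∩ φ ⁻¹' W''

/-- `φ` has unique extension of relatively clopen sets near `w`. -/
def GoodAt (φ : Y → Z) (w : Z) : Prop :=
  ∃ δ > 0, UniqueExt φ (ball w δ) ∧ ExistsExt φ (ball w δ)

variable {φ : Y → Z} {Ω : Set Z}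

theorem UniqueExt.eq (hu : UniqueExt φ Ω) {W W' : Set Z} (hW : IsOpen W) (hWΩ : W ⊆ Ω)
    (hWc : IsPreconnected W) (hW'W : W' ⊆ W) (hW' : IsOpen W') (hne : W'.Nonempty) {A B : Set Y}
    (hA : ClopenIn A (φ ⁻¹' W)) (hB : ClopenIn B (φ ⁻¹' W))
    (h : A ∩ φ ⁻¹' W' = B ∩ φ ⁻¹' W') : A = B := by
  have key : ∀ A B : Set Y, ClopenIn A (φ ⁻¹' W) → ClopenIn B (φ ⁻¹' W) →
      A ∩ φ ⁻¹' W' = B ∩ φ ⁻¹' W' → A ⊆ B := by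
    intro A B hA hB h
    rw [← sdiff_eq_empty]
    refine hu W W' hW hWΩ hWc hW'W hW' hne _ (hA.sdiff hB) ?_
    rw [eq_empty_iff_forall_notMem]
    rintro x ⟨⟨hxA, hxB⟩, hx⟩
    have : x ∈ B ∩ φ ⁻¹' W' := h ▸ ⟨hxA, hx⟩
    exact hxB this.1
  exact Subset.antisymm (key A B hA hB h) (key B A hB hA h.symm)

theorem UniqueExt.mono {Ω' : Set Z} (hu : UniqueExt φ Ω) (h : Ω' ⊆ Ω) : UniqueExt φ Ω' :=
  fun W W' hW hWΩ => hu W W' hW (hWΩ.trans h)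

theorem ExistsExt.exists_eq (he : ExistsExt φ Ω) (hu : UniqueExt φ Ω) (hφ : Continuous φ)
    {W' : Set Z} (hW' : IsOpen W') (hW'Ω : W' ⊆ Ω) (hne : W'.Nonempty) (hc : IsPreconnected W')
    {L : Set Y} (hL : ClopenIn L (φ ⁻¹' W')) :
    ∃ L', ClopenIn L' (φ ⁻¹' Ω) ∧ L' ∩ φ ⁻¹' W' = L := by
  obtain ⟨W'', hW''W', hW'', hne'', L', hL', hLL'⟩ := he W' hW' hW'Ω hne L hL
  refine ⟨L', hL', ?_⟩
  refine hu.eq hW' hW'Ω hc hW''W' hW'' hne''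
    (hL'.restrict (hW'.preimage hφ) (preimage_mono hW'Ω)) hL ?_
  rw [← hLL', inter_assoc, inter_eq_right.2 (preimage_mono hW''W')]

variable [NormedSpace ℝ Z]

theorem uniqueExt_of_goodAt (hφ : Continuous φ) (hg : ∀ w ∈ Ω, GoodAt φ w) : UniqueExt φ Ω := by
  intro W W' hW hWΩ hWc hW'W hW' hne A hA hAW'
  have hstep : ∀ w ∈ W, ∃ r > 0, ball w r ⊆ W ∧ ∀ w' ∈ ball w r, ∀ ε > 0,
      A ∩ φ ⁻¹' ball w' ε = ∅ → A ∩ φ ⁻¹' ball w r = ∅ := by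
    intro w hw
    obtain ⟨δ, hδ, hu, -⟩ := hg w (hWΩ hw)
    obtain ⟨r, hr, hrW⟩ := Metric.isOpen_iff.1 hW w hw
    have hsub : ball w (min r δ) ⊆ W := (ball_subset_ball (min_le_left _ _)).trans hrW
    refine ⟨min r δ, lt_min hr hδ, hsub, fun w' hw' ε hε h => ?_⟩
    refine hu (ball w (min r δ)) (ball w' ε ∩ ball w (min r δ)) isOpen_ball
      (ball_subset_ball (min_le_right _ _)) (convex_ball _ _).isPreconnected inter_subset_right
      (isOpen_ball.inter isOpen_ball) ⟨w', mem_ball_self hε, hw'⟩ _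
      (hA.restrict (isOpen_ball.preimage hφ) (preimage_mono hsub)) ?_
    rw [eq_empty_iff_forall_notMem] at h ⊢
    rintro x ⟨⟨hxA, -⟩, hx, -⟩
    exact h x ⟨hxA, hx⟩
  let V : Set Z := {w | w ∈ W ∧ ∃ ε > 0, A ∩ φ ⁻¹' ball w ε = ∅}
  have hV : IsOpen V := by
    rw [isOpen_iff_mem_nhds]
    rintro w ⟨hw, ε, hε, h⟩
    filter_upwards [hW.mem_nhds hw, ball_mem_nhds w (half_pos hε)] with x hx hxw
    refine ⟨hx, ε / 2, half_pos hε, ?_⟩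
    refine subset_empty_iff.1 (subset_trans (inter_subset_inter_right _ (preimage_mono ?_)) h.subset)
    exact ball_subset_ball' (by rw [mem_ball] at hxw; linarith)
  have hVc : ClopenIn V W := by
    refine ⟨fun w hw => hw.1, hV, ?_⟩
    rw [isOpen_iff_mem_nhds]
    rintro w ⟨hw, hwV⟩
    obtain ⟨r, hr, hrW, h⟩ := hstep w hw
    filter_upwards [ball_mem_nhds w hr] with x hx
    refine ⟨hrW hx, ?_⟩
    rintro ⟨-, ε, hε, hx'⟩
    exact hwV ⟨hw, r, hr, h x hx ε hε hx'⟩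
  obtain ⟨w', hw'⟩ := hne
  have hWV : W ⊆ V := by
    refine hVc.subset_of_isPreconnected hWc Subset.rfl ⟨w', hW'W hw', hW'W hw', ?_⟩
    obtain ⟨ε, hε, hεW⟩ := Metric.isOpen_iff.1 hW' w' hw'
    exact ⟨ε, hε, subset_empty_iff.1
      (subset_trans (inter_subset_inter_right _ (preimage_mono hεW)) hAW'.subset)⟩
  rw [eq_empty_iff_forall_notMem]
  intro x hx
  obtain ⟨-, ε, hε, h⟩ := hWV (hA.subset hx)
  exact (eq_empty_iff_forall_notMem.1 h) x ⟨hx, mem_ball_self hε⟩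

theorem existsExt_of_goodAt (hφ : Continuous φ) (hΩ : IsOpen Ω) (hΩc : Convex ℝ Ω)
    (hg : ∀ w ∈ Ω, GoodAt φ w) : ExistsExt φ Ω := by
  intro W' hW' hW'Ω ⟨c, hc⟩ L hL
  have hu := uniqueExt_of_goodAt hφ hg
  obtain ⟨r, hr, hrW'⟩ := Metric.isOpen_iff.1 hW' c hc
  have hrΩ := hrW'.trans hW'Ω
  let R : Set Z → Set Y → Prop := fun T M => IsOpen T ∧ Convex ℝ T ∧ T ⊆ Ω ∧ c ∈ T ∧
    ClopenIn M (φ ⁻¹' T) ∧ M ∩ φ ⁻¹' (ball c r ∩ T) = L ∩ φ ⁻¹' (ball c r ∩ T)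
  have hcompat : ∀ T M T' M', R T M → R T' M' → M ∩ φ ⁻¹' T' ⊆ M' := by
    rintro T M T' M' ⟨hT, hTc, hTΩ, hcT, hM, hML⟩ ⟨hT', hTc', hTΩ', hcT', hM', hML'⟩
    have heq : M ∩ φ ⁻¹' (T ∩ T') = M' ∩ φ ⁻¹' (T ∩ T') := by
      refine hu.eq (hT.inter hT') (inter_subset_left.trans hTΩ) (hTc.inter hTc').isPreconnected
        (W' := ball c r ∩ (T ∩ T')) inter_subset_right (isOpen_ball.inter (hT.inter hT'))
        ⟨c, mem_ball_self hr, hcT, hcT'⟩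
        (hM.restrict ((hT.inter hT').preimage hφ) (preimage_mono inter_subset_left))
        (hM'.restrict ((hT.inter hT').preimage hφ) (preimage_mono inter_subset_right)) ?_
      ext x
      have h1 := Set.ext_iff.1 hML x
      have h2 := Set.ext_iff.1 hML' x
      simp only [mem_inter_iff, mem_preimage] at h1 h2 ⊢
      tauto
    rintro x ⟨hx, hx'⟩
    have : x ∈ M' ∩ φ ⁻¹' (T ∩ T') := heq ▸ ⟨hx, hM.subset hx, hx'⟩
    exact this.1
  have hRall : ∀ z ∈ Ω, ∃ T M, z ∈ T ∧ R T M := by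
    intro z hz
    let γ : ℝ → Z := fun s => AffineMap.lineMap c z s
    have hγ : Continuous γ := AffineMap.lineMap_continuous
    have hγΩ : ∀ s ∈ Icc (0:ℝ) 1, γ s ∈ Ω := fun s hs =>
      hΩc.segment_subset (hW'Ω hc) hz (by
        rw [segment_eq_image_lineMap]; exact ⟨s, hs, rfl⟩)
    let u : Set ℝ := {s | ∃ T M, γ s ∈ T ∧ R T M}
    have huo : IsOpen u := by
      rw [isOpen_iff_mem_nhds]
      rintro s ⟨T, M, hs, hR⟩
      filter_upwards [(hR.1.preimage hγ).mem_nhds hs] with s' hs'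
      exact ⟨T, M, hs', hR⟩
    have hdown : ∀ s ∈ u, ∀ s', 0 ≤ s' → s' ≤ s → s' ∈ u := by
      rintro s ⟨T, M, hs, hR⟩ s' h0 hle
      refine ⟨T, M, ?_, hR⟩
      rcases h0.eq_or_lt with rfl | hpos
      · simpa [γ] using hR.2.2.2.1
      have hs0 : 0 < s := hpos.trans_le hle
      have := hR.2.1.segment_subset hR.2.2.2.1 hs
      refine this ?_
      rw [segment_eq_image_lineMap]
      refine ⟨s' / s, ⟨by positivity, (div_le_one hs0).2 hle⟩, ?_⟩
      simp only [γ, AffineMap.lineMap_apply_module']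
      rw [add_sub_cancel_right, smul_smul, div_mul_cancel₀ _ hs0.ne']
    have hclosed : ∀ s ∈ Icc (0:ℝ) 1, ∃ η > 0, ∀ s' ∈ u, s' ∈ Icc (0:ℝ) 1 → |s' - s| < η → s ∈ u := by
      intro s hs
      obtain ⟨δ, hδ, hud, hed⟩ := hg _ (hγΩ s hs)
      obtain ⟨δ', hδ', hδΩ⟩ := Metric.isOpen_iff.1 hΩ _ (hγΩ s hs)
      obtain ⟨η, hη, hηγ⟩ := Metric.continuous_iff.1 hγ s (min δ δ') (lt_min hδ hδ')
      refine ⟨η, hη, fun s' hs'u hs' hd => ?_⟩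
      rcases le_total s s' with hle | hle
      · exact hdown s' hs'u s hs.1 hle
      obtain ⟨T, M, hs'T, hT, hTc, hTΩ, hcT, hM, hML⟩ := hs'u
      let B := ball (γ s) δ
      have hs'B : γ s' ∈ B := (hηγ s' hd).trans_le (min_le_left _ _)
      have hTB : IsOpen (T ∩ B) := hT.inter isOpen_ball
      obtain ⟨M', hM', hMM'⟩ := hed.exists_eq hud hφ hTB inter_subset_right
        ⟨_, hs'T, hs'B⟩ (hTc.inter (convex_ball _ _)).isPreconnected
        (hM.restrict (hTB.preimage hφ) (preimage_mono inter_subset_left))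
      have hsegsub : segment ℝ c (γ s) ⊆ T ∪ (B ∩ ball (γ s) δ') := by
        have h1 : segment ℝ c (γ s') ⊆ T := hTc.segment_subset hcT hs'T
        have h2 : segment ℝ (γ s') (γ s) ⊆ B ∩ ball (γ s) δ' :=
          ((convex_ball _ _).inter (convex_ball _ _)).segment_subset
            ⟨hs'B, (hηγ s' hd).trans_le (min_le_right _ _)⟩ ⟨mem_ball_self hδ, mem_ball_self hδ'⟩
        have h3 : segment ℝ c (γ s) ⊆ segment ℝ c (γ s') ∪ segment ℝ (γ s') (γ s) := by
          have e0 : c = γ 0 := by simp [γ]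
          have himg : ∀ a b : ℝ, a ≤ b → segment ℝ (γ a) (γ b) = γ '' Icc a b := by
            intro a b hab
            have := image_segment ℝ (AffineMap.lineMap c z : ℝ →ᵃ[ℝ] Z) a b
            rw [segment_eq_Icc hab] at this
            exact this.symm
          rw [e0, himg 0 s hs.1, himg 0 s' hs'.1, himg s' s hle, ← image_union,
            Icc_union_Icc_eq_Icc hs'.1 hle]
        exact h3.trans (union_subset_union h1 h2)
      have hcomp : IsCompact (segment ℝ c (γ s)) := by
        rw [segment_eq_image_lineMap]
        exact isCompact_Icc.image AffineMap.lineMap_continuous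
      obtain ⟨ε, hε, hεs⟩ := hcomp.exists_thickening_subset_open
        (hT.union (isOpen_ball.inter isOpen_ball)) hsegsub
      set T' := thickening ε (segment ℝ c (γ s)) with hT'def
      have hT' : IsOpen T' := isOpen_thickening
      have hcM : M ∩ φ ⁻¹' B ⊆ M' := by
        rintro x ⟨hx, hxB⟩
        have : x ∈ M' ∩ φ ⁻¹' (T ∩ B) := hMM' ▸ ⟨hx, hM.subset hx, hxB⟩
        exact this.1
      have hcM' : M' ∩ φ ⁻¹' T ⊆ M := by
        rintro x ⟨hx, hxT⟩
        have : x ∈ M ∩ φ ⁻¹' (T ∩ B) := hMM' ▸ ⟨hx, hxT, hM'.subset hx⟩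
        exact this.1
      obtain ⟨hun, hunj⟩ := ClopenIn.iUnion (L := fun b : Bool => cond b M M')
        (S := fun b : Bool => cond b (φ ⁻¹' T) (φ ⁻¹' B)) (by rintro (_ | _) <;> assumption)
        (by
          rintro (_ | _) (_ | _)
          · exact inter_subset_left
          · exact hcM'
          · exact hcM
          · exact inter_subset_left)
      set N := ⋃ b : Bool, cond b M M'
      have hNT : N ∩ φ ⁻¹' T = M := hunj true
      have hT'sub : φ ⁻¹' T' ⊆ ⋃ b : Bool, cond b (φ ⁻¹' T) (φ ⁻¹' B) := by
        intro x hx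
        rcases hεs hx with h | h
        · exact mem_iUnion.2 ⟨true, h⟩
        · exact mem_iUnion.2 ⟨false, h.1⟩
      refine ⟨T', N ∩ φ ⁻¹' T', self_subset_thickening hε _ (right_mem_segment _ _ _), hT',
        (convex_segment _ _).thickening _, ?_, self_subset_thickening hε _ (left_mem_segment _ _ _),
        hun.restrict (hT'.preimage hφ) hT'sub, ?_⟩
      · refine hεs.trans (union_subset hTΩ (inter_subset_right.trans hδΩ))
      · -- agreement near `c`
        have hcb : ball c r ∩ T' ⊆ ball c r := inter_subset_left
        obtain ⟨ρ, hρ, hρT⟩ := Metric.isOpen_iff.1 hT c hcT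
        have hbT : IsOpen (ball c r ∩ T') := isOpen_ball.inter hT'
        have hcT' : c ∈ T' := self_subset_thickening hε _ (left_mem_segment _ _ _)
        have hsubT' : φ ⁻¹' (ball c r ∩ T') ⊆ φ ⁻¹' T' := preimage_mono inter_subset_right
        refine hu.eq hbT (inter_subset_left.trans hrΩ)
          ((convex_ball _ _).inter ((convex_segment _ _).thickening _)).isPreconnected
          (W' := (ball c r ∩ T') ∩ T) inter_subset_left (hbT.inter hT)
          ⟨c, ⟨mem_ball_self hr, hcT'⟩, hcT⟩
          ((hun.restrict (hT'.preimage hφ) hT'sub).restrict (hbT.preimage hφ) hsubT')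
          (hL.restrict (hbT.preimage hφ) (preimage_mono (inter_subset_left.trans hrW'))) ?_
        ext x
        have h1 := Set.ext_iff.1 hML x
        have h2 := Set.ext_iff.1 hNT x
        simp only [mem_inter_iff, mem_preimage] at h1 h2 ⊢
        tauto
    have h0 : (0:ℝ) ∈ u := ⟨ball c r, L ∩ φ ⁻¹' ball c r, by simpa [γ] using hr, isOpen_ball,
      convex_ball _ _, hrΩ, mem_ball_self hr, hL.restrict (isOpen_ball.preimage hφ)
        (preimage_mono hrW'), by rw [inter_self, inter_assoc, inter_self]⟩
    let v : Set ℝ := interior {s | s ∈ Icc (0:ℝ) 1 → s ∉ u}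
    have h1 : (1:ℝ) ∈ u := by
      by_contra h1
      have hcov : Icc (0:ℝ) 1 ⊆ u ∪ v := by
        intro s hs
        by_cases hsu : s ∈ u
        · exact Or.inl hsu
        · obtain ⟨η, hη, h⟩ := hclosed s hs
          refine Or.inr (mem_interior_iff_mem_nhds.2 ?_)
          filter_upwards [ball_mem_nhds s hη] with s' hs' hI hu'
          exact hsu (h s' hu' hI (by simpa [Real.dist_eq] using hs'))
      have h1v : (1:ℝ) ∈ v := (hcov ⟨zero_le_one, le_rfl⟩).resolve_left h1
      obtain ⟨s, hs, hsu, hsv⟩ := isPreconnected_Icc u v huo isOpen_interior hcov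
        ⟨0, ⟨le_rfl, zero_le_one⟩, h0⟩ ⟨1, ⟨zero_le_one, le_rfl⟩, h1v⟩
      exact interior_subset hsv hs hsu
    obtain ⟨T, M, h, hR⟩ := h1
    exact ⟨T, M, by simpa [γ] using h, hR⟩
  let ι := {x : Set Z × Set Y // R x.1 x.2}
  obtain ⟨hun, hunj⟩ := ClopenIn.iUnion (L := fun i : ι => i.1.2) (S := fun i : ι => φ ⁻¹' i.1.1)
    (fun i => i.2.2.2.2.2.1) (fun i j => hcompat _ _ _ _ i.2 j.2)
  have hS : (⋃ i : ι, φ ⁻¹' i.1.1) = φ ⁻¹' Ω := by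
    ext x; constructor
    · intro hx
      obtain ⟨i, hi⟩ := mem_iUnion.1 hx
      exact i.2.2.2.1 hi
    · intro hx
      obtain ⟨T, M, hT, hR⟩ := hRall _ hx
      exact mem_iUnion.2 ⟨⟨(T, M), hR⟩, hT⟩
  rw [hS] at hun
  have hRb : R (ball c r) (L ∩ φ ⁻¹' ball c r) := ⟨isOpen_ball,
      convex_ball _ _, hrΩ, mem_ball_self hr, hL.restrict (isOpen_ball.preimage hφ)
        (preimage_mono hrW'), by rw [inter_self, inter_assoc, inter_self]⟩
  exact ⟨ball c r, hrW', isOpen_ball, ⟨c, mem_ball_self hr⟩, _, hun, hunj ⟨(_, _), hRb⟩⟩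

end Extension

theorem isPreconnected_of_clopenIn {Y : Type*} [TopologicalSpace Y] {S : Set Y} (hS : IsOpen S)
    (h : ∀ L, ClopenIn L S → L.Nonempty → S ⊆ L) : IsPreconnected S := by
  rintro u v hu hv huv ⟨x, hxS, hxu⟩ ⟨y, hyS, hyv⟩
  by_contra hne
  have hL : ClopenIn (S ∩ u) S := by
    refine ⟨inter_subset_left, hS.inter hu, ?_⟩
    have : S \ (S ∩ u) = S ∩ v := by
      ext z; constructor
      · rintro ⟨hz, hzu⟩
        exact ⟨hz, (huv hz).resolve_left fun h => hzu ⟨hz, h⟩⟩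
      · rintro ⟨hz, hzv⟩
        exact ⟨hz, fun h => hne ⟨z, hz, h.2, hzv⟩⟩
    rw [this]; exact hS.inter hv
  exact hne ⟨y, hyS, (h _ hL ⟨x, hxS, hxu⟩ hyS).2, hyv⟩

theorem IsPreconnected.of_thin {Y : Type*} [TopologicalSpace Y] {T S : Set Y} (hTc : IsPreconnected T)
    (hT : IsOpen T) (hS : IsOpen S) (hST : S ⊆ T)
    (hthin : ∀ y ∈ T, ∀ O ∈ 𝓝 y, ∃ O' ∈ 𝓝 y, O' ⊆ O ∧ (O' ∩ S).Nonempty ∧ IsPreconnected (O' ∩ S)) :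
    IsPreconnected S := by
  refine isPreconnected_of_clopenIn hS fun L hL ⟨x, hx⟩ => ?_
  obtain ⟨L', hL', rfl⟩ := hL.exists_extend_thin hT hST hthin
  exact fun y hy => ⟨hL'.subset_of_isPreconnected hTc Subset.rfl ⟨x, hST hx.2, hx.1⟩ (hST hy), hy⟩

theorem Complex.isPreconnected_ball_diff_center (b : ℂ) (r : ℝ) :
    IsPreconnected (ball b r \ {b}) := by
  rcases le_or_gt r 0 with hr | hr
  · rw [ball_eq_empty.2 hr, empty_sdiff]; exact isPreconnected_empty
  have h : ball b r \ {b} = (fun ζ => b + Complex.exp ζ) '' {ζ : ℂ | ζ.re < Real.log r} := by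
    ext z
    simp only [mem_sdiff, mem_ball, mem_singleton_iff, mem_image, mem_ofPred_eq]
    constructor
    · rintro ⟨h1, h2⟩
      have hne : z - b ≠ 0 := sub_ne_zero.2 h2
      refine ⟨Complex.log (z - b), ?_, by rw [Complex.exp_log hne]; ring⟩
      rw [Complex.log_re]
      exact Real.log_lt_log (norm_pos_iff.2 hne) (by rwa [← dist_eq_norm])
    · rintro ⟨ζ, hζ, rfl⟩
      refine ⟨?_, by simp [Complex.exp_ne_zero]⟩
      rw [dist_eq_norm, add_sub_cancel_left, Complex.norm_exp]
      exact (Real.lt_log_iff_exp_lt hr).1 hζ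
  rw [h]
  exact (convex_halfSpace_re_lt _).isPreconnected.image _ (by fun_prop)

theorem Complex.exists_mem_ball_ne (b : ℂ) {r : ℝ} (hr : 0 < r) : (ball b r \ {b}).Nonempty := by
  refine ⟨b + (r / 2 : ℝ), ?_, ?_⟩
  · rw [mem_ball, dist_eq_norm, add_sub_cancel_left, Complex.norm_real, Real.norm_eq_abs,
      abs_of_pos (half_pos hr)]
    linarith
  · simp [hr.ne']

theorem Complex.thin_diff_finite {T F : Set ℂ} (hT : IsOpen T) (hF : F.Finite) :
    ∀ y ∈ T, ∀ O ∈ 𝓝 y, ∃ O' ∈ 𝓝 y, O' ⊆ O ∧ (O' ∩ (T \ F)).Nonempty ∧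
      IsPreconnected (O' ∩ (T \ F)) := by
  intro y hy O hO
  have h1 : IsOpen (F \ {y})ᶜ := (hF.sdiff).isClosed.isOpen_compl
  obtain ⟨r, hr, h⟩ := Metric.mem_nhds_iff.1 (Filter.inter_mem hO
    (Filter.inter_mem (hT.mem_nhds hy) (h1.mem_nhds (by simp))))
  refine ⟨ball y r, ball_mem_nhds y hr, fun x hx => (h hx).1, ?_⟩
  by_cases hyF : y ∈ F
  · have : ball y r ∩ (T \ F) = ball y r \ {y} := by
      ext x; constructor
      · rintro ⟨hx, -, hxF⟩
        exact ⟨hx, fun e => hxF (by rw [mem_singleton_iff.1 e]; exact hyF)⟩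
      · rintro ⟨hx, hxy⟩
        exact ⟨hx, (h hx).2.1, fun hxF => (h hx).2.2 ⟨hxF, hxy⟩⟩
    rw [this]
    exact ⟨Complex.exists_mem_ball_ne y hr, Complex.isPreconnected_ball_diff_center y r⟩
  · have : ball y r ∩ (T \ F) = ball y r := by
      refine inter_eq_left.2 fun x hx => ⟨(h hx).2.1, fun hxF => (h hx).2.2 ⟨hxF, ?_⟩⟩
      rintro rfl; exact hyF hxF
    rw [this]
    exact ⟨⟨y, mem_ball_self hr⟩, (convex_ball y r).isPreconnected⟩

theorem IsPreconnected.diff_finite_complex {T F : Set ℂ} (hTc : IsPreconnected T) (hT : IsOpen T)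
    (hF : F.Finite) : IsPreconnected (T \ F) :=
  hTc.of_thin hT (hT.sdiff hF.isClosed) sdiff_subset (Complex.thin_diff_finite hT hF)

/-- Functions which are polynomial along each complex line. -/
def PolyLike {Z : Type*} [AddCommGroup Z] [Module ℂ Z] (g : Z → ℂ) : Prop :=
  ∀ x v : Z, ∃ P : Polynomial ℂ, ∀ t : ℂ, g (x + t • v) = P.eval t

namespace PolyLike

section Algebra

variable {Z : Type*} [AddCommGroup Z] [Module ℂ Z] {g g' : Z → ℂ}

theorem const (c : ℂ) : PolyLike (fun _ : Z => c) := fun _ _ => ⟨Polynomial.C c, by simp⟩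

theorem add (h : PolyLike g) (h' : PolyLike g') : PolyLike (fun z => g z + g' z) := by
  intro x v
  obtain ⟨P, hP⟩ := h x v
  obtain ⟨P', hP'⟩ := h' x v
  exact ⟨P + P', fun t => by simp [hP, hP']⟩

theorem mul (h : PolyLike g) (h' : PolyLike g') : PolyLike (fun z => g z * g' z) := by
  intro x v
  obtain ⟨P, hP⟩ := h x v
  obtain ⟨P', hP'⟩ := h' x v
  exact ⟨P * P', fun t => by simp [hP, hP']⟩

theorem linear (l : Z →ₗ[ℂ] ℂ) : PolyLike l := by
  intro x v
  exact ⟨Polynomial.C (l x) + Polynomial.C (l v) * Polynomial.X, fun t => by simp; ring⟩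

theorem pow (h : PolyLike g) (k : ℕ) : PolyLike (fun z => g z ^ k) := by
  intro x v
  obtain ⟨P, hP⟩ := h x v
  exact ⟨P ^ k, fun t => by simp [hP]⟩

theorem finset_sum {ι : Type*} (s : Finset ι) {g : ι → Z → ℂ} (h : ∀ i ∈ s, PolyLike (g i)) :
    PolyLike (fun z => ∑ i ∈ s, g i z) := by
  classical
  induction s using Finset.induction_on with
  | empty => simpa using const 0
  | insert a s ha ih =>
    simp_rw [Finset.sum_insert ha]
    exact (h a (by simp)).add (ih fun i hi => h i (by simp [hi]))

theorem polynomial_eval (h : PolyLike g) (P : Polynomial ℂ) : PolyLike (fun z => P.eval (g z)) := by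
  intro x v
  obtain ⟨P', hP'⟩ := h x v
  exact ⟨P.comp P', fun t => by simp [hP']⟩

/-- Evaluation of a polynomial with two-variable coefficients. -/
theorem bivariate_eval (h : PolyLike g) (h' : PolyLike g') (P : Polynomial (Polynomial ℂ)) :
    PolyLike (fun z => (P.map (Polynomial.evalRingHom (g' z))).eval (g z)) := by
  have : (fun z => (P.map (Polynomial.evalRingHom (g' z))).eval (g z)) =
      fun z => ∑ i ∈ P.support, (P.coeff i).eval (g' z) * g z ^ i := by
    funext z
    rw [Polynomial.eval_map, Polynomial.eval₂_eq_sum, Polynomial.sum_def]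
    rfl
  rw [this]
  exact finset_sum _ fun i _ => (h'.polynomial_eval _).mul (h.pow i)

end Algebra

variable {Z : Type*} [NormedAddCommGroup Z] [NormedSpace ℂ Z] {g : Z → ℂ}

theorem exists_ne_zero (hg : PolyLike g) {C : Set Z} (hC : IsOpen C) {c z : Z} (hc : c ∈ C)
    (hz : g z ≠ 0) : ∃ x ∈ C, g x ≠ 0 := by
  obtain ⟨P, hP⟩ := hg c (z - c)
  have hP0 : P ≠ 0 := by
    rintro rfl
    have := hP 1
    simp at this
    exact hz this
  have hΩ : IsOpen {t : ℂ | c + t • (z - c) ∈ C} := hC.preimage (by fun_prop)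
  obtain ⟨O', hO', hO'sub, ⟨t, htO, htC, htP⟩, -⟩ :=
    Complex.thin_diff_finite hΩ (Polynomial.finite_setOfPred_isRoot hP0) 0 (by simpa using hc) univ Filter.univ_mem
  exact ⟨_, htC, by rw [hP]; exact htP⟩

theorem isPreconnected_inter (hg : PolyLike g) {C : Set Z} (hC : IsOpen C)
    (hCc : Convex ℝ C) : IsPreconnected (C ∩ {z | g z ≠ 0}) := by
  refine isPreconnected_of_forall_pair ?_
  rintro x ⟨hxC, hx⟩ y ⟨hyC, hy⟩
  obtain ⟨P, hP⟩ := hg x (y - x)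
  have hP0 : P ≠ 0 := by
    rintro rfl
    have := hP 0
    simp at this
    exact hx this
  let l : ℂ →ᵃ[ℝ] Z := ((LinearMap.toSpanSingleton ℂ Z (y - x)).restrictScalars ℝ).toAffineMap +
    AffineMap.const ℝ ℂ x
  have hl : ∀ t, l t = x + t • (y - x) := fun t => by simp [l, add_comm]
  have hlc : Continuous l := by
    have : (l : ℂ → Z) = fun t => x + t • (y - x) := funext hl
    rw [this]; fun_prop
  have hΩ : IsOpen (l ⁻¹' C) := hC.preimage hlc
  have hΩc : IsPreconnected (l ⁻¹' C \ {t | P.eval t = 0}) :=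
    (hCc.affine_preimage l).isPreconnected.diff_finite_complex hΩ (Polynomial.finite_setOfPred_isRoot hP0)
  refine ⟨l '' (l ⁻¹' C \ {t | P.eval t = 0}), ?_, ?_, ?_, hΩc.image _ hlc.continuousOn⟩
  · rintro _ ⟨t, ⟨htC, ht⟩, rfl⟩
    refine ⟨htC, ?_⟩
    rw [mem_ofPred_eq, hl, hP]; exact ht
  · refine ⟨0, ⟨by simpa [hl] using hxC, ?_⟩, by simp [hl]⟩
    rw [mem_ofPred_eq, ← hP]; simpa using hx
  · refine ⟨1, ⟨by simpa [hl] using hyC, ?_⟩, by simp [hl]⟩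
    rw [mem_ofPred_eq, ← hP]; simpa using hy

end PolyLike

/-- Evaluation of a polynomial with polynomial coefficients: the inner variable at `x`, the outer
variable at `y`. -/
noncomputable def eval2 (P : ℂ[X][X]) (x y : ℂ) : ℂ := (P.map (evalRingHom x)).eval y

/-- The locus where the fibre has a multiple point is given by a polynomial. -/
theorem exists_critical_locus (H : ℂ[X][X]) (N : ℕ)
    (hdeg : ∀ x, (H.map (evalRingHom x)).natDegree = N) (hN : 1 ≤ N) :
    ∃ Q : ℂ[X][X], ∀ x w, eval2 Q w x = 0 ↔
      ∃ t, eval2 H x t = w ∧ eval2 (derivative H) x t = 0 := by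
  let G : ℂ[X][X][X] := H.map (mapRingHom C) - C (C X)
  refine ⟨resultant G (derivative G) N (N - 1), fun x w => ?_⟩
  let ev : ℂ[X][X] →+* ℂ := (evalRingHom x).comp (mapRingHom (evalRingHom w))
  have hev : ∀ P, ev P = eval2 P w x := fun P => by simp [ev, eval2]
  have hG : G.map ev = H.map (evalRingHom x) - C w := by
    have : ev.comp (mapRingHom C) = evalRingHom x := by
      ext <;> simp [ev]
    simp [G, Polynomial.map_map, this, ev]
  have hnd : (H.map (evalRingHom x) - C w).natDegree = N := by
    rw [natDegree_sub_C, hdeg]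
  have hne : (H.map (evalRingHom x) - C w) ≠ 0 := by
    intro h; rw [h] at hnd; simp at hnd; omega
  rw [← hev, ← resultant_map_map, ← derivative_map, hG]
  have := resultant_eq_prod_eval (H.map (evalRingHom x) - C w)
    (derivative (H.map (evalRingHom x) - C w)) (N - 1)
    ((natDegree_derivative_le _).trans (by rw [hnd])) (IsAlgClosed.splits _)
  rw [hnd] at this
  rw [this, mul_eq_zero, Multiset.prod_eq_zero_iff, Multiset.mem_map]
  have hlc : (H.map (evalRingHom x) - C w).leadingCoeff ^ (N - 1) ≠ 0 :=
    pow_ne_zero _ (leadingCoeff_ne_zero.2 hne)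
  simp only [hlc, false_or]
  refine exists_congr fun t => ?_
  rw [mem_roots hne]
  simp [eval2, IsRoot, sub_eq_zero, derivative_map]

theorem exists_clear_denominators (p : (FractionRing ℂ[X])[X]) :
    ∃ r : ℂ[X], r ≠ 0 ∧ ∃ P : ℂ[X][X], P.map (algebraMap ℂ[X] (FractionRing ℂ[X])) =
      C (algebraMap ℂ[X] (FractionRing ℂ[X]) r) * p := by
  obtain ⟨r, hrm, hr⟩ := IsLocalization.integerNormalization_spec (nonZeroDivisors ℂ[X]) p
  refine ⟨r, nonZeroDivisors.ne_zero hrm, _, hr.trans ?_⟩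
  ext n; simp [Algebra.smul_def]

/-- Outside finitely many parameters, the zero set of a polynomial is cut out by a polynomial
without multiple roots. -/
theorem exists_squarefree_part (Q : ℂ[X][X]) (hQ : Q ≠ 0) :
    ∃ (G : ℂ[X][X]) (B : Set ℂ), B.Finite ∧ ∀ w ∉ B, (∀ x, eval2 Q w x = 0 ↔ eval2 G w x = 0) ∧
      (∀ x, eval2 G w x = 0 → eval2 (derivative G) w x ≠ 0) ∧ G.leadingCoeff.eval w ≠ 0 := by
  classical
  let K := FractionRing ℂ[X]
  let ι := algebraMap ℂ[X] K
  have hι : Function.Injective ι := IsFractionRing.injective ℂ[X] K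
  have hmi : Function.Injective (Polynomial.map ι) := Polynomial.map_injective ι hι
  let q : K[X] := Q.map ι
  have hq : q ≠ 0 := by
    intro h; apply hQ; apply hmi; simpa [q] using h
  obtain ⟨g, hgsq, hgq, k, hqg⟩ : ∃ g : K[X], Squarefree g ∧ g ∣ q ∧ ∃ k : ℕ, q ∣ g ^ k := by
    refine ⟨UniqueFactorizationMonoid.radical q, UniqueFactorizationMonoid.squarefree_radical,
      UniqueFactorizationMonoid.radical_dvd_self, ?_⟩
    exact UniqueFactorizationMonoid.exists_dvd_radical_self_pow hq
  have hsep : g.Separable := PerfectField.separable_iff_squarefree.2 hgsq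
  obtain ⟨a, b, hab⟩ := hsep
  obtain ⟨c, hc⟩ := hgq
  obtain ⟨c', hc'⟩ := hqg
  obtain ⟨r, hr, G, hG⟩ := exists_clear_denominators g
  obtain ⟨ra, hra, A, hA⟩ := exists_clear_denominators a
  obtain ⟨rb, hrb, B, hB⟩ := exists_clear_denominators b
  obtain ⟨rc, hrc, P, hP⟩ := exists_clear_denominators c
  obtain ⟨rc', hrc', P', hP'⟩ := exists_clear_denominators c'
  change G.map ι = C (ι r) * g at hG
  change A.map ι = C (ι ra) * a at hA
  change B.map ι = C (ι rb) * b at hB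
  change P.map ι = C (ι rc) * c at hP
  change P'.map ι = C (ι rc') * c' at hP'
  have e1 : G * P = C (r * rc) * Q := by
    apply hmi
    simp only [Polynomial.map_mul, hG, hP, Polynomial.map_C]
    change _ = C (ι (r * rc)) * q
    rw [hc, map_mul, map_mul]; ring
  have e2 : Q * P' * C (r ^ k) = C rc' * G ^ k := by
    apply hmi
    simp only [Polynomial.map_mul, Polynomial.map_pow, hG, hP', Polynomial.map_C]
    change q * _ * _ = _
    rw [mul_pow, hc', map_pow, map_pow]; ring
  have e3 : C rb * A * G + C ra * B * derivative G = C (r * ra * rb) := by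
    apply hmi
    simp only [Polynomial.map_mul, Polynomial.map_add, ← derivative_map, hG, hA, hB,
      Polynomial.map_C, derivative_mul, derivative_C, zero_mul, zero_add]
    rw [map_mul, map_mul, map_mul, map_mul]
    linear_combination (C (ι r) * C (ι ra) * C (ι rb)) * hab
  have hG0 : G ≠ 0 := by
    rintro rfl
    rw [zero_mul] at e1
    have := (mul_eq_zero.1 e1.symm).resolve_right hQ
    rw [C_eq_zero] at this
    exact mul_ne_zero hr hrc this
  have hprod : r * ra * rb * rc * rc' * G.leadingCoeff ≠ 0 :=
    mul_ne_zero (mul_ne_zero (mul_ne_zero (mul_ne_zero (mul_ne_zero hr hra) hrb) hrc) hrc')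
      (leadingCoeff_ne_zero.2 hG0)
  refine ⟨G, {w | IsRoot (r * ra * rb * rc * rc' * G.leadingCoeff) w},
    finite_setOfPred_isRoot hprod, fun w hw => ?_⟩
  simp only [mem_ofPred_eq, IsRoot, eval_mul, mul_eq_zero, not_or] at hw
  obtain ⟨⟨⟨⟨⟨h1, h2⟩, h3⟩, h4⟩, h5⟩, h6⟩ := hw
  have E1 : ∀ x, eval2 G w x * eval2 P w x = r.eval w * rc.eval w * eval2 Q w x := fun x => by
    simpa [eval2] using congrArg (fun R => eval2 R w x) e1
  have E2 : ∀ x, eval2 Q w x * eval2 P' w x * r.eval w ^ k = rc'.eval w * eval2 G w x ^ k :=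
    fun x => by simpa [eval2] using congrArg (fun R => eval2 R w x) e2
  have E3 : ∀ x, rb.eval w * eval2 A w x * eval2 G w x +
      ra.eval w * eval2 B w x * eval2 (derivative G) w x = r.eval w * ra.eval w * rb.eval w :=
    fun x => by simpa [eval2] using congrArg (fun R => eval2 R w x) e3
  refine ⟨fun x => ⟨fun h => ?_, fun h => ?_⟩, fun x h h' => ?_, h6⟩
  · have := E2 x
    rw [h, zero_mul, zero_mul] at this
    exact eq_zero_of_pow_eq_zero ((mul_eq_zero.1 this.symm).resolve_left h5)
  · have := E1 x
    rw [h, zero_mul] at this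
    exact (mul_eq_zero.1 this.symm).resolve_left (mul_ne_zero h1 h4)
  · have := E3 x
    rw [h, h'] at this
    simp at this
    tauto

theorem eval2_eq_sum (P : ℂ[X][X]) (x y : ℂ) :
    eval2 P x y = ∑ i ∈ Finset.range (P.natDegree + 1), (P.coeff i).eval x * y ^ i := by
  rw [eval2, eval_eq_sum_range' (n := P.natDegree + 1)]
  · simp
  · exact Nat.lt_succ_of_le natDegree_map_le

theorem contDiff_eval2 (P : ℂ[X][X]) (n : WithTop ℕ∞) :
    ContDiff ℂ n (fun y : ℂ × ℂ => eval2 P y.1 y.2) := by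
  simp only [eval2_eq_sum]
  refine ContDiff.sum fun i _ => ContDiff.mul ?_ (contDiff_snd.pow i)
  exact (Polynomial.contDiff_aeval (P.coeff i) n).comp contDiff_fst

theorem continuous_eval2 (P : ℂ[X][X]) : Continuous (fun y : ℂ × ℂ => eval2 P y.1 y.2) :=
  (contDiff_eval2 P 0).continuous

theorem isLocalHomeomorphOn_graph (P : ℂ[X][X]) :
    IsLocalHomeomorphOn (fun y : ℂ × ℂ => (y.1, eval2 P y.1 y.2))
      {y | eval2 (derivative P) y.1 y.2 ≠ 0} := by
  refine IsLocalHomeomorphOn.mk _ _ fun y hy => ?_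
  have h1 : HasStrictFDerivAt (fun y : ℂ × ℂ => eval2 P y.1 y.2)
      (fderiv ℂ (fun y : ℂ × ℂ => eval2 P y.1 y.2) y) y :=
    (contDiff_eval2 P 1).contDiffAt.hasStrictFDerivAt one_ne_zero
  set A := fderiv ℂ (fun y : ℂ × ℂ => eval2 P y.1 y.2) y
  have h2 : A (0, 1) = eval2 (derivative P) y.1 y.2 := by
    have e : HasDerivAt (fun t : ℂ => (y.1, t)) ((0 : ℂ), (1 : ℂ)) y.2 :=
      (hasDerivAt_const _ _).prodMk (hasDerivAt_id _)
    have e1 : HasDerivAt (fun t : ℂ => eval2 P y.1 t) (A (0, 1)) y.2 :=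
      (HasStrictFDerivAt.hasFDerivAt h1).comp_hasDerivAt (f := fun t : ℂ => (y.1, t)) y.2 e
    have e2 : HasDerivAt (fun t : ℂ => eval2 P y.1 t) (eval2 (derivative P) y.1 y.2) y.2 := by
      have := (P.map (evalRingHom y.1)).hasDerivAt y.2
      rwa [derivative_map] at this
    exact e1.unique e2
  have h3 : HasStrictFDerivAt (fun y : ℂ × ℂ => (y.1, eval2 P y.1 y.2))
      ((ContinuousLinearMap.fst ℂ ℂ ℂ).prod A) y := hasStrictFDerivAt_fst.prodMk h1
  have hinj : Function.Injective ((ContinuousLinearMap.fst ℂ ℂ ℂ).prod A : ℂ × ℂ →ₗ[ℂ] ℂ × ℂ) := by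
    rw [injective_iff_map_eq_zero]
    rintro ⟨a, b⟩ hab
    have ha : a = 0 := congrArg Prod.fst hab
    have hb : A (a, b) = 0 := congrArg Prod.snd hab
    subst ha
    have : ((0 : ℂ), b) = b • ((0 : ℂ), (1 : ℂ)) := by simp
    rw [this, map_smul, h2, smul_eq_mul, mul_eq_zero] at hb
    rw [hb.resolve_right hy]; rfl
  let T : (ℂ × ℂ) ≃L[ℂ] (ℂ × ℂ) := (LinearEquiv.ofInjectiveEndo _ hinj).toContinuousLinearEquiv
  have hT : (T : ℂ × ℂ →L[ℂ] ℂ × ℂ) = (ContinuousLinearMap.fst ℂ ℂ ℂ).prod A := by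
    ext <;> rfl
  rw [← hT] at h3
  exact ⟨h3.toOpenPartialHomeomorph _, h3.mem_toOpenPartialHomeomorph_source, fun z _ => rfl⟩

theorem norm_le_of_eval2_eq (P : ℂ[X][X]) (hP : 1 ≤ P.natDegree) {x t : ℂ}
    (hx : P.leadingCoeff.eval x ≠ 0) :
    ‖t‖ ≤ 1 + ((∑ i ∈ Finset.range P.natDegree, ‖(P.coeff i).eval x‖) + ‖eval2 P x t‖) /
      ‖P.leadingCoeff.eval x‖ := by
  rcases le_or_gt ‖t‖ 1 with h | h
  · exact h.trans (le_add_of_nonneg_right (by positivity))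
  obtain ⟨m, hm⟩ : ∃ m, P.natDegree = m + 1 := ⟨P.natDegree - 1, by omega⟩
  refine le_trans ?_ (le_add_of_nonneg_left zero_le_one)
  rw [le_div_iff₀ (norm_pos_iff.2 hx)]
  have h0 : P.leadingCoeff.eval x * t ^ (m + 1) = eval2 P x t -
      ∑ i ∈ Finset.range (m + 1), (P.coeff i).eval x * t ^ i := by
    rw [eval2_eq_sum, hm, Finset.sum_range_succ, leadingCoeff, hm]; ring
  have ht : 0 < ‖t‖ ^ m := by positivity
  refine le_of_mul_le_mul_right ?_ ht
  calc ‖t‖ * ‖P.leadingCoeff.eval x‖ * ‖t‖ ^ m = ‖P.leadingCoeff.eval x * t ^ (m + 1)‖ := by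
        rw [norm_mul, norm_pow]; ring
    _ ≤ ‖eval2 P x t‖ + ∑ i ∈ Finset.range (m + 1), ‖(P.coeff i).eval x * t ^ i‖ := by
        rw [h0]; exact (norm_sub_le _ _).trans (add_le_add le_rfl (norm_sum_le _ _))
    _ ≤ ‖eval2 P x t‖ * ‖t‖ ^ m + ∑ i ∈ Finset.range (m + 1), ‖(P.coeff i).eval x‖ * ‖t‖ ^ m := by
        refine add_le_add (le_mul_of_one_le_right (norm_nonneg _) (one_le_pow₀ h.le))
          (Finset.sum_le_sum fun i hi => ?_)
        rw [norm_mul, norm_pow]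
        refine mul_le_mul_of_nonneg_left (pow_le_pow_right₀ h.le ?_) (norm_nonneg _)
        have := Finset.mem_range.1 hi; omega
    _ = _ := by rw [← Finset.sum_mul, hm]; ring

/-- The graph map of a polynomial is a covering away from its critical values. -/
theorem coveringOnto_graph (P : ℂ[X][X]) {U : Set (ℂ × ℂ)} (hU : IsOpen U)
    (h : ∀ u ∈ U, P.leadingCoeff.eval u.1 ≠ 0 ∧
      ∀ t, eval2 P u.1 t = u.2 → eval2 (derivative P) u.1 t ≠ 0) :
    CoveringOnto (fun y : {y : ℂ × ℂ // (y.1, eval2 P y.1 y.2) ∈ U} =>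
      (y.1.1, eval2 P y.1.1 y.1.2)) U := by
  refine ⟨fun y => y.2, ?_⟩
  let κ : ℂ × ℂ → ℂ × ℂ := fun y => (y.1, eval2 P y.1 y.2)
  have hκ : Continuous κ := continuous_fst.prodMk (continuous_eval2 P)
  let ψ : κ ⁻¹' U → U := U.restrictPreimage κ
  change IsCoveringMap ψ
  have hψ : Continuous ψ := hκ.restrictPreimage
  have hloc : IsLocalHomeomorph ψ := by
    have h1 : IsLocalHomeomorphOn κ (κ ⁻¹' U) :=
      (isLocalHomeomorphOn_graph P).mono fun y hy => (h _ hy).2 _ rfl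
    have h2 : IsLocalHomeomorph (κ ∘ (Subtype.val : κ ⁻¹' U → ℂ × ℂ)) := by
      rw [isLocalHomeomorph_iff_isLocalHomeomorphOn_univ]
      exact h1.comp (hU.preimage hκ).isOpenEmbedding_subtypeVal.isLocalHomeomorph.isLocalHomeomorphOn
        fun y _ => y.2
    have h3 : κ ∘ (Subtype.val : κ ⁻¹' U → ℂ × ℂ) = Subtype.val ∘ ψ := rfl
    rw [h3] at h2
    exact h2.of_comp hU.isOpenEmbedding_subtypeVal.isLocalHomeomorph hψ
  have hproper : IsProperMap ψ := by
    have : LocallyCompactSpace U := hU.locallyCompactSpace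
    refine isProperMap_iff_isCompact_preimage.2 ⟨hψ, fun K hK => ?_⟩
    rw [Subtype.isCompact_iff]
    by_cases hdeg : 1 ≤ P.natDegree
    · let β : U → ℝ := fun u => 1 + ((∑ i ∈ Finset.range P.natDegree, ‖(P.coeff i).eval u.1.1‖) +
        ‖u.1.2‖) / ‖P.leadingCoeff.eval u.1.1‖
      have hβ : Continuous β := by
        refine continuous_const.add (Continuous.div ?_ ?_ fun u => norm_ne_zero_iff.2 (h _ u.2).1)
        · refine Continuous.add (continuous_finsetSum _ fun i _ => ?_) (by fun_prop)
          exact ((P.coeff i).continuous.comp (by fun_prop)).norm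
        · exact (P.leadingCoeff.continuous.comp (by fun_prop)).norm
      obtain ⟨M, hM⟩ := hK.exists_bound_of_continuousOn hβ.continuousOn
      have hK' : IsCompact (Subtype.val '' K) := hK.image continuous_subtype_val
      have himg : Subtype.val '' (ψ ⁻¹' K) = κ ⁻¹' (Subtype.val '' K) := by
        ext y; constructor
        · rintro ⟨y, hy, rfl⟩; exact ⟨_, hy, rfl⟩
        · rintro ⟨u, hu, huy⟩
          have : κ y ∈ U := huy ▸ u.2
          refine ⟨⟨y, this⟩, ?_, rfl⟩
          have e : ψ ⟨y, this⟩ = u := Subtype.ext huy.symm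
          simpa only [mem_preimage, e]
      rw [himg]
      refine IsCompact.of_isClosed_subset
        ((hK'.image continuous_fst).prod (isCompact_closedBall (0 : ℂ) M))
        (hK'.isClosed.preimage hκ) fun y hy => ⟨⟨_, hy, rfl⟩, ?_⟩
      obtain ⟨u, hu, huy⟩ := hy
      rw [mem_closedBall_zero_iff]
      have h1 := hM u hu
      have h2 := norm_le_of_eval2_eq P hdeg (t := y.2) (h _ u.2).1
      have e1 : u.1.1 = y.1 := by rw [huy]
      have e2 : u.1.2 = eval2 P y.1 y.2 := by rw [huy]
      refine le_trans ?_ ((le_abs_self _).trans h1)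
      simp only [β, e2]
      rwa [e1] at h2 ⊢
    · have : IsEmpty (κ ⁻¹' U) := by
        refine ⟨fun y => (h _ y.2).2 _ rfl ?_⟩
        rw [derivative_of_natDegree_zero (by omega)]
        simp [eval2]
      simp [Set.eq_empty_of_isEmpty]
  have hfin : ∀ u, (ψ ⁻¹' {u}).Finite := fun u =>
    (hproper.isCompact_preimage isCompact_singleton).finite
      ((hloc.isLocalHomeomorphOn (s := ψ ⁻¹' {u})).isDiscrete_of_image
        ((Set.subsingleton_singleton.anti (image_preimage_subset _ _)).isDiscrete))
  rw [isCoveringMap_iff_isCoveringMapOn_univ]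
  exact hproper.isClosedMap.isCoveringMapOn_of_isLocalHomeomorphOn (fun u _ => hfin u)
    hloc.isLocalHomeomorphOn

section Transport

variable {Y Z : Type*} [TopologicalSpace Y] [NormedAddCommGroup Z] [NormedSpace ℝ Z]

/-- Relatively clopen sets can be extended along a transport to a fibre. -/
theorem exists_clopenIn_of_transport {φ : Y → Z} (hφ : Continuous φ) {S : Set Y} (hS : IsOpen S)
    {O : Set Z} (hO : IsOpen O) {w₁ : Z}
    (C : unitInterval × ↥(S ∩ φ ⁻¹' O) → Y) (hC : Continuous C) (hCS : ∀ x, C x ∈ S)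
    (hC0 : ∀ e, C (0, e) = e)
    (hCφ : ∀ s e, φ (C (s, e)) = (1 - (s : ℝ)) • φ e + (s : ℝ) • w₁)
    {W' : Set Z} (hW' : IsOpen W') (hw₁' : w₁ ∈ W') (hW'O : W' ⊆ O)
    {L : Set Y} (hL : ClopenIn L (S ∩ φ ⁻¹' W')) :
    ∃ L', ClopenIn L' (S ∩ φ ⁻¹' O) ∧ ∃ ε > 0, ball w₁ ε ⊆ W' ∧
      L' ∩ φ ⁻¹' ball w₁ ε = L ∩ φ ⁻¹' ball w₁ ε := by
  have hSO : IsOpen (S ∩ φ ⁻¹' O) := hS.inter (hO.preimage hφ)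
  let C₁ : ↥(S ∩ φ ⁻¹' O) → Y := fun e => C (1, e)
  have hC₁ : Continuous C₁ := by fun_prop
  have hC₁φ : ∀ e, C₁ e ∈ S ∩ φ ⁻¹' W' := fun e => ⟨hCS _, by
    simp only [C₁, mem_preimage, hCφ]; simpa using hw₁'⟩
  obtain ⟨ε, hε, hεW'⟩ := Metric.isOpen_iff.1 hW' _ hw₁'
  refine ⟨Subtype.val '' (C₁ ⁻¹' L), ⟨?_, ?_, ?_⟩, ε, hε, hεW', ?_⟩
  · rintro _ ⟨e, -, rfl⟩; exact e.2
  · exact hSO.isOpenMap_subtype_val _ (hL.isOpen.preimage hC₁)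
  · have : (S ∩ φ ⁻¹' O) \ Subtype.val '' (C₁ ⁻¹' L) =
        Subtype.val '' (C₁ ⁻¹' ((S ∩ φ ⁻¹' W') \ L)) := by
      ext y; constructor
      · rintro ⟨hy, hy'⟩
        exact ⟨⟨y, hy⟩, ⟨hC₁φ _, fun h => hy' ⟨_, h, rfl⟩⟩, rfl⟩
      · rintro ⟨e, he, rfl⟩
        refine ⟨e.2, ?_⟩
        rintro ⟨e', he', h⟩
        rw [Subtype.ext h] at he'
        exact he.2 he'
    rw [this]
    exact hSO.isOpenMap_subtype_val _ (hL.isOpen_diff.preimage hC₁)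
  · have key : ∀ e : ↥(S ∩ φ ⁻¹' O), φ e ∈ ball w₁ ε → (C₁ e ∈ L ↔ (e : Y) ∈ L) := by
      intro e he
      let γ : unitInterval → Y := fun s => C (s, e)
      have hγ : Continuous γ := by fun_prop
      have hpc : IsPreconnected (range γ) := isPreconnected_range hγ
      have hsub : range γ ⊆ S ∩ φ ⁻¹' W' := by
        rintro _ ⟨s, rfl⟩
        refine ⟨hCS _, hεW' ?_⟩
        simp only [γ, hCφ]
        refine convex_ball w₁ ε he (mem_ball_self hε) ?_ s.2.1 (by ring)
        linarith [s.2.2]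
      have h0 : (e : Y) ∈ range γ := ⟨0, hC0 e⟩
      have h1 : C₁ e ∈ range γ := ⟨1, rfl⟩
      exact ⟨fun h => hL.subset_of_isPreconnected hpc hsub ⟨_, h1, h⟩ h0,
        fun h => hL.subset_of_isPreconnected hpc hsub ⟨_, h0, h⟩ h1⟩
    ext y; constructor
    · rintro ⟨⟨e, he, rfl⟩, hy⟩
      exact ⟨(key e hy).1 he, hy⟩
    · rintro ⟨he, hy⟩
      have : y ∈ S ∩ φ ⁻¹' O := ⟨(hL.subset he).1, hW'O (hL.subset he).2⟩
      exact ⟨⟨⟨y, this⟩, (key ⟨y, this⟩ hy).2 he, rfl⟩, hy⟩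

end Transport

/-- Zero sets of polynomials with simple roots depend on the parameter through an isotopy. -/
theorem exists_root_transport (G : ℂ[X][X]) {w₀ : ℂ} (hlc : G.leadingCoeff.eval w₀ ≠ 0)
    (hsimple : ∀ x, eval2 G w₀ x = 0 → eval2 (derivative G) w₀ x ≠ 0) :
    ∃ δ > 0, ∀ w₁ ∈ ball w₀ δ, ∃ c : unitInterval × (ℂ × ℂ) → ℂ,
      ContinuousOn c {x | x.2.2 ∈ ball w₀ δ} ∧ (∀ u, c (0, u) = u.1) ∧
      ∀ (s : unitInterval) u, u.2 ∈ ball w₀ δ → eval2 G u.2 u.1 ≠ 0 →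
        eval2 G ((1 - (s : ℝ)) • u.2 + (s : ℝ) • w₁) (c (s, u)) ≠ 0 := by
  classical
  set g := G.map (evalRingHom w₀) with hg
  have hgdeg : g.natDegree = G.natDegree := natDegree_map_of_leadingCoeff_ne_zero _ hlc
  have hg0 : g ≠ 0 := by
    intro h
    have : g.coeff G.natDegree = 0 := by rw [h]; simp
    simp only [hg, coeff_map] at this
    exact hlc this
  set R := g.roots.toFinset
  have hRmem : ∀ r, r ∈ R ↔ eval2 G w₀ r = 0 := fun r => by
    rw [Multiset.mem_toFinset, mem_roots hg0]; rfl
  have hRcard : R.card = G.natDegree := by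
    rw [Multiset.toFinset_card_of_nodup, ← hgdeg]
    · exact (IsAlgClosed.splits g).natDegree_eq_card_roots.symm
    · rw [Multiset.nodup_iff_count_le_one]
      intro a
      rw [count_roots]
      by_contra! h
      rw [one_lt_rootMultiplicity_iff_isRoot hg0] at h
      refine hsimple a h.1 ?_
      have := h.2
      rwa [hg, derivative_map] at this
  have hρ : ∀ r, ∃ ρ : ℂ → ℂ, r ∈ R → ρ w₀ = r ∧
      ∀ᶠ w in 𝓝 w₀, ContinuousAt ρ w ∧ eval2 G w (ρ w) = 0 := by
    intro r
    by_cases hr : r ∈ R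
    swap
    · exact ⟨id, fun h => absurd h hr⟩
    obtain ⟨e, hes, he⟩ := isLocalHomeomorphOn_graph G (w₀, r) (hsimple r ((hRmem r).1 hr))
    have he0 : e (w₀, r) = (w₀, 0) := by rw [← he]; simp only [(hRmem r).1 hr]
    have ht : (w₀, (0 : ℂ)) ∈ e.target := he0 ▸ e.map_source hes
    refine ⟨fun w => (e.symm (w, 0)).2, fun _ => ⟨?_, ?_⟩⟩
    · change (e.symm (w₀, 0)).2 = r
      rw [← he0, e.left_inv hes]
    · have hcont : Continuous fun w : ℂ => (w, (0 : ℂ)) := by fun_prop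
      filter_upwards [hcont.continuousAt.preimage_mem_nhds (e.open_target.mem_nhds ht)] with w hw
      refine ⟨?_, ?_⟩
      · exact continuous_snd.continuousAt.comp
          (ContinuousAt.comp (f := fun w : ℂ => (w, (0 : ℂ))) (e.continuousAt_symm hw)
            hcont.continuousAt)
      · have h1 : e (e.symm (w, 0)) = (w, 0) := e.right_inv hw
        rw [← he] at h1
        have h2 : (e.symm (w, 0)).1 = w := congrArg Prod.fst h1
        have h3 : eval2 G (e.symm (w, 0)).1 (e.symm (w, 0)).2 = 0 := congrArg Prod.snd h1
        rwa [h2] at h3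
  choose ρ hρ using hρ
  obtain ⟨η, hη, hsep⟩ : ∃ η > 0, ∀ r ∈ R, ∀ r' ∈ R, r ≠ r' → 4 * η < ‖r - r'‖ := by
    have : ∀ᶠ η : ℝ in 𝓝[>] 0, ∀ r ∈ R, ∀ r' ∈ R, r ≠ r' → 4 * η < ‖r - r'‖ := by
      rw [Filter.eventually_all_finset]; intro r hr
      rw [Filter.eventually_all_finset]; intro r' hr'
      by_cases h : r = r'
      · simp [h]
      · have : ContinuousAt (fun η : ℝ => 4 * η) 0 := by fun_prop
        have h2 := this.eventually_lt (continuousAt_const (y := ‖r - r'‖))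
          (by simpa [sub_eq_zero] using h)
        filter_upwards [nhdsWithin_le_nhds h2] with η hη _ using hη
    obtain ⟨η, h1, h2⟩ := (this.and self_mem_nhdsWithin).exists
    exact ⟨η, h2, h1⟩
  obtain ⟨δ, hδ, hball⟩ : ∃ δ > 0, ∀ w ∈ ball w₀ δ, G.leadingCoeff.eval w ≠ 0 ∧
      ∀ r ∈ R, ContinuousAt (ρ r) w ∧ eval2 G w (ρ r w) = 0 ∧ ‖ρ r w - r‖ < η / 8 := by
    have h1 : ∀ᶠ w in 𝓝 w₀, G.leadingCoeff.eval w ≠ 0 ∧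
      ∀ r ∈ R, ContinuousAt (ρ r) w ∧ eval2 G w (ρ r w) = 0 ∧ ‖ρ r w - r‖ < η / 8 := by
      refine (G.leadingCoeff.continuousAt.eventually_ne hlc).and ?_
      rw [Filter.eventually_all_finset]; intro r hr
      obtain ⟨h2, h3⟩ := hρ r hr
      have h4 : ContinuousAt (fun w => ‖ρ r w - r‖) w₀ :=
        (h3.self_of_nhds.1.sub continuousAt_const).norm
      have h5 := h4.eventually_lt (continuousAt_const (y := η / 8)) (by simp [h2, hη])
      filter_upwards [h3, h5] with w hw hw' using ⟨hw.1, hw.2, hw'⟩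
    obtain ⟨δ, hδ, h⟩ := Metric.eventually_nhds_iff_ball.1 h1
    exact ⟨δ, hδ, h⟩
  have hall : ∀ w ∈ ball w₀ δ, ∀ x, eval2 G w x = 0 → ∃ r ∈ R, x = ρ r w := by
    intro w hw x hx
    obtain ⟨hlcw, hrw⟩ := hball w hw
    have hgw : G.map (evalRingHom w) ≠ 0 := by
      intro h
      have : (G.map (evalRingHom w)).coeff G.natDegree = 0 := by rw [h]; simp
      simp only [coeff_map] at this
      exact hlcw this
    have hinj : Set.InjOn (fun r => ρ r w) R := by
      intro r hr r' hr' h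
      by_contra hne
      have h1 := hsep r hr r' hr' hne
      have h2 := (hrw r hr).2.2
      have h3 := (hrw r' hr').2.2
      have h4 : r - r' = (ρ r' w - r') - (ρ r w - r) := by
        simp only at h; rw [h]; ring
      have h5 := norm_sub_le (ρ r' w - r') (ρ r w - r)
      rw [← h4] at h5
      linarith
    have hsub : R.image (fun r => ρ r w) ⊆ (G.map (evalRingHom w)).roots.toFinset := by
      intro y hy
      obtain ⟨r, hr, rfl⟩ := Finset.mem_image.1 hy
      rw [Multiset.mem_toFinset, mem_roots hgw]
      exact (hrw r hr).2.1
    have heq := Finset.eq_of_subset_of_card_le hsub (by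
      rw [Finset.card_image_of_injOn hinj, hRcard]
      exact (Multiset.toFinset_card_le _).trans ((card_roots' _).trans natDegree_map_le))
    have hx' : x ∈ (G.map (evalRingHom w)).roots.toFinset := by
      rw [Multiset.mem_toFinset, mem_roots hgw]; exact hx
    rw [← heq] at hx'
    obtain ⟨r, hr, h⟩ := Finset.mem_image.1 hx'
    exact ⟨r, hr, h.symm⟩
  refine ⟨δ, hδ, fun w₁ hw₁ => ?_⟩
  let χ : ℂ → ℂ → ℝ := fun r x => max 0 (min 1 (2 - 2 * ‖x - r‖ / η))
  have hχ1 : ∀ r x, ‖x - r‖ < η / 2 → χ r x = 1 := by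
    intro r x h
    have : 1 ≤ 2 - 2 * ‖x - r‖ / η := by
      have : 2 * ‖x - r‖ / η ≤ 1 := by rw [div_le_one hη]; linarith
      linarith
    simp only [χ, min_eq_left this]; norm_num
  have hχ0 : ∀ r x, χ r x ≠ 0 → ‖x - r‖ < η := by
    intro r x h
    by_contra! hle
    apply h
    have : 2 - 2 * ‖x - r‖ / η ≤ 0 := by
      have : 2 ≤ 2 * ‖x - r‖ / η := by rw [le_div_iff₀ hη]; linarith
      linarith
    exact max_eq_left ((min_le_right _ _).trans this)
  have hχle : ∀ r x, |χ r x| ≤ 1 := by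
    intro r x
    rw [abs_of_nonneg (le_max_left _ _)]
    exact max_le zero_le_one (min_le_left _ _)
  let ws : unitInterval × (ℂ × ℂ) → ℂ := fun x => (1 - (x.1 : ℝ)) • x.2.2 + (x.1 : ℝ) • w₁
  have hws : Continuous ws := by fun_prop
  have hwsb : ∀ x, x.2.2 ∈ ball w₀ δ → ws x ∈ ball w₀ δ := fun x hx =>
    convex_ball w₀ δ hx hw₁ (by linarith [x.1.2.2]) x.1.2.1 (by ring)
  refine ⟨fun x => x.2.1 + ∑ r ∈ R, (χ r x.2.1 : ℂ) * (ρ r (ws x) - ρ r x.2.2), ?_, ?_, ?_⟩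
  · refine ContinuousOn.add (by fun_prop) (continuousOn_finsetSum _ fun r hr => ?_)
    refine ContinuousOn.mul ?_ (ContinuousOn.sub ?_ ?_)
    · have : Continuous (χ r) := by fun_prop
      fun_prop
    · intro x hx
      exact (ContinuousAt.comp (f := ws) ((hball _ (hwsb x hx)).2 r hr).1
        hws.continuousAt).continuousWithinAt
    · intro x hx
      have hc : Continuous fun x : unitInterval × (ℂ × ℂ) => x.2.2 := by fun_prop
      exact (ContinuousAt.comp (f := fun x : unitInterval × (ℂ × ℂ) => x.2.2)
        ((hball _ hx).2 r hr).1 hc.continuousAt).continuousWithinAt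
  · intro u; simp [ws]
  · intro s u hu hne h0
    have hwsx := hwsb (s, u) hu
    obtain ⟨r₀, hr₀, hr₀'⟩ := hall _ hwsx _ h0
    simp only at hr₀'
    have hd0 := ((hball _ hwsx).2 r₀ hr₀).2.2
    by_cases hex : ∃ r ∈ R, χ r u.1 ≠ 0
    · obtain ⟨r, hr, hrχ⟩ := hex
      have hur := hχ0 r u.1 hrχ
      rw [Finset.sum_eq_single r ?_ (fun h => absurd hr h)] at hr₀'
      swap
      · intro r' hr' hne'
        have h1 := hsep r' hr' r hr hne'
        by_cases h2 : χ r' u.1 = 0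
        · simp [h2]
        · have h3 := hχ0 r' u.1 h2
          have h4 : r' - r = (u.1 - r) - (u.1 - r') := by ring
          have h5 := norm_sub_le (u.1 - r) (u.1 - r')
          rw [← h4] at h5
          linarith
      have hm : ‖(χ r u.1 : ℂ) * (ρ r (ws (s, u)) - ρ r u.2)‖ < η / 4 := by
        rw [norm_mul, Complex.norm_real, Real.norm_eq_abs]
        have h1 := ((hball _ hwsx).2 r hr).2.2
        have h2 := ((hball _ hu).2 r hr).2.2
        have h4 : ρ r (ws (s, u)) - ρ r u.2 = (ρ r (ws (s, u)) - r) - (ρ r u.2 - r) := by ring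
        have h5 := norm_sub_le (ρ r (ws (s, u)) - r) (ρ r u.2 - r)
        rw [← h4] at h5
        calc _ ≤ 1 * ‖ρ r (ws (s, u)) - ρ r u.2‖ :=
              mul_le_mul_of_nonneg_right (hχle _ _) (norm_nonneg _)
          _ < η / 4 := by linarith
      have hrr : r = r₀ := by
        by_contra hne'
        have h1 := hsep r hr r₀ hr₀ hne'
        have h2 : r - r₀ = (ρ r₀ (ws (s, u)) - r₀) - (u.1 - r) -
            (χ r u.1 : ℂ) * (ρ r (ws (s, u)) - ρ r u.2) := by
          rw [← hr₀']; ring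
        have h3 := norm_sub_le ((ρ r₀ (ws (s, u)) - r₀) - (u.1 - r))
          ((χ r u.1 : ℂ) * (ρ r (ws (s, u)) - ρ r u.2))
        have h4 := norm_sub_le (ρ r₀ (ws (s, u)) - r₀) (u.1 - r)
        rw [← h2] at h3
        linarith
      subst hrr
      have h1 : u.1 - r = (ρ r (ws (s, u)) - r) -
          (χ r u.1 : ℂ) * (ρ r (ws (s, u)) - ρ r u.2) := by
        linear_combination hr₀'
      have h2 := norm_sub_le (ρ r (ws (s, u)) - r)
          ((χ r u.1 : ℂ) * (ρ r (ws (s, u)) - ρ r u.2))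
      rw [← h1] at h2
      have h3 : χ r u.1 = 1 := hχ1 _ _ (by linarith)
      rw [h3] at hr₀'
      have h4 : u.1 = ρ r u.2 := by push_cast at hr₀'; linear_combination hr₀'
      apply hne
      rw [h4]
      exact ((hball _ hu).2 r hr).2.1
    · push Not at hex
      rw [Finset.sum_eq_zero (fun r hr => by rw [hex r hr]; simp), add_zero] at hr₀'
      have := hex r₀ hr₀
      rw [hχ1 r₀ u.1 (by rw [hr₀']; exact hd0.trans (by linarith))] at this
      exact one_ne_zero this

theorem Polynomial.isOpenMap_eval_complex (q : ℂ[X]) (hq : 1 ≤ q.natDegree) : IsOpenMap q.eval := by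
  have ha : AnalyticOnNhd ℂ q.eval univ := q.differentiable.differentiableOn.analyticOnNhd isOpen_univ
  rcases ha.is_constant_or_isOpen isPreconnected_univ with ⟨w, hw⟩ | h
  · exfalso
    have : q = C w := Polynomial.funext fun x => by simpa using hw x (mem_univ _)
    rw [this] at hq; simp at hq
  · intro O hO; exact h O (subset_univ _) hO

section Line

variable {E : Type*} [TopologicalSpace E] {p : E → ℂ} {q : ℂ[X]}

theorem isOpen_eval_ne_zero (q : ℂ[X]) : IsOpen {t | q.eval t ≠ 0} :=
  isOpen_ne_fun q.continuous continuous_const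

theorem eq_empty_of_line (hq : 1 ≤ q.natDegree) (hp : CoveringOnto p {t | q.eval t ≠ 0})
    {W : Set ℂ} (hW : IsOpen W) (hWc : IsPreconnected W) (h0 : (0 : ℂ) ∉ W) {A : Set E}
    (hA : ClopenIn A ((fun e => q.eval (p e)) ⁻¹' W)) {w : ℂ} (hw : w ∈ W)
    (hAw : ∀ e ∈ A, q.eval (p e) ≠ w) : A = ∅ := by
  have hA' : ClopenIn (p '' A) (q.eval ⁻¹' W) :=
    hp.clopenIn_image (isOpen_eval_ne_zero q) (hW.preimage q.continuous)
      (fun t ht h => h0 (h ▸ ht)) hA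
  have hcl : IsClosed (q.eval ⁻¹' W \ p '' A)ᶜ := hA'.isOpen_diff.isClosed_compl
  have h1 : W \ q.eval '' (p '' A) = W \ q.eval '' (q.eval ⁻¹' W \ p '' A)ᶜ := by
    ext w'; constructor
    · rintro ⟨hw', h⟩
      refine ⟨hw', ?_⟩
      rintro ⟨t, ht, rfl⟩
      exact h ⟨t, by_contra fun h' => ht ⟨hw', h'⟩, rfl⟩
    · rintro ⟨hw', h⟩
      refine ⟨hw', ?_⟩
      rintro ⟨t, ht, rfl⟩
      exact h ⟨t, fun h' => h'.2 ht, rfl⟩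
  have h2 : ClopenIn (q.eval '' (p '' A)) W := by
    refine ⟨?_, q.isOpenMap_eval_complex hq _ hA'.isOpen, ?_⟩
    · rintro _ ⟨t, ht, rfl⟩; exact hA'.subset ht
    · rw [h1]
      exact hW.sdiff (q.isClosedMap_eval _ hcl)
  by_contra hne
  obtain ⟨e, he⟩ := nonempty_iff_ne_empty.2 hne
  have h3 : q.eval (p e) ∈ q.eval '' (p '' A) := ⟨_, ⟨e, he, rfl⟩, rfl⟩
  obtain ⟨_, ⟨e', he', rfl⟩, h⟩ := h2.subset_of_isPreconnected hWc Subset.rfl ⟨_, h2.subset h3, h3⟩ hw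
  exact hAw e' he' h

theorem uniqueExt_line (hq : 1 ≤ q.natDegree) (hp : CoveringOnto p {t | q.eval t ≠ 0})
    {Ω : Set ℂ} (h0 : (0 : ℂ) ∉ Ω) : UniqueExt (fun e => q.eval (p e)) Ω := by
  intro W W' hW hWΩ hWc hW'W hW' ⟨w, hw⟩ A hA hAW'
  refine eq_empty_of_line hq hp hW hWc (fun h => h0 (hWΩ h)) hA (hW'W hw) fun e he h => ?_
  have : e ∈ A ∩ (fun e => q.eval (p e)) ⁻¹' W' := ⟨he, by rw [mem_preimage, h]; exact hw⟩
  rw [hAW'] at this; exact this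

theorem existsExt_line (hp : CoveringOnto p {t | q.eval t ≠ 0}) {W : Set ℂ} (hW : IsOpen W)
    (hWc : Convex ℝ W) (h0 : (0 : ℂ) ∉ W)
    (hcrit : ∀ t, q.eval t ∈ W → (derivative q).eval t ≠ 0) :
    ExistsExt (fun e => q.eval (p e)) W := by
  intro W' hW' hW'W ⟨w₁, hw₁⟩ L hL
  have hcov : CoveringOnto (fun y : {t // q.eval t ∈ W} => q.eval (y : ℂ)) W := by
    refine ⟨fun y => y.2, ?_⟩
    refine IsCoveringMapOn.isCoveringMap_restrictPreimage W
      (q.isCoveringMapOn_eval.mono ?_)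
    rintro w hw ⟨t, ht, rfl⟩
    exact hcrit t hw (by simpa using ht)
  have hφ : Continuous fun e => q.eval (p e) := q.continuous.comp hp.continuous
  let H : unitInterval × ↥(univ ∩ (fun e => q.eval (p e)) ⁻¹' W) → ℂ := fun x =>
    (1 - (x.1 : ℝ)) • q.eval (p x.2.1) + (x.1 : ℝ) • w₁
  have hH : Continuous H := by
    have : Continuous fun x : unitInterval × ↥(univ ∩ (fun e => q.eval (p e)) ⁻¹' W) => q.eval (p x.2.1) := hφ.comp (by fun_prop)
    fun_prop
  have hHW : ∀ x, H x ∈ W := fun x =>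
    hWc x.2.2.2 (hW'W hw₁) (by linarith [x.1.2.2]) x.1.2.1 (by ring)
  obtain ⟨K, hK, hKH, hK0, -⟩ := hcov.exists_lift H hH hHW (fun a : ↥(univ ∩ (fun e => q.eval (p e)) ⁻¹' W) => ⟨p a.1, a.2.2⟩)
    ((hp.continuous.comp continuous_subtype_val).subtype_mk _) (fun a => by simp [H])
  obtain ⟨K', hK', hKH', hK0', -⟩ := hp.exists_lift (fun x => (K x : ℂ)) (by fun_prop)
    (fun x h => h0 (by
      have := (K x).2
      rwa [h] at this)) (fun a : ↥(univ ∩ (fun e => q.eval (p e)) ⁻¹' W) => a.1) (by fun_prop)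
    (fun a => by rw [hK0])
  have hw1 : w₁ ∈ W := hW'W hw₁
  obtain ⟨L', hL', ε, hε, hεW', h⟩ := exists_clopenIn_of_transport hφ isOpen_univ hW K' hK'
    (fun _ => mem_univ _) hK0' (fun s e => by simp only [hKH', hKH]; rfl) hW' hw₁ hW'W
    (L := L) (by rwa [univ_inter])
  rw [univ_inter] at hL'
  exact ⟨_, hεW', isOpen_ball, nonempty_ball.2 hε, L', hL', h⟩

end Line

/-- The complement of the zero set of a polynomial function is thick in a covering. -/
theorem CoveringOnto.thin {E Z : Type*} [TopologicalSpace E] [NormedAddCommGroup Z]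
    [NormedSpace ℂ Z] {p : E → Z} {U : Set Z} (hp : CoveringOnto p U) (hU : IsOpen U)
    {G : Z → ℂ} (hG : PolyLike G) {z : Z} (hz : G z ≠ 0) {T S : Set E} (hT : IsOpen T)
    (hS : ∀ e ∈ T, e ∈ S ↔ G (p e) ≠ 0) :
    ∀ y ∈ T, ∀ O ∈ 𝓝 y, ∃ O' ∈ 𝓝 y, O' ⊆ O ∧ (O' ∩ S).Nonempty ∧ IsPreconnected (O' ∩ S) := by
  intro y hy O hO
  obtain ⟨N, hN, hyN, hNU, σ, hσ, hσy, hpσ, hop, hmaps⟩ :=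
    hp.exists_section_nhds hU (Filter.inter_mem hO (hT.mem_nhds hy))
  obtain ⟨ε, hε, hεN⟩ := Metric.isOpen_iff.1 hN _ hyN
  have hset : σ '' ball (p y) ε ∩ S = σ '' (ball (p y) ε ∩ {x | G x ≠ 0}) := by
    ext e; constructor
    · rintro ⟨⟨x, hx, rfl⟩, he⟩
      refine ⟨x, ⟨hx, ?_⟩, rfl⟩
      have := (hS _ (hmaps (hεN hx)).2).1 he
      rwa [hpσ x (hεN hx)] at this
    · rintro ⟨x, ⟨hx, hGx⟩, rfl⟩
      refine ⟨⟨x, hx, rfl⟩, (hS _ (hmaps (hεN hx)).2).2 ?_⟩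
      rwa [hpσ x (hεN hx)]
  refine ⟨σ '' ball (p y) ε, (hop _ hεN isOpen_ball).mem_nhds ⟨p y, mem_ball_self hε, hσy⟩, ?_, ?_, ?_⟩
  · rintro _ ⟨x, hx, rfl⟩; exact (hmaps (hεN hx)).1
  · rw [hset]
    obtain ⟨x, hx, hGx⟩ := hG.exists_ne_zero isOpen_ball (mem_ball_self hε) hz
    exact ⟨σ x, x, ⟨hx, hGx⟩, rfl⟩
  · rw [hset]
    exact (hG.isPreconnected_inter isOpen_ball (convex_ball _ _)).image _
      (hσ.mono (inter_subset_left.trans hεN))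

/-- Relatively clopen sets agreeing on a dense subset agree. -/
theorem ClopenIn.eq_of_dense {Y : Type*} [TopologicalSpace Y] {A B T S : Set Y}
    (hA : ClopenIn A T) (hB : ClopenIn B T)
    (hd : ∀ y ∈ T, ∀ O ∈ 𝓝 y, (O ∩ S).Nonempty) (h : A ∩ S = B ∩ S) : A = B := by
  have key : ∀ A B : Set Y, ClopenIn A T → ClopenIn B T → A ∩ S = B ∩ S → A ⊆ B := by
    intro A B hA hB h
    rw [← sdiff_eq_empty]
    by_contra hne
    obtain ⟨y, hy⟩ := nonempty_iff_ne_empty.2 hne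
    obtain ⟨x, hx, hxS⟩ := hd y (hA.subset hy.1) _ ((hA.sdiff hB).isOpen.mem_nhds hy)
    have : x ∈ B ∩ S := h ▸ ⟨hx.1, hxS⟩
    exact hx.2 this.1
  exact Subset.antisymm (key A B hA hB h) (key B A hB hA h.symm)

section Plane

variable {E : Type*} [TopologicalSpace E] {p : E → ℂ × ℂ} {H : ℂ[X][X]}

theorem isOpen_eval2_ne_zero (H : ℂ[X][X]) : IsOpen {y : ℂ × ℂ | eval2 H y.1 y.2 ≠ 0} :=
  isOpen_ne_fun (continuous_eval2 H) continuous_const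

theorem PolyLike.fst : PolyLike (Prod.fst : ℂ × ℂ → ℂ) := PolyLike.linear (LinearMap.fst ℂ ℂ ℂ)

theorem PolyLike.snd : PolyLike (Prod.snd : ℂ × ℂ → ℂ) := PolyLike.linear (LinearMap.snd ℂ ℂ ℂ)

theorem PolyLike.eval2 {Z : Type*} [AddCommGroup Z] [Module ℂ Z] {g g' : Z → ℂ} (h : PolyLike g)
    (h' : PolyLike g') (P : ℂ[X][X]) : PolyLike (fun z => eval2 P (g z) (g' z)) :=
  PolyLike.bivariate_eval h' h P

theorem CoveringOnto.exists_lift_graph (hp : CoveringOnto p {y | eval2 H y.1 y.2 ≠ 0})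
    {V : Set (ℂ × ℂ)} (hV : IsOpen V)
    (h : ∀ u ∈ V, H.leadingCoeff.eval u.1 ≠ 0 ∧
      ∀ t, eval2 H u.1 t = u.2 → eval2 (derivative H) u.1 t ≠ 0)
    (h0 : ∀ u ∈ V, u.2 ≠ 0) {A : Type*} [TopologicalSpace A] (c : unitInterval × A → ℂ × ℂ)
    (hc : Continuous c) (hcV : ∀ x, c x ∈ V) (f : A → E) (hf : Continuous f)
    (hcf : ∀ a, c (0, a) = ((p (f a)).1, eval2 H (p (f a)).1 (p (f a)).2)) :
    ∃ K : unitInterval × A → E, Continuous K ∧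
      (∀ x, ((p (K x)).1, eval2 H (p (K x)).1 (p (K x)).2) = c x) ∧ ∀ a, K (0, a) = f a := by
  have hm : ∀ a, ((p (f a)).1, eval2 H (p (f a)).1 (p (f a)).2) ∈ V := fun a => hcf a ▸ hcV _
  let f' : A → {y : ℂ × ℂ // (y.1, eval2 H y.1 y.2) ∈ V} := fun a => ⟨p (f a), hm a⟩
  have hf' : Continuous f' := (hp.continuous.comp hf).subtype_mk _
  obtain ⟨K, hK, hKc, hK0, -⟩ := (coveringOnto_graph H hV h).exists_lift c hc hcV f' hf' hcf
  obtain ⟨K', hK', hKc', hK0', -⟩ := hp.exists_lift (fun x => (K x : ℂ × ℂ)) (by fun_prop)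
    (fun x => h0 _ (K x).2) f hf (fun a => congrArg Subtype.val (hK0 a))
  refine ⟨K', hK', fun x => ?_, hK0'⟩
  rw [hKc']; exact hKc x

theorem CoveringOnto.clopenIn_image_graph (hp : CoveringOnto p {y | eval2 H y.1 y.2 ≠ 0})
    {V : Set (ℂ × ℂ)} (hV : IsOpen V)
    (h : ∀ u ∈ V, H.leadingCoeff.eval u.1 ≠ 0 ∧
      ∀ t, eval2 H u.1 t = u.2 → eval2 (derivative H) u.1 t ≠ 0)
    (h0 : ∀ u ∈ V, u.2 ≠ 0) {A : Set E}
    (hA : ClopenIn A ((fun e => ((p e).1, eval2 H (p e).1 (p e).2)) ⁻¹' V)) :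
    ClopenIn ((fun e => ((p e).1, eval2 H (p e).1 (p e).2)) '' A) V := by
  let κ : ℂ × ℂ → ℂ × ℂ := fun y => (y.1, eval2 H y.1 y.2)
  have hκ : Continuous κ := continuous_fst.prodMk (continuous_eval2 H)
  have h1 : ClopenIn (p '' A) (κ ⁻¹' V) :=
    hp.clopenIn_image (isOpen_eval2_ne_zero H) (hV.preimage hκ) (fun y hy => h0 _ hy) hA
  have h2 := (coveringOnto_graph H hV h).clopenIn_image hV hV Subset.rfl
    (h1.preimage (continuous_subtype_val (p := fun y => κ y ∈ V)))
  convert h2 using 1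
  ext u; constructor
  · rintro ⟨e, he, rfl⟩
    exact ⟨⟨p e, hA.subset he⟩, ⟨e, he, rfl⟩, rfl⟩
  · rintro ⟨y, ⟨e, he, hy⟩, rfl⟩
    exact ⟨e, he, by simp only [hy]⟩

theorem CoveringOnto.eq_empty_of_graph (hp : CoveringOnto p {y | eval2 H y.1 y.2 ≠ 0})
    {V : Set (ℂ × ℂ)} (hV : IsOpen V) (hVc : IsPreconnected V)
    (h : ∀ u ∈ V, H.leadingCoeff.eval u.1 ≠ 0 ∧
      ∀ t, eval2 H u.1 t = u.2 → eval2 (derivative H) u.1 t ≠ 0)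
    (h0 : ∀ u ∈ V, u.2 ≠ 0) {A : Set E}
    (hA : ClopenIn A ((fun e => ((p e).1, eval2 H (p e).1 (p e).2)) ⁻¹' V)) {u : ℂ × ℂ} (hu : u ∈ V)
    (hAu : ∀ e ∈ A, ((p e).1, eval2 H (p e).1 (p e).2) ≠ u) : A = ∅ := by
  by_contra hne
  obtain ⟨e, he⟩ := nonempty_iff_ne_empty.2 hne
  have h1 := hp.clopenIn_image_graph hV h h0 hA
  obtain ⟨e', he', h⟩ := h1.subset_of_isPreconnected hVc Subset.rfl
    ⟨_, h1.subset ⟨e, he, rfl⟩, ⟨e, he, rfl⟩⟩ hu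
  exact hAu e' he' h

/-- Extension of relatively clopen sets for a pencil of lines one of whose members has no critical
values in the given disc. -/
theorem exists_clopenIn_extend_plane (hdeg : 1 ≤ H.natDegree)
    (hlc : ∀ x, H.leadingCoeff.eval x ≠ 0)
    (hp : CoveringOnto p {y | eval2 H y.1 y.2 ≠ 0}) {w₀ : ℂ} {R : ℝ} (h0 : (0 : ℂ) ∉ ball w₀ R)
    (hcrit : ∀ t, eval2 H 0 t ∈ ball w₀ R → eval2 (derivative H) 0 t ≠ 0)
    {w' : ℂ} {R' : ℝ} (hR' : 0 < R') (hsub : ball w' R' ⊆ ball w₀ R) {L : Set E}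
    (hL : ClopenIn L ((fun e => eval2 H (p e).1 (p e).2) ⁻¹' ball w' R')) :
    ∃ L', ClopenIn L' ((fun e => eval2 H (p e).1 (p e).2) ⁻¹' ball w₀ R) ∧
      L' ∩ (fun e => eval2 H (p e).1 (p e).2) ⁻¹' ball w' R' = L := by
  set g : E → ℂ := fun e => eval2 H (p e).1 (p e).2 with hg
  have hgc : Continuous g := (continuous_eval2 H).comp hp.continuous
  let π : E → ℂ × ℂ := fun e => ((p e).1, eval2 H (p e).1 (p e).2)
  have hπ : Continuous π := (continuous_fst.comp hp.continuous).prodMk hgc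
  have hnd : ∀ x, (H.map (evalRingHom x)).natDegree = H.natDegree := fun x =>
    natDegree_map_of_leadingCoeff_ne_zero _ (hlc x)
  have hR : w' ∈ ball w₀ R := hsub (mem_ball_self hR')
  obtain ⟨Q, hQ⟩ := exists_critical_locus H _ hnd hdeg
  have hQ0W : ∀ w ∈ ball w₀ R, eval2 Q w 0 ≠ 0 := by
    intro w hw h
    obtain ⟨t, ht, ht'⟩ := (hQ 0 w).1 h
    exact hcrit t (ht ▸ hw) ht'
  have hQne : Q ≠ 0 := by
    rintro rfl
    exact hQ0W w' hR (by simp [eval2])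
  obtain ⟨G, B, hB, hGB⟩ := exists_squarefree_part Q hQne
  have hWB : IsOpen (ball w₀ R \ B) := isOpen_ball.sdiff hB.isClosed
  have hWBc : IsPreconnected (ball w₀ R \ B) :=
    (convex_ball w₀ R).isPreconnected.diff_finite_complex isOpen_ball hB
  let V : Set ℂ → Set (ℂ × ℂ) := fun O => {u | u.2 ∈ O ∧ eval2 G u.2 u.1 ≠ 0}
  have hVo : ∀ O, IsOpen O → IsOpen (V O) := fun O hO =>
    (hO.preimage continuous_snd).inter
      ((isOpen_eval2_ne_zero G).preimage (continuous_snd.prodMk continuous_fst))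
  have hVc : ∀ O, IsOpen O → Convex ℝ O → IsPreconnected (V O) := by
    intro O hO hOc
    have : V O = (Prod.snd ⁻¹' O) ∩ {u : ℂ × ℂ | eval2 G u.2 u.1 ≠ 0} := rfl
    rw [this]
    exact (PolyLike.eval2 PolyLike.snd PolyLike.fst G).isPreconnected_inter
      (hO.preimage continuous_snd) (hOc.linear_preimage (LinearMap.snd ℝ ℂ ℂ))
  have hVreg : ∀ O, O ⊆ ball w₀ R \ B → ∀ u ∈ V O, H.leadingCoeff.eval u.1 ≠ 0 ∧
      ∀ t, eval2 H u.1 t = u.2 → eval2 (derivative H) u.1 t ≠ 0 := by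
    rintro O hO u ⟨hu, hu'⟩
    refine ⟨hlc _, fun t ht ht' => hu' ?_⟩
    rw [← (hGB u.2 (hO hu).2).1, hQ]
    exact ⟨t, ht, ht'⟩
  have hVne : ∀ O, O ⊆ ball w₀ R \ B → ∀ u ∈ V O, u.2 ≠ 0 := by
    rintro O hO u ⟨hu, -⟩ h
    exact h0 (h ▸ (hO hu).1)
  have hV0 : ∀ O, O ⊆ ball w₀ R \ B → ∀ w ∈ O, ((0 : ℂ), w) ∈ V O := fun O hO w hw =>
    ⟨hw, fun h => hQ0W w (hO hw).1 (((hGB w (hO hw).2).1 0).2 h)⟩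
  -- the central line
  let ι : ℂ → ℂ × ℂ := fun t => (0, t)
  have hι : Continuous ι := by fun_prop
  let q : ℂ[X] := H.map (evalRingHom 0)
  have hq : 1 ≤ q.natDegree := by rw [hnd]; exact hdeg
  have hp₁ : CoveringOnto (fun x : {x : E × ℂ // p x.1 = ι x.2} => x.1.2) {t | q.eval t ≠ 0} :=
    hp.pullback hι
  let j : {x : E × ℂ // p x.1 = ι x.2} → E := fun x => x.1.1
  have hj : Continuous j := by fun_prop
  have hgj : ∀ x, g (j x) = q.eval x.1.2 := by
    intro x; simp only [hg, j, x.2, ι]; rfl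
  have hpj : ∀ e, (p e).1 = 0 → ∃ x, j x = e := fun e he =>
    ⟨⟨(e, (p e).2), Prod.ext he rfl⟩, rfl⟩
  have hM₁ := (existsExt_line hp₁ isOpen_ball (convex_ball w₀ R) h0 (fun t ht => by
    have := hcrit t ht
    rwa [eval2, ← derivative_map] at this))
  have hgj' : (fun x : {x : E × ℂ // p x.1 = ι x.2} => q.eval x.1.2) = fun x => g (j x) :=
    funext fun x => (hgj x).symm
  have hM₂ := uniqueExt_line hq hp₁ h0
  rw [hgj'] at hM₁ hM₂
  have hgjc : Continuous fun x => g (j x) := hgc.comp hj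
  obtain ⟨M, hM, hML⟩ := hM₁.exists_eq hM₂ hgjc isOpen_ball hsub ⟨w', mem_ball_self hR'⟩
    (convex_ball _ _).isPreconnected (hL.preimage hj)
  -- agreement with `M` determines relatively clopen sets
  let Agree : Set ℂ → Set E → Prop := fun O A => ∀ x, g (j x) ∈ O → (j x ∈ A ↔ x ∈ M)
  have hagree : ∀ O, IsOpen O → Convex ℝ O → O ⊆ ball w₀ R \ B → ∀ A A', ClopenIn A (π ⁻¹' V O) →
      ClopenIn A' (π ⁻¹' V O) → Agree O A → Agree O A' → A ⊆ A' := by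
    intro O hO hOc hOW A A' hA hA' hAM hAM'
    rw [← sdiff_eq_empty]
    by_contra hne
    obtain ⟨e, he⟩ := nonempty_iff_ne_empty.2 hne
    have hwO : (π e).2 ∈ O := (hA.subset he.1).1
    refine hne (hp.eq_empty_of_graph (hVo O hO) (hVc O hO hOc) (hVreg O hOW) (hVne O hOW)
      (hA.sdiff hA') (hV0 O hOW _ hwO) ?_)
    rintro e' ⟨he', he''⟩ h
    obtain ⟨x, rfl⟩ := hpj e' (congrArg Prod.fst h)
    have hgO : g (j x) ∈ O := (hA.subset he').1
    exact he'' ((hAM' x hgO).2 ((hAM x hgO).1 he'))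
  have hVmono : ∀ O O', O ⊆ O' → π ⁻¹' V O ⊆ π ⁻¹' V O' := fun O O' h e he => ⟨h he.1, he.2⟩
  have hrestr : ∀ O O' A, IsOpen O → O ⊆ O' → ClopenIn A (π ⁻¹' V O') → Agree O' A →
      ClopenIn (A ∩ π ⁻¹' V O) (π ⁻¹' V O) ∧ (O ⊆ ball w₀ R \ B → Agree O (A ∩ π ⁻¹' V O)) := by
    intro O O' A hO hOO' hA hAg
    refine ⟨hA.restrict ((hVo O hO).preimage hπ) (hVmono _ _ hOO'), fun hOW x hx => ?_⟩
    rw [← hAg x (hOO' hx)]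
    refine ⟨fun h => h.1, fun h => ⟨h, hx, (hA.subset h).2⟩⟩
  -- local existence propagates
  let P : Set ℂ := {w | w ∈ ball w₀ R \ B ∧ ∃ ε > 0, ball w ε ⊆ ball w₀ R \ B ∧
    ∃ A, ClopenIn A (π ⁻¹' V (ball w ε)) ∧ Agree (ball w ε) A}
  have hstep : ∀ w ∈ ball w₀ R \ B, ∃ δ > 0, ball w δ ⊆ ball w₀ R \ B ∧
      ∀ w₁ ∈ ball w δ, w₁ ∈ P → ball w δ ⊆ P := by
    intro w hw
    obtain ⟨δ₁, hδ₁, hδ₁W⟩ := Metric.isOpen_iff.1 hWB w hw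
    obtain ⟨δ₂, hδ₂, htr⟩ := exists_root_transport G (hGB w hw.2).2.2 (hGB w hw.2).2.1
    refine ⟨min δ₁ δ₂, lt_min hδ₁ hδ₂, (ball_subset_ball (min_le_left _ _)).trans hδ₁W, ?_⟩
    set O := ball w (min δ₁ δ₂) with hO
    have hOW : O ⊆ ball w₀ R \ B := (ball_subset_ball (min_le_left _ _)).trans hδ₁W
    have hOO : O ⊆ ball w δ₂ := ball_subset_ball (min_le_right _ _)
    rintro w₁ hw₁ ⟨-, ε, hε, hεW, A, hA, hAg⟩
    obtain ⟨c, hc, hc0, hcG⟩ := htr w₁ (hOO hw₁)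
    have hAO := hrestr (O ∩ ball w₁ ε) (ball w₁ ε) A (isOpen_ball.inter isOpen_ball)
      inter_subset_right hA hAg
    have hcv : ∀ (s : unitInterval) u, u ∈ V O →
        (c (s, u), (1 - (s : ℝ)) • u.2 + (s : ℝ) • w₁) ∈ V O := fun s u hu =>
      ⟨(convex_ball _ _) hu.1 hw₁ (by linarith [s.2.2]) s.2.1 (by ring), hcG s u (hOO hu.1) hu.2⟩
    obtain ⟨K, hK, hKc, hK0⟩ := hp.exists_lift_graph (hVo O isOpen_ball) (hVreg O hOW) (hVne O hOW)
      (A := ↥(π ⁻¹' V (ball w₀ R \ B) ∩ g ⁻¹' O))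
      (fun x => (c (x.1, π x.2), (1 - (x.1 : ℝ)) • g x.2 + (x.1 : ℝ) • w₁))
      (by
        refine Continuous.prodMk ?_ (by fun_prop)
        refine hc.comp_continuous (f := fun x : unitInterval × ↥(π ⁻¹' V (ball w₀ R \ B) ∩ g ⁻¹' O)
          => (x.1, π x.2)) (by fun_prop) fun x => hOO x.2.2.2)
      (fun x => hcv x.1 (π x.2) ⟨x.2.2.2, x.2.2.1.2⟩) (fun a => a.1) (by fun_prop)
      (fun a => by
        refine Prod.ext (hc0 _) ?_
        simp [hg])
    have hVO : ∀ O', O' ⊆ O → π ⁻¹' V (ball w₀ R \ B) ∩ g ⁻¹' O' = π ⁻¹' V O' := by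
      intro O' hO'
      ext e; exact ⟨fun h => ⟨h.2, h.1.2⟩, fun h => ⟨⟨hOW (hO' h.1), h.2⟩, h.1⟩⟩
    obtain ⟨A', hA', ε', hε', hε'W, hAA'⟩ := exists_clopenIn_of_transport hgc
      ((hVo _ hWB).preimage hπ) isOpen_ball (w₁ := w₁) K hK
      (fun x => hVmono _ _ hOW (by
        have := hcv x.1 (π x.2) ⟨x.2.2.2, x.2.2.1.2⟩
        rw [mem_preimage]; simp only [π]; rw [hKc]; exact this)) hK0
      (fun s e => congrArg Prod.snd (hKc (s, e))) (W' := O ∩ ball w₁ ε)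
      (isOpen_ball.inter isOpen_ball) ⟨hw₁, mem_ball_self hε⟩ inter_subset_left
      (L := A ∩ π ⁻¹' V (O ∩ ball w₁ ε)) (by rw [hVO _ inter_subset_left]; exact hAO.1)
    rw [hVO _ Subset.rfl] at hA'
    have hA'g : Agree O A' := by
      have hXY := hM₂.eq (W := O) (W' := ball w₁ ε') isOpen_ball (hOW.trans sdiff_subset)
        (convex_ball _ _).isPreconnected (hε'W.trans inter_subset_left) isOpen_ball
        (nonempty_ball.2 hε') (A := j ⁻¹' A') (B := M ∩ (fun x => g (j x)) ⁻¹' O) (by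
          have := hA'.preimage hj
          convert this using 1
          ext x; constructor
          · intro hx
            refine ⟨hx, ?_⟩
            have := hV0 O hOW _ hx
            have e : π (j x) = (0, g (j x)) := Prod.ext (by simp [π, j, x.2, ι]) rfl
            rw [e]; exact this.2
          · intro hx; exact hx.1)
        (hM.restrict (isOpen_ball.preimage hgjc) (preimage_mono (hOW.trans sdiff_subset))) (by
          ext x
          constructor
          · rintro ⟨hx, hx'⟩
            have : j x ∈ A' ∩ g ⁻¹' ball w₁ ε' := ⟨hx, hx'⟩
            rw [hAA'] at this
            exact ⟨⟨(hAg x (hε'W hx').2).1 this.1.1, (hε'W hx').1⟩, hx'⟩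
          · rintro ⟨⟨hx, hxO⟩, hx'⟩
            refine ⟨?_, hx'⟩
            have h1 : j x ∈ A := (hAg x (hε'W hx').2).2 hx
            have : j x ∈ (A ∩ π ⁻¹' V (O ∩ ball w₁ ε)) ∩ g ⁻¹' ball w₁ ε' :=
              ⟨⟨h1, hε'W hx', (hA.subset h1).2⟩, hx'⟩
            rw [← hAA'] at this
            exact this.1)
      intro x hx
      have := Set.ext_iff.1 hXY x
      simp only [mem_preimage, mem_inter_iff] at this
      rw [this]
      exact ⟨fun h => h.1, fun h => ⟨h, hx⟩⟩
    intro w₂ hw₂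
    obtain ⟨ε₂, hε₂, hε₂O⟩ := Metric.isOpen_iff.1 isOpen_ball w₂ hw₂
    have := hrestr (ball w₂ ε₂) O A' isOpen_ball hε₂O hA' hA'g
    exact ⟨hOW hw₂, ε₂, hε₂, hε₂O.trans hOW, _, this.1, this.2 (hε₂O.trans hOW)⟩
  have hP : ClopenIn P (ball w₀ R \ B) := by
    refine ⟨fun w hw => hw.1, ?_, ?_⟩
    · rw [Metric.isOpen_iff]
      intro w hw
      obtain ⟨δ, hδ, -, h⟩ := hstep w hw.1
      exact ⟨δ, hδ, h w (mem_ball_self hδ) hw⟩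
    · rw [Metric.isOpen_iff]
      rintro w ⟨hw, hwP⟩
      obtain ⟨δ, hδ, hδW, h⟩ := hstep w hw
      exact ⟨δ, hδ, fun w₁ hw₁ => ⟨hδW hw₁, fun hw₁P => hwP (h w₁ hw₁ hw₁P (mem_ball_self hδ))⟩⟩
  have hLV : ∀ O, IsOpen O → O ⊆ ball w' R' \ B →
      ClopenIn (L ∩ π ⁻¹' V O) (π ⁻¹' V O) ∧ Agree O (L ∩ π ⁻¹' V O) := by
    intro O hO hOW
    refine ⟨hL.restrict ((hVo O hO).preimage hπ) fun e he => (hOW he.1).1, fun x hx => ?_⟩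
    have h1 : x ∈ j ⁻¹' L ↔ x ∈ M := by
      rw [← hML]
      exact ⟨fun h => h.1, fun h => ⟨h, (hOW hx).1⟩⟩
    rw [← h1]
    refine ⟨fun h => h.1, fun h => ⟨h, ?_⟩⟩
    have := hV0 O (hOW.trans (sdiff_subset_sdiff_left hsub)) _ hx
    have e : π (j x) = (0, g (j x)) := Prod.ext (by simp [π, j, x.2, ι]) rfl
    rw [mem_preimage, e]; exact this
  have hPall : ball w₀ R \ B ⊆ P := by
    refine hP.subset_of_isPreconnected hWBc Subset.rfl ?_
    have hW'B : IsOpen (ball w' R' \ B) := isOpen_ball.sdiff hB.isClosed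
    obtain ⟨w₁, hw₁⟩ : (ball w' R' \ B).Nonempty := by
      obtain ⟨O', -, -, ⟨x, -, hx⟩, -⟩ := Complex.thin_diff_finite (T := ball w' R') isOpen_ball hB w'
        (mem_ball_self hR') univ Filter.univ_mem
      exact ⟨x, hx⟩
    obtain ⟨ε, hε, hεW⟩ := Metric.isOpen_iff.1 hW'B w₁ hw₁
    have hw₁W : w₁ ∈ ball w₀ R \ B := ⟨hsub hw₁.1, hw₁.2⟩
    exact ⟨w₁, hw₁W, hw₁W, ε, hε, hεW.trans (sdiff_subset_sdiff_left hsub), _,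
      hLV (ball w₁ ε) isOpen_ball hεW⟩
  choose! r hr hrW A hA hAg using fun w (hw : w ∈ ball w₀ R \ B) => (hPall hw).2
  obtain ⟨hU, hUj⟩ := ClopenIn.iUnion (ι := ↥(ball w₀ R \ B)) (L := fun w => A w)
    (S := fun w => π ⁻¹' V (ball w (r w))) (fun w => hA w w.2) (by
      intro w₁ w₂ e ⟨he1, he2⟩
      have hi := hagree (ball w₁ (r w₁) ∩ ball w₂ (r w₂)) (isOpen_ball.inter isOpen_ball)
        ((convex_ball _ _).inter (convex_ball _ _)) (inter_subset_left.trans (hrW w₁ w₁.2)) _ _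
        (hrestr _ _ _ (isOpen_ball.inter isOpen_ball) inter_subset_left (hA w₁ w₁.2)
          (hAg w₁ w₁.2)).1
        (hrestr _ _ _ (isOpen_ball.inter isOpen_ball) inter_subset_right (hA w₂ w₂.2)
          (hAg w₂ w₂.2)).1
        ((hrestr _ _ _ (isOpen_ball.inter isOpen_ball) inter_subset_left (hA w₁ w₁.2)
          (hAg w₁ w₁.2)).2 (inter_subset_left.trans (hrW w₁ w₁.2)))
        ((hrestr _ _ _ (isOpen_ball.inter isOpen_ball) inter_subset_right (hA w₂ w₂.2)
          (hAg w₂ w₂.2)).2 (inter_subset_left.trans (hrW w₁ w₁.2)))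
      exact (hi ⟨he1, ⟨((hA w₁ w₁.2).subset he1).1, he2.1⟩, he2.2⟩).1)
  set L₁ := ⋃ w : ↥(ball w₀ R \ B), A w
  have hSU : ⋃ w : ↥(ball w₀ R \ B), π ⁻¹' V (ball w (r w)) = π ⁻¹' V (ball w₀ R \ B) := by
    ext e; constructor
    · intro h
      obtain ⟨w, hw⟩ := mem_iUnion.1 h
      exact hVmono _ _ (hrW w w.2) hw
    · intro h
      exact mem_iUnion.2 ⟨⟨g e, h.1⟩, mem_ball_self (hr _ h.1), h.2⟩
  rw [hSU] at hU
  -- extension over the thin exceptional set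
  let Φ : ℂ × ℂ → ℂ := fun y => eval2 Q (eval2 H y.1 y.2) y.1 *
    (∏ b ∈ hB.toFinset, (X - C b)).eval (eval2 H y.1 y.2)
  have hΦp : PolyLike Φ := by
    have h1 : PolyLike fun y : ℂ × ℂ => eval2 H y.1 y.2 := PolyLike.fst.eval2 PolyLike.snd H
    exact (h1.eval2 PolyLike.fst Q).mul (h1.polynomial_eval _)
  have hprod : ∀ w, (∏ b ∈ hB.toFinset, (X - C b)).eval w ≠ 0 ↔ w ∉ B := by
    intro w
    rw [eval_prod, Finset.prod_ne_zero_iff]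
    simp only [Finite.mem_toFinset, eval_sub, eval_X, eval_C, sub_ne_zero]
    exact ⟨fun h hw => h w hw rfl, fun h b hb hwb => h (hwb ▸ hb)⟩
  have hΦS : ∀ e ∈ g ⁻¹' ball w₀ R, e ∈ π ⁻¹' V (ball w₀ R \ B) ↔ Φ (p e) ≠ 0 := by
    intro e he
    simp only [Φ, mul_ne_zero_iff, hprod]
    constructor
    · rintro ⟨h1, h2⟩
      exact ⟨fun h => h2 (((hGB _ h1.2).1 _).1 h), h1.2⟩
    · rintro ⟨h1, h2⟩
      exact ⟨⟨he, h2⟩, fun h => h1 (((hGB _ h2).1 _).2 h)⟩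
  obtain ⟨z, hz⟩ : ∃ z, Φ z ≠ 0 := by
    obtain ⟨O', -, -, ⟨w, -, hwW, hwB⟩, -⟩ := Complex.thin_diff_finite (T := ball w₀ R) isOpen_ball hB w'
        hR univ Filter.univ_mem
    obtain ⟨t, ht⟩ := IsAlgClosed.exists_root (q - C w) (by
      intro h
      have h' := natDegree_eq_zero_iff_degree_le_zero.2 h.le
      rw [natDegree_sub_C] at h'
      omega)
    have ht' : eval2 H 0 t = w := by
      rw [IsRoot, eval_sub, eval_C, sub_eq_zero] at ht
      exact ht
    refine ⟨(0, t), ?_⟩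
    simp only [Φ, ht']
    exact mul_ne_zero (hQ0W w hwW) ((hprod w).2 hwB)
  have hthin := hp.thin (isOpen_eval2_ne_zero H) hΦp hz (isOpen_ball.preimage hgc) hΦS
  obtain ⟨L', hL', hL'S⟩ := hU.exists_extend_thin (T := g ⁻¹' ball w₀ R) (isOpen_ball.preimage hgc)
    (fun e he => he.1.1) hthin
  refine ⟨L', hL', ?_⟩
  refine ClopenIn.eq_of_dense (S := π ⁻¹' V (ball w₀ R \ B))
    (hL'.restrict (isOpen_ball.preimage hgc) (preimage_mono hsub)) hL ?_ ?_
  · intro y hy O hO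
    obtain ⟨O', -, hO', hne, -⟩ := hthin y (preimage_mono hsub hy) O hO
    exact hne.mono (inter_subset_inter_left _ hO')
  · have hcomm : L' ∩ g ⁻¹' ball w' R' ∩ π ⁻¹' V (ball w₀ R \ B) = L₁ ∩ g ⁻¹' ball w' R' := by
      rw [inter_right_comm, hL'S]
    rw [hcomm]
    have hloc : ∀ e, e ∈ π ⁻¹' V (ball w₀ R \ B) → g e ∈ ball w' R' → (e ∈ L₁ ↔ e ∈ L) := by
      intro e he hge
      let w : ↥(ball w₀ R \ B) := ⟨g e, he.1⟩
      have he2 : e ∈ π ⁻¹' V (ball w (r w)) := ⟨mem_ball_self (hr _ he.1), he.2⟩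
      have h1 : e ∈ L₁ ↔ e ∈ A w := by
        rw [← hUj w]; exact ⟨fun h => ⟨h, he2⟩, fun h => h.1⟩
      have hOO : ball (w : ℂ) (r w) ∩ ball w' R' ⊆ ball w' R' \ B :=
        fun x hx => ⟨hx.2, (hrW w w.2 hx.1).2⟩
      have hOo : IsOpen (ball (w : ℂ) (r w) ∩ ball w' R') := isOpen_ball.inter isOpen_ball
      have hOc : Convex ℝ (ball (w : ℂ) (r w) ∩ ball w' R') := (convex_ball _ _).inter (convex_ball _ _)
      have hOW : ball (w : ℂ) (r w) ∩ ball w' R' ⊆ ball w₀ R \ B :=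
        inter_subset_left.trans (hrW w w.2)
      obtain ⟨a1, a2⟩ := hLV _ hOo hOO
      obtain ⟨b1, b2⟩ := hrestr _ _ _ hOo inter_subset_left (hA w w.2) (hAg w w.2)
      have he3 : e ∈ π ⁻¹' V (ball (w : ℂ) (r w) ∩ ball w' R') := ⟨⟨he2.1, hge⟩, he.2⟩
      rw [h1]
      exact ⟨fun h => (hagree _ hOo hOc hOW _ _ b1 a1 (b2 hOW) a2 ⟨h, he3⟩).1,
        fun h => (hagree _ hOo hOc hOW _ _ a1 b1 a2 (b2 hOW) ⟨h, he3⟩).1⟩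
    ext e; constructor
    · rintro ⟨h1, h2⟩
      exact ⟨(hloc e (hU.subset h1) h2).1 h1, hU.subset h1⟩
    · rintro ⟨h1, h2⟩
      exact ⟨(hloc e h2 (hL.subset h1)).2 h1, hL.subset h1⟩

end Plane

/-- A function which is polynomial, of constant degree `N` and constant leading coefficient `c`, along
the lines in the direction `v`, depending polynomially on the line. -/
structure Pencil {Z : Type*} [NormedAddCommGroup Z] [NormedSpace ℂ Z] (f : Z → ℂ) (v : Z) (N : ℕ)
    (c : ℂ) : Prop where
  continuous : Continuous f
  polyLike : PolyLike f
  one_le : 1 ≤ N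
  ne_zero : c ≠ 0
  plane : ∀ z u, ∃ H : ℂ[X][X], H.natDegree = N ∧ H.leadingCoeff = C c ∧
    ∀ τ t, f (z + τ • u + t • v) = eval2 H τ t

namespace Pencil

variable {Z : Type*} [NormedAddCommGroup Z] [NormedSpace ℂ Z] {f : Z → ℂ} {v : Z} {N : ℕ} {c : ℂ}
  {E : Type*} [TopologicalSpace E] {p : E → Z}

theorem line (hf : Pencil f v N c) (z : Z) :
    ∃ q : ℂ[X], q.natDegree = N ∧ q.leadingCoeff = c ∧ ∀ t, f (z + t • v) = q.eval t := by
  obtain ⟨H, hN, hc, hH⟩ := hf.plane z 0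
  have h0 : (evalRingHom (0 : ℂ)) H.leadingCoeff ≠ 0 := by
    rw [hc]; simpa using hf.ne_zero
  refine ⟨H.map (evalRingHom 0), ?_, ?_, fun t => ?_⟩
  · rw [natDegree_map_of_leadingCoeff_ne_zero _ h0, hN]
  · rw [leadingCoeff_map_of_leadingCoeff_ne_zero _ h0, hc]; simp
  · have := hH 0 t
    simpa [eval2] using this

theorem isOpen_ne_zero (hf : Pencil f v N c) : IsOpen {z | f z ≠ 0} :=
  isOpen_ne_fun hf.continuous continuous_const

theorem exists_eq (hf : Pencil f v N c) (z : Z) (w : ℂ) : ∃ t : ℂ, f (z + t • v) = w := by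
  obtain ⟨q, hN, -, hq⟩ := hf.line z
  obtain ⟨t, ht⟩ := IsAlgClosed.exists_root (q - C w) (by
    intro h
    have h' := natDegree_eq_zero_iff_degree_le_zero.2 h.le
    rw [natDegree_sub_C] at h'
    have := hf.one_le
    omega)
  rw [IsRoot, eval_sub, eval_C, sub_eq_zero] at ht
  exact ⟨t, (hq t).trans ht⟩

theorem continuous_line (z v : Z) : Continuous fun t : ℂ => z + t • v := by fun_prop

/-- Nonempty relatively clopen sets on a line meet all the fibres. -/
theorem eq_empty_of_line (hf : Pencil f v N c) (hp : CoveringOnto p {z | f z ≠ 0}) (z : Z)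
    {W : Set ℂ} (hW : IsOpen W) (hWc : IsPreconnected W) (h0 : (0 : ℂ) ∉ W)
    {A : Set {x : E × ℂ // p x.1 = z + x.2 • v}} (hA : ClopenIn A ((fun x => f (p x.1.1)) ⁻¹' W))
    {w : ℂ} (hw : w ∈ W) (hAw : ∀ x ∈ A, f (p x.1.1) ≠ w) : A = ∅ := by
  obtain ⟨q, hN, -, hq⟩ := hf.line z
  have hp' : CoveringOnto (fun x : {x : E × ℂ // p x.1 = z + x.2 • v} => x.1.2)
      {t | q.eval t ≠ 0} := by
    convert hp.pullback (continuous_line z v) using 1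
    ext t; simp [← hq]
  have hg : (fun x : {x : E × ℂ // p x.1 = z + x.2 • v} => f (p x.1.1)) =
      fun x => q.eval x.1.2 := funext fun x => by rw [x.2, hq]
  rw [hg] at hA
  refine _root_.eq_empty_of_line (hN ▸ hf.one_le) hp' hW hWc h0 hA hw fun x hx h => hAw x hx ?_
  rw [← h]
  exact congrFun hg x

theorem exists_mem_eq (hf : Pencil f v N c) (hp : CoveringOnto p {z | f z ≠ 0})
    {W : Set ℂ} (hW : IsOpen W) (hWc : IsPreconnected W) (h0 : (0 : ℂ) ∉ W)
    {A : Set E} (hA : ClopenIn A ((fun e => f (p e)) ⁻¹' W)) {e : E} (he : e ∈ A)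
    {w : ℂ} (hw : w ∈ W) : ∃ e' ∈ A, f (p e') = w := by
  by_contra! h
  let j : {x : E × ℂ // p x.1 = p e + x.2 • v} → E := fun x => x.1.1
  have hj : Continuous j := by fun_prop
  have := hf.eq_empty_of_line hp (p e) hW hWc h0 (hA.preimage hj) hw fun x hx => h _ hx
  have hmem : (⟨(e, 0), by simp⟩ : {x : E × ℂ // p x.1 = p e + x.2 • v}) ∈ j ⁻¹' A := he
  rw [this] at hmem
  exact hmem

theorem uniqueExt (hf : Pencil f v N c) (hp : CoveringOnto p {z | f z ≠ 0}) {Ω : Set ℂ}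
    (h0 : (0 : ℂ) ∉ Ω) : UniqueExt (fun e => f (p e)) Ω := by
  intro W W' hW hWΩ hWc hW'W hW' ⟨w, hw⟩ A hA hAW'
  by_contra hne
  obtain ⟨e, he⟩ := nonempty_iff_ne_empty.2 hne
  obtain ⟨e', he', h⟩ := hf.exists_mem_eq hp hW hWc (fun h => h0 (hWΩ h)) hA he (hW'W hw)
  have : e' ∈ A ∩ (fun e => f (p e)) ⁻¹' W' := ⟨he', by rw [mem_preimage, h]; exact hw⟩
  rw [hAW'] at this; exact this

/-- Extension of relatively clopen sets along a line. -/
theorem exists_extend_line (hf : Pencil f v N c) (hp : CoveringOnto p {z | f z ≠ 0}) {z₀ : Z}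
    {q₀ : ℂ[X]} (hq₀ : ∀ t, f (z₀ + t • v) = q₀.eval t) {w₀ : ℂ} {R : ℝ}
    (h0 : (0 : ℂ) ∉ ball w₀ R)
    (hcrit : ∀ t, q₀.eval t ∈ ball w₀ R → (derivative q₀).eval t ≠ 0)
    {w' : ℂ} {R' : ℝ} (hR' : 0 < R') (hsub : ball w' R' ⊆ ball w₀ R) {L : Set E}
    (hL : ClopenIn L ((fun e => f (p e)) ⁻¹' ball w' R')) (z : Z) :
    ∃ A : Set {x : E × ℂ // p x.1 = z + x.2 • v},
      ClopenIn A ((fun x => f (p x.1.1)) ⁻¹' ball w₀ R) ∧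
      ∀ x, f (p x.1.1) ∈ ball w' R' → (x ∈ A ↔ x.1.1 ∈ L) := by
  obtain ⟨H, hN, hc, hH⟩ := hf.plane z₀ (z - z₀)
  have hφ : Continuous fun y : ℂ × ℂ => z₀ + y.1 • (z - z₀) + y.2 • v := by fun_prop
  have hp' : CoveringOnto (fun x : {x : E × (ℂ × ℂ) // p x.1 = z₀ + x.2.1 • (z - z₀) + x.2.2 • v}
      => x.1.2) {y | eval2 H y.1 y.2 ≠ 0} := by
    convert hp.pullback hφ using 1
    ext t; simp [← hH]
  have hg : (fun x : {x : E × (ℂ × ℂ) // p x.1 = z₀ + x.2.1 • (z - z₀) + x.2.2 • v} =>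
      eval2 H x.1.2.1 x.1.2.2) = fun x => f (p x.1.1) := funext fun x => by rw [x.2, hH]
  have hq : H.map (evalRingHom 0) = q₀ := Polynomial.funext fun t => by
    rw [← hq₀]
    have := hH 0 t
    simp only [zero_smul, add_zero] at this
    exact this.symm
  have hj : Continuous fun x : {x : E × (ℂ × ℂ) // p x.1 = z₀ + x.2.1 • (z - z₀) + x.2.2 • v} =>
    x.1.1 := by fun_prop
  have key := exists_clopenIn_extend_plane (hN ▸ hf.one_le)
    (fun x => by rw [hc, eval_C]; exact hf.ne_zero) hp' h0 (fun t ht => by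
      have h1 : eval2 H 0 t = q₀.eval t := by rw [← hq]; rfl
      have h2 : eval2 (derivative H) 0 t = (derivative q₀).eval t := by
        rw [← hq, eval2, derivative_map]
      rw [h2]
      exact hcrit t (h1 ▸ ht)) hR' hsub (L := (fun x => x.1.1) ⁻¹' L)
  rw [hg] at key
  obtain ⟨L', hL', hLL'⟩ := key (hL.preimage hj)
  let i : {x : E × ℂ // p x.1 = z + x.2 • v} →
      {x : E × (ℂ × ℂ) // p x.1 = z₀ + x.2.1 • (z - z₀) + x.2.2 • v} :=
    fun x => ⟨(x.1.1, (1, x.1.2)), by simp [x.2]⟩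
  have hi : Continuous i := by fun_prop
  refine ⟨i ⁻¹' L', hL'.preimage hi, fun x hx => ?_⟩
  have := Set.ext_iff.1 hLL' (i x)
  exact ⟨fun h => this.1 ⟨h, hx⟩, fun h => (this.2 h).1⟩

theorem exists_extend (hf : Pencil f v N c) (hp : CoveringOnto p {z | f z ≠ 0}) {z₀ : Z}
    {q₀ : ℂ[X]} (hq₀ : ∀ t, f (z₀ + t • v) = q₀.eval t) {w₀ : ℂ} {R : ℝ}
    (h0 : (0 : ℂ) ∉ ball w₀ R)
    (hcrit : ∀ t, q₀.eval t ∈ ball w₀ R → (derivative q₀).eval t ≠ 0)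
    {w' : ℂ} {R' : ℝ} (hR' : 0 < R') (hsub : ball w' R' ⊆ ball w₀ R) {L : Set E}
    (hL : ClopenIn L ((fun e => f (p e)) ⁻¹' ball w' R')) :
    ∃ L', ClopenIn L' ((fun e => f (p e)) ⁻¹' ball w₀ R) ∧
      L' ∩ (fun e => f (p e)) ⁻¹' ball w' R' = L := by
  choose A hA hAL using hf.exists_extend_line hp hq₀ h0 hcrit hR' hsub hL
  have hgc : Continuous fun e => f (p e) := hf.continuous.comp hp.continuous
  have hpc := hp.continuous
  have hfc := hf.continuous
  -- the extensions are consistent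
  have hcons : ∀ z t e (h : p e = z + t • v), f (p e) ∈ ball w₀ R →
      ((⟨(e, t), h⟩ : {x : E × ℂ // p x.1 = z + x.2 • v}) ∈ A z ↔
        (⟨(e, 0), by simp⟩ : {x : E × ℂ // p x.1 = p e + x.2 • v}) ∈ A (p e)) := by
    intro z t e h he
    let s : {x : E × ℂ // p x.1 = p e + x.2 • v} → {x : E × ℂ // p x.1 = z + x.2 • v} :=
      fun x => ⟨(x.1.1, x.1.2 + t), by
        have h1 := x.2
        simp only [h] at h1
        simp only [h1, add_smul]; abel⟩
    have hs : Continuous s := by fun_prop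
    have hE : ∀ B B' : Set {x : E × ℂ // p x.1 = p e + x.2 • v},
        ClopenIn B ((fun x => f (p x.1.1)) ⁻¹' ball w₀ R) →
        ClopenIn B' ((fun x => f (p x.1.1)) ⁻¹' ball w₀ R) →
        (∀ x, f (p x.1.1) ∈ ball w' R' → (x ∈ B → x ∈ B')) → B ⊆ B' := by
      intro B B' hB hB' hBB
      rw [← sdiff_eq_empty]
      refine hf.eq_empty_of_line hp (p e) isOpen_ball (convex_ball _ _).isPreconnected h0
        (hB.sdiff hB') (hsub (mem_ball_self hR')) fun x hx hxw => hx.2 (hBB x ?_ hx.1)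
      rw [hxw]; exact mem_ball_self hR'
    have h1 : ∀ x, f (p x.1.1) ∈ ball w' R' → (x ∈ s ⁻¹' A z ↔ x ∈ A (p e)) := by
      intro x hx
      rw [hAL _ x hx, mem_preimage, hAL _ (s x) hx]
    have h2 : s ⁻¹' A z = A (p e) := Subset.antisymm
      (hE _ _ ((hA z).preimage hs) (hA _) fun x hx h => (h1 x hx).1 h)
      (hE _ _ (hA _) ((hA z).preimage hs) fun x hx h => (h1 x hx).2 h)
    rw [← h2, mem_preimage]
    simp [s]
  let M : Set E := {e | (⟨(e, 0), by simp⟩ : {x : E × ℂ // p x.1 = p e + x.2 • v}) ∈ A (p e)}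
  have hMA : ∀ z (x : {x : E × ℂ // p x.1 = z + x.2 • v}), f (p x.1.1) ∈ ball w₀ R →
      (x ∈ A z ↔ x.1.1 ∈ M) := fun z x hx => hcons z x.1.2 x.1.1 x.2 hx
  have hMsub : M ⊆ (fun e => f (p e)) ⁻¹' ball w₀ R := fun e he => (hA (p e)).subset he
  have hML : ∀ e, f (p e) ∈ ball w' R' → (e ∈ M ↔ e ∈ L) := fun e he =>
    hAL (p e) ⟨(e, 0), by simp⟩ he
  -- membership is constant along lines in small sheets
  have hline : ∀ (O : Set Z) (σ : Z → E), Convex ℝ O → ContinuousOn σ O →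
      (∀ x ∈ O, p (σ x) = x) → (∀ x ∈ O, f x ∈ ball w₀ R) → ∀ y ∈ O, ∀ s : ℂ, y + s • v ∈ O →
      σ y ∈ M → σ (y + s • v) ∈ M := by
    intro O σ hO hσ hpσ hOR y hy s hs hM
    let T : Set ℂ := {t | y + t • v ∈ O}
    have hT : Convex ℝ T := by
      intro a ha b hb r s hr hs hrs
      have := hO ha hb hr hs hrs
      show y + (r • a + s • b) • v ∈ O
      convert this using 1
      rw [smul_add, smul_add, add_add_add_comm, ← add_smul, hrs, one_smul, add_smul, smul_assoc,
        smul_assoc]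
    have hTO : ∀ t : T, y + (t : ℂ) • v ∈ O := fun t => t.2
    let γ : T → {x : E × ℂ // p x.1 = y + x.2 • v} :=
      fun t => ⟨(σ (y + (t : ℂ) • v), t), hpσ _ t.2⟩
    have hγ : Continuous γ := by
      refine Continuous.subtype_mk (Continuous.prodMk ?_ continuous_subtype_val) _
      exact hσ.comp_continuous (by fun_prop) hTO
    have hTc : IsPreconnected (univ : Set T) :=
      (isPreconnected_iff_preconnectedSpace.1 hT.isPreconnected).isPreconnected_univ
    have h0T : (0 : ℂ) ∈ T := by simpa [T] using hy
    have h1 := ((hA y).preimage hγ).subset_of_isPreconnected hTc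
      (fun t _ => by
        show f (p (σ (y + (t : ℂ) • v))) ∈ ball w₀ R
        rw [hpσ _ t.2]; exact hOR _ t.2) ⟨⟨0, h0T⟩, mem_univ _, by
        rw [mem_preimage, hMA]
        · simpa [γ] using hM
        · simp only [γ]
          rw [hpσ _ h0T]; exact hOR _ h0T⟩ (mem_univ ⟨s, hs⟩)
    rw [mem_preimage, hMA] at h1
    · exact h1
    · show f (p (σ (y + s • v))) ∈ ball w₀ R
      rw [hpσ _ hs]; exact hOR _ hs
  have hloc : ∀ e, f (p e) ∈ ball w₀ R → M ∈ 𝓝 e ∨ Mᶜ ∈ 𝓝 e := by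
    intro e he
    let z := p e
    let j : {x : E × ℂ // p x.1 = z + x.2 • v} → E := fun x => x.1.1
    have hj : Continuous j := by fun_prop
    let S : Set {x : E × ℂ // p x.1 = z + x.2 • v} := (fun x => f (p x.1.1)) ⁻¹' ball w₀ R
    have hS : IsOpen S := isOpen_ball.preimage (by fun_prop)
    let G := j ⁻¹' (interior M ∪ interior Mᶜ)
    have hG : IsOpen G := (isOpen_interior.union isOpen_interior).preimage hj
    have hbad : IsOpen (S \ G) := by
      rw [isOpen_iff_mem_nhds]
      rintro x ⟨hxS, hxG⟩
      obtain ⟨Nx, hNx, hxN, hNU, σ, hσ, hσx, hpσ, hop, -⟩ :=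
        hp.exists_section_nhds hf.isOpen_ne_zero (e := j x) (O := univ) Filter.univ_mem
      obtain ⟨ρ, hρ, hρN⟩ := Metric.isOpen_iff.1
        (hNx.inter (isOpen_ball.preimage hf.continuous)) (p (j x)) ⟨hxN, hxS⟩
      set O := ball (p (j x)) ρ with hO
      have hON : O ⊆ Nx := fun y hy => (hρN hy).1
      have hσO := hop O hON isOpen_ball
      have hjσ : j x ∈ σ '' O := ⟨p (j x), mem_ball_self hρ, hσx⟩
      filter_upwards [hS.mem_nhds hxS, (hσO.preimage hj).mem_nhds hjσ] with x' hx'S hx'σ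
      refine ⟨hx'S, fun hx'G => hxG ?_⟩
      obtain ⟨y', hy'O, hy'⟩ := hx'σ
      have hpy' : p (j x') = y' := by rw [← hy', hpσ _ (hON hy'O)]
      let s : ℂ := x'.1.2 - x.1.2
      have hy's : y' = p (j x) + s • v := by
        rw [← hpy']
        show p x'.1.1 = p x.1.1 + _
        rw [x.2, x'.2]; simp only [s, sub_smul]; abel
      -- near `j x`, membership is governed by membership near `j x'`
      have hcont : ContinuousAt (fun y => σ (y + s • v)) (p (j x)) := by
        have h1 : ContinuousAt σ (p (j x) + s • v) :=
          (hσ.mono hON).continuousAt (isOpen_ball.mem_nhds (hy's ▸ hy'O))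
        exact ContinuousAt.comp (f := fun y => y + s • v) h1 (by fun_prop)
      have hval : σ (p (j x) + s • v) = j x' := by rw [← hy's, hy']
      have hev : ∀ P : Set E, P ∈ 𝓝 (j x') → ∀ᶠ e' in 𝓝 (j x), ∃ y ∈ O, y + s • v ∈ O ∧
          σ y = e' ∧ σ (y + s • v) ∈ P := by
        intro P hP
        have h1 : ∀ᶠ y in 𝓝 (p (j x)), σ (y + s • v) ∈ P := by
          have : Filter.Tendsto (fun y => σ (y + s • v)) (𝓝 (p (j x))) (𝓝 (j x')) := by
            rw [← hval]; exact hcont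
          exact this hP
        have h2 : ∀ᶠ y in 𝓝 (p (j x)), y + s • v ∈ O :=
          (isOpen_ball.preimage (by fun_prop : Continuous fun y : Z => y + s • v)).mem_nhds
            (by rw [mem_preimage, ← hy's]; exact hy'O)
        have h3 : ∀ᶠ y in 𝓝 (p (j x)), y ∈ O := isOpen_ball.mem_nhds (mem_ball_self hρ)
        have h4 := hp.continuous.continuousAt.eventually (h1.and (h2.and h3))
        filter_upwards [h4, hσO.mem_nhds hjσ] with e' he' he''
        obtain ⟨y, hy, rfl⟩ := he''
        rw [hpσ _ (hON hy)] at he'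
        exact ⟨y, hy, he'.2.1, rfl, he'.1⟩
      have hOR : ∀ y ∈ O, f y ∈ ball w₀ R := fun y hy => (hρN hy).2
      have hpσ' : ∀ y ∈ O, p (σ y) = y := fun y hy => hpσ y (hON hy)
      have hσ' := hσ.mono hON
      rcases hx'G with h | h
      · refine Or.inl (mem_interior_iff_mem_nhds.2 ?_)
        filter_upwards [hev M (mem_interior_iff_mem_nhds.1 h)] with e' he'
        obtain ⟨y, hy, hys, rfl, hP⟩ := he'
        have := hline O σ (convex_ball _ _) hσ' hpσ' hOR _ hys (-s)
          (by rw [neg_smul, add_neg_cancel_right]; exact hy) hP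
        rwa [neg_smul, add_neg_cancel_right] at this
      · refine Or.inr (mem_interior_iff_mem_nhds.2 ?_)
        filter_upwards [hev Mᶜ (mem_interior_iff_mem_nhds.1 h)] with e' he'
        obtain ⟨y, hy, hys, rfl, hP⟩ := he'
        exact fun hM => hP (hline O σ (convex_ball _ _) hσ' hpσ' hOR _ hy s hys hM)
    have hGS : ClopenIn (S \ G) S := ⟨sdiff_subset, hbad, by
      rw [Set.sdiff_sdiff_right_self]; exact hS.inter hG⟩
    have hempty := hf.eq_empty_of_line hp z isOpen_ball (convex_ball _ _).isPreconnected h0 hGS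
      (hsub (mem_ball_self hR')) (by
        rintro x ⟨hxS, hxG⟩ hxw
        refine hxG ?_
        have hxw' : j x ∈ (fun e => f (p e)) ⁻¹' ball w' R' := by
          show f (p x.1.1) ∈ ball w' R'
          rw [hxw]; exact mem_ball_self hR'
        by_cases hxL : j x ∈ L
        · refine Or.inl (mem_interior_iff_mem_nhds.2 ?_)
          filter_upwards [hL.isOpen.mem_nhds hxL] with e' he'
          exact (hML e' (hL.subset he')).2 he'
        · refine Or.inr (mem_interior_iff_mem_nhds.2 ?_)
          filter_upwards [hL.isOpen_diff.mem_nhds ⟨hxw', hxL⟩] with e' he'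
          exact fun h => he'.2 ((hML e' he'.1).1 h))
    have hmem : (⟨(e, 0), by simp [z]⟩ : {x : E × ℂ // p x.1 = z + x.2 • v}) ∈ G := by
      by_contra h
      have : (⟨(e, 0), by simp [z]⟩ : {x : E × ℂ // p x.1 = z + x.2 • v}) ∈ S \ G := ⟨he, h⟩
      rw [hempty] at this; exact this
    rcases hmem with h | h
    · exact Or.inl (mem_interior_iff_mem_nhds.1 h)
    · exact Or.inr (mem_interior_iff_mem_nhds.1 h)
  refine ⟨M, ⟨hMsub, ?_, ?_⟩, ?_⟩
  · rw [isOpen_iff_mem_nhds]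
    intro e he
    rcases hloc e (hMsub he) with h | h
    · exact h
    · exact absurd he (mem_of_mem_nhds h)
  · rw [isOpen_iff_mem_nhds]
    rintro e ⟨he, he'⟩
    rcases hloc e he with h | h
    · exact absurd (mem_of_mem_nhds h) he'
    · exact Filter.inter_mem ((isOpen_ball.preimage hgc).mem_nhds he) h
  · ext e
    exact ⟨fun h => (hML e h.2).1 h.1, fun h => ⟨(hML e (hL.subset h)).2 h, hL.subset h⟩⟩

theorem existsExt (hf : Pencil f v N c) (hp : CoveringOnto p {z | f z ≠ 0}) {z₀ : Z}
    {q₀ : ℂ[X]} (hq₀ : ∀ t, f (z₀ + t • v) = q₀.eval t) {w₀ : ℂ} {R : ℝ}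
    (h0 : (0 : ℂ) ∉ ball w₀ R)
    (hcrit : ∀ t, q₀.eval t ∈ ball w₀ R → (derivative q₀).eval t ≠ 0) :
    ExistsExt (fun e => f (p e)) (ball w₀ R) := by
  intro W' hW' hW'W ⟨w₁, hw₁⟩ L hL
  obtain ⟨ε, hε, hεW⟩ := Metric.isOpen_iff.1 hW' w₁ hw₁
  have hgc : Continuous fun e => f (p e) := hf.continuous.comp hp.continuous
  obtain ⟨L', hL', h⟩ := hf.exists_extend hp hq₀ h0 hcrit hε (hεW.trans hW'W)
    (hL.restrict (isOpen_ball.preimage hgc) (preimage_mono hεW))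
  exact ⟨_, hεW, isOpen_ball, nonempty_ball.2 hε, L', hL', h⟩

/-- There is a finite set outside of which relatively clopen sets extend uniquely. -/
theorem exists_finite_goodAt (hf : Pencil f v N c) :
    ∃ B : Set ℂ, B.Finite ∧ ∀ {E : Type*} [TopologicalSpace E] {p : E → Z},
      CoveringOnto p {z | f z ≠ 0} → ∀ w ≠ 0, w ∉ B → GoodAt (fun e => f (p e)) w := by
  obtain ⟨q, hN, -, hq⟩ := hf.line 0
  have hd : derivative q ≠ 0 := by
    intro h
    have := derivative_eq_zero.1 h
    have := hf.one_le
    omega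
  have hB : (q.eval '' {t | (derivative q).IsRoot t}).Finite :=
    (Polynomial.finite_setOfPred_isRoot hd).image _
  refine ⟨_, hB, fun {E} _ {p} hp w hw0 hwB => ?_⟩
  obtain ⟨δ, hδ, hδ'⟩ := Metric.isOpen_iff.1
    ((hB.insert 0).isClosed.isOpen_compl) w (by simp only [mem_compl_iff, mem_insert_iff]; tauto)
  have h0 : (0 : ℂ) ∉ ball w δ := fun h => hδ' h (mem_insert _ _)
  exact ⟨δ, hδ, hf.uniqueExt hp h0, hf.existsExt hp hq h0 fun t ht h =>
    hδ' ht (mem_insert_of_mem _ ⟨t, h, rfl⟩)⟩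

end Pencil

/-- Under unique and existing continuation of clopen sets over `Ω`, connectedness of the part over `Ω`
can be tested over any connected open subset. -/
theorem isPreconnected_preimage_iff {Y : Type*} [TopologicalSpace Y] {Z : Type*} [NormedAddCommGroup Z]
    [NormedSpace ℝ Z] {φ : Y → Z}
    {Ω W : Set Z} (hφ : Continuous φ) (hΩ : IsOpen Ω) (hΩc : IsPreconnected Ω) (hu : UniqueExt φ Ω)
    (he : ExistsExt φ Ω) (hW : IsOpen W) (hWΩ : W ⊆ Ω) (hne : W.Nonempty) (hWc : IsPreconnected W) :
    IsPreconnected (φ ⁻¹' W) ↔ IsPreconnected (φ ⁻¹' Ω) := by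
  constructor
  · intro h
    refine isPreconnected_of_clopenIn (hΩ.preimage hφ) fun L hL hLne => ?_
    have hL' := hL.restrict (hW.preimage hφ) (preimage_mono hWΩ)
    by_cases hemp : (φ ⁻¹' W ∩ (L ∩ φ ⁻¹' W)).Nonempty
    · have hsub := hL'.subset_of_isPreconnected h subset_rfl hemp
      have hd := hu Ω W hΩ subset_rfl hΩc hWΩ hW hne _ hL.diff (by
        ext y; simp only [mem_inter_iff, mem_sdiff, mem_empty_iff_false, iff_false]
        rintro ⟨⟨_, h1⟩, h2⟩; exact h1 (hsub h2).1)
      exact sdiff_eq_empty.1 hd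
    · have hd := hu Ω W hΩ subset_rfl hΩc hWΩ hW hne _ hL (by
        by_contra hc
        obtain ⟨y, hy⟩ := nonempty_iff_ne_empty.2 hc
        exact hemp ⟨y, hy.2, hy⟩)
      rw [hd] at hLne; exact absurd hLne not_nonempty_empty
  · intro h
    refine isPreconnected_of_clopenIn (hW.preimage hφ) fun L hL hLne => ?_
    obtain ⟨L', hL', hLL⟩ := he.exists_eq hu hφ hW hWΩ hne hWc hL
    obtain ⟨y, hy⟩ := hLne
    have hsub := hL'.subset_of_isPreconnected h subset_rfl
      ⟨y, hWΩ (hL.subset hy), ((hLL ▸ hy : y ∈ L' ∩ φ ⁻¹' W)).1⟩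
    intro x hx
    rw [← hLL]; exact ⟨hsub (hWΩ hx), hx⟩

theorem isPreconnected_preimage_of_goodAt {Y : Type*} [TopologicalSpace Y] {Z : Type*}
    [NormedAddCommGroup Z] [NormedSpace ℝ Z] {φ : Y → Z} {Ω : Set Z} (hφ : Continuous φ)
    (hΩ : IsOpen Ω) (hΩc : IsPreconnected Ω) (hg : ∀ w ∈ Ω, GoodAt φ w) {w₀ : Z} (hw₀ : w₀ ∈ Ω) {ε : ℝ}
    (hε : 0 < ε) (h₀ : ∀ r, 0 < r → r ≤ ε → IsPreconnected (φ ⁻¹' ball w₀ r)) {w : Z} (hw : w ∈ Ω) :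
    ∃ δ > 0, ∀ W, IsOpen W → W ⊆ ball w δ → W.Nonempty → IsPreconnected W →
      IsPreconnected (φ ⁻¹' W) := by
  choose! δ hδ hu he using hg
  have key : ∀ w ∈ Ω, ∀ W, IsOpen W → W ⊆ ball w (δ w) → W.Nonempty → IsPreconnected W →
      (IsPreconnected (φ ⁻¹' W) ↔ IsPreconnected (φ ⁻¹' ball w (δ w))) := fun w hw W h1 h2 h3 h4 =>
    isPreconnected_preimage_iff hφ isOpen_ball (convex_ball _ _).isPreconnected (hu w hw) (he w hw)
      h1 h2 h3 h4
  have hloc : ∀ w ∈ Ω, ∀ w' ∈ Ω ∩ ball w (δ w), (IsPreconnected (φ ⁻¹' ball w (δ w)) ↔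
      IsPreconnected (φ ⁻¹' ball w' (δ w'))) := by
    rintro w hw w' ⟨hw', hww'⟩
    obtain ⟨r, hr, hrs⟩ := Metric.isOpen_iff.1 (isOpen_ball.inter isOpen_ball) w'
      (show w' ∈ ball w (δ w) ∩ ball w' (δ w') from ⟨hww', mem_ball_self (hδ w' hw')⟩)
    rw [← key w hw (ball w' r) isOpen_ball (hrs.trans inter_subset_left) (nonempty_ball.2 hr)
      (convex_ball _ _).isPreconnected, key w' hw' (ball w' r) isOpen_ball
      (hrs.trans inter_subset_right) (nonempty_ball.2 hr) (convex_ball _ _).isPreconnected]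
  have hC : ClopenIn {w ∈ Ω | IsPreconnected (φ ⁻¹' ball w (δ w))} Ω := by
    refine ⟨fun w hw => hw.1, ?_, ?_⟩
    · rw [isOpen_iff_mem_nhds]
      rintro w ⟨hw, hQ⟩
      filter_upwards [hΩ.mem_nhds hw, ball_mem_nhds w (hδ w hw)] with w' h1 h2
      exact ⟨h1, (hloc w hw w' ⟨h1, h2⟩).1 hQ⟩
    · rw [isOpen_iff_mem_nhds]
      rintro w ⟨hw, hQ⟩
      filter_upwards [hΩ.mem_nhds hw, ball_mem_nhds w (hδ w hw)] with w' h1 h2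
      exact ⟨h1, fun h => hQ ⟨hw, (hloc w hw w' ⟨h1, h2⟩).2 h.2⟩⟩
  have hall := hC.subset_of_isPreconnected hΩc subset_rfl ⟨w₀, hw₀, hw₀, by
    have hm : 0 < min ε (δ w₀) := lt_min hε (hδ w₀ hw₀)
    exact (key w₀ hw₀ (ball w₀ (min ε (δ w₀))) isOpen_ball (ball_subset_ball (min_le_right _ _))
      (nonempty_ball.2 hm) (convex_ball _ _).isPreconnected).1 (h₀ _ hm (min_le_left _ _))⟩
  exact ⟨δ w, hδ w hw, fun W h1 h2 h3 h4 => (key w hw W h1 h2 h3 h4).2 (hall hw).2⟩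

/-- The pullback of the covering `exp` along `φ - b`. -/
abbrev ExpCover {Y : Type*} (φ : Y → ℂ) (b : ℂ) := {x : ℂ × Y // Complex.exp x.1 = φ x.2 - b}

namespace ExpCover

variable {Y : Type*} {φ : Y → ℂ} {b : ℂ}

/-- The tautological logarithm of `φ - b`. -/
def log (x : ExpCover φ b) : ℂ := x.1.1

/-- The projection of the exponential cover. -/
def pr (x : ExpCover φ b) : Y := x.1.2

theorem map_pr (x : ExpCover φ b) : φ (pr x) = b + Complex.exp (log x) := by
  have := x.2
  simp only [pr, log, this]; ring

theorem exp_log (x : ExpCover φ b) : Complex.exp (log x) = φ (pr x) - b := x.2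

/-- The deck transformations. -/
noncomputable def shift (m : ℤ) (x : ExpCover φ b) : ExpCover φ b :=
  ⟨(x.1.1 + m * (2 * Real.pi * Complex.I), x.1.2), by
    rw [← x.2, Complex.exp_eq_exp_iff_exists_int]; exact ⟨m, rfl⟩⟩

@[simp] theorem log_shift (m : ℤ) (x : ExpCover φ b) :
    log (shift m x) = log x + m * (2 * Real.pi * Complex.I) := rfl

@[simp] theorem pr_shift (m : ℤ) (x : ExpCover φ b) : pr (shift m x) = pr x := rfl

@[ext] theorem ext' {x y : ExpCover φ b} (h : log x = log y) (h' : pr x = pr y) : x = y :=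
  Subtype.ext (Prod.ext h h')

theorem shift_shift (m m' : ℤ) (x : ExpCover φ b) : shift m (shift m' x) = shift (m + m') x := by
  refine ext' ?_ rfl
  simp only [log_shift]; push_cast; ring

theorem shift_zero (x : ExpCover φ b) : shift 0 x = x := by
  refine ext' ?_ rfl
  simp

theorem exists_shift_eq {x y : ExpCover φ b} (h : pr x = pr y) : ∃ m : ℤ, y = shift m x := by
  obtain ⟨m, hm⟩ := Complex.exp_eq_exp_iff_exists_int.1
    (show Complex.exp (log y) = Complex.exp (log x) by rw [exp_log, exp_log, h])
  exact ⟨m, ext' hm h.symm⟩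

variable [TopologicalSpace Y]

theorem continuous_log : Continuous (log : ExpCover φ b → ℂ) := continuous_subtype_val.fst

theorem continuous_pr : Continuous (pr : ExpCover φ b → Y) := continuous_subtype_val.snd

theorem continuous_shift (m : ℤ) : Continuous (shift m : ExpCover φ b → ExpCover φ b) :=
  Continuous.subtype_mk (by fun_prop) _

theorem coveringOnto_exp : CoveringOnto Complex.exp {w | w ≠ 0} :=
  ⟨Complex.exp_ne_zero, Complex.isCoveringMap_exp⟩

theorem coveringOnto (hφ : Continuous φ) :
    CoveringOnto (pr : ExpCover φ b → Y) {y | φ y - b ≠ 0} :=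
  coveringOnto_exp.pullback (φ := fun y => φ y - b) (by fun_prop)

theorem isOpenMap_pr (hφ : Continuous φ) : IsOpenMap (pr : ExpCover φ b → Y) :=
  (coveringOnto hφ).isOpenMap (isOpen_ne_fun (by fun_prop) continuous_const)

/-- Saturated clopen sets descend along the exponential cover. -/
theorem clopenIn_image (hφ : Continuous φ) {W : Set ℂ} {A : Set (ExpCover φ b)}
    (hA : ClopenIn A (log ⁻¹' W))
    (hsat : ∀ x y : ExpCover φ b, log x ∈ W → log y ∈ W → pr x = pr y → x ∈ A → y ∈ A) :
    ClopenIn (pr '' A) (φ ⁻¹' ((fun ζ => b + Complex.exp ζ) '' W)) ∧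
      ∀ x, log x ∈ W → (pr x ∈ pr '' A ↔ x ∈ A) := by
  have h2 : ∀ x, log x ∈ W → (pr x ∈ pr '' A ↔ x ∈ A) := by
    intro x hx
    refine ⟨?_, fun h => ⟨x, h, rfl⟩⟩
    rintro ⟨y, hy, hyx⟩
    exact hsat y x (hA.subset hy) hx hyx hy
  refine ⟨⟨?_, isOpenMap_pr hφ _ hA.isOpen, ?_⟩, h2⟩
  · rintro _ ⟨x, hx, rfl⟩
    exact ⟨log x, hA.subset hx, (map_pr x).symm⟩
  · convert isOpenMap_pr hφ _ hA.isOpen_diff using 1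
    ext y
    constructor
    · rintro ⟨⟨ζ, hζ, hy⟩, hyA⟩
      refine ⟨⟨(ζ, y), by simp only at hy; rw [← hy]; simp⟩, ⟨hζ, fun h => hyA ⟨_, h, rfl⟩⟩, rfl⟩
    · rintro ⟨x, ⟨hx, hxA⟩, rfl⟩
      exact ⟨⟨log x, hx, (map_pr x).symm⟩, fun h => hxA ((h2 x hx).1 h)⟩

theorem exp_injOn_ball {ζ : ℂ} {δ : ℝ} (hδ : δ ≤ Real.pi) : InjOn Complex.exp (ball ζ δ) := by
  intro x hx y hy h
  obtain ⟨m, hm⟩ := Complex.exp_eq_exp_iff_exists_int.1 h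
  have hd : dist x y < 2 * Real.pi := by
    have := dist_triangle_right x y ζ
    rw [mem_ball] at hx hy; linarith
  rw [hm, dist_eq_norm] at hd
  simp only [add_sub_cancel_left, norm_mul, Complex.norm_intCast, Complex.norm_ofNat,
    Complex.norm_real, Complex.norm_I, mul_one, Real.norm_eq_abs, abs_of_pos Real.pi_pos] at hd
  have : |(m : ℝ)| < 1 := by
    by_contra hc
    push Not at hc
    nlinarith [Real.pi_pos]
  have hm0 : m = 0 := by
    have : |m| < 1 := by exact_mod_cast this
    exact Int.abs_lt_one_iff.1 this
  simpa [hm0] using hm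

theorem isOpenMap_add_exp : IsOpenMap fun ζ => b + Complex.exp ζ :=
  (Homeomorph.addLeft b).isOpenMap.comp Complex.isOpenMap_exp

theorem clopenIn_image_of_subset_ball (hφ : Continuous φ) {W : Set ℂ} {ζ : ℂ} {δ : ℝ}
    (hδ : δ ≤ Real.pi) (hW : W ⊆ ball ζ δ) {A : Set (ExpCover φ b)} (hA : ClopenIn A (log ⁻¹' W)) :
    ClopenIn (pr '' A) (φ ⁻¹' ((fun ζ => b + Complex.exp ζ) '' W)) ∧
      ∀ x, log x ∈ W → (pr x ∈ pr '' A ↔ x ∈ A) := by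
  refine clopenIn_image hφ hA fun x y hx hy hxy hxA => ?_
  have : x = y := ext' (exp_injOn_ball hδ (hW hx) (hW hy) (by rw [exp_log, exp_log, hxy])) hxy
  exact this ▸ hxA

theorem goodAt (hφ : Continuous φ) {ζ : ℂ} (h : GoodAt φ (b + Complex.exp ζ)) :
    GoodAt (log : ExpCover φ b → ℂ) ζ := by
  obtain ⟨δ, hδ, hu, he⟩ := h
  have hcont : Continuous fun ζ => b + Complex.exp ζ := by fun_prop
  obtain ⟨r, hr, hrs⟩ := Metric.isOpen_iff.1 ((isOpen_ball (x := b + Complex.exp ζ) (ε := δ)).preimage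
    hcont) ζ (mem_ball_self hδ)
  set ε := min r Real.pi with hεdef
  have hε : 0 < ε := lt_min hr Real.pi_pos
  have hεπ : ε ≤ Real.pi := min_le_right _ _
  have hεs : ball ζ ε ⊆ (fun ζ => b + Complex.exp ζ) ⁻¹' ball (b + Complex.exp ζ) δ :=
    (ball_subset_ball (min_le_left _ _)).trans hrs
  refine ⟨ε, hε, ?_, ?_⟩
  · intro W W' hW hWΩ hWc hW'W hW' hne A hA hAW
    have hA' := (clopenIn_image_of_subset_ball hφ hεπ hWΩ hA).1
    have := hu _ ((fun ζ => b + Complex.exp ζ) '' W') (isOpenMap_add_exp _ hW)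
      (image_subset_iff.2 (hWΩ.trans hεs)) (hWc.image _ hcont.continuousOn) (image_mono hW'W)
      (isOpenMap_add_exp _ hW') (hne.image _) _ hA' ?_
    · exact image_eq_empty.1 this
    · rw [eq_empty_iff_forall_notMem] at hAW ⊢
      rintro _ ⟨⟨x, hx, rfl⟩, ζ', hζ', hζx⟩
      have : ζ' = log x := exp_injOn_ball hεπ (hWΩ (hW'W hζ')) (hWΩ (hA.subset hx)) (by
        simp only [map_pr] at hζx; exact add_left_cancel hζx)
      exact hAW x ⟨hx, show log x ∈ W' from this ▸ hζ'⟩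
  · intro W' hW' hW'Ω hne L hL
    obtain ⟨hL1, hL2⟩ := clopenIn_image_of_subset_ball hφ hεπ hW'Ω hL
    obtain ⟨W'', hW''W', hW'', hne'', L', hL', hLL⟩ := he _ (isOpenMap_add_exp _ hW')
      (image_subset_iff.2 (hW'Ω.trans hεs)) (hne.image _) _ hL1
    refine ⟨W' ∩ (fun ζ => b + Complex.exp ζ) ⁻¹' W'', inter_subset_left,
      hW'.inter (hW''.preimage hcont), ?_, pr ⁻¹' L' ∩ log ⁻¹' ball ζ ε, ?_, ?_⟩
    · obtain ⟨w, hw⟩ := hne''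
      obtain ⟨ζ', h1, rfl⟩ := hW''W' hw
      exact ⟨ζ', h1, hw⟩
    · refine (hL'.preimage continuous_pr).restrict (isOpen_ball.preimage continuous_log) ?_
      intro x hx
      rw [mem_preimage, mem_preimage, map_pr x]
      exact hεs hx
    · ext x
      constructor
      · rintro ⟨⟨hx1, hx2⟩, hx3, hx4⟩
        refine ⟨?_, hx3, hx4⟩
        have : pr x ∈ L' ∩ φ ⁻¹' W'' := ⟨hx1, by rw [mem_preimage, map_pr x]; exact hx4⟩
        rw [hLL] at this
        exact (hL2 x hx3).1 this.1
      · rintro ⟨hx1, hx3, hx4⟩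
        refine ⟨⟨?_, hW'Ω hx3⟩, hx3, hx4⟩
        have : pr x ∈ pr '' L ∩ φ ⁻¹' W'' := ⟨⟨x, hx1, rfl⟩, by rw [mem_preimage, map_pr x]; exact hx4⟩
        rw [← hLL] at this
        exact this.1

/-- The exponential cover is connected over convex sets whose image avoids the bad values. -/
theorem isPreconnected_preimage (hφ : Continuous φ) {Ω : Set ℂ}
    (hΩ : IsOpen Ω) (hΩc : IsPreconnected Ω) (hg : ∀ w ∈ Ω, GoodAt φ w) {w₀ : ℂ} (hw₀ : w₀ ∈ Ω) {ε : ℝ}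
    (hε : 0 < ε) (h₀ : ∀ r, 0 < r → r ≤ ε → IsPreconnected (φ ⁻¹' ball w₀ r)) {H : Set ℂ}
    (hH : IsOpen H) (hHc : Convex ℝ H) (hHne : H.Nonempty) (hHΩ : ∀ ζ ∈ H, b + Complex.exp ζ ∈ Ω) :
    IsPreconnected ((log : ExpCover φ b → ℂ) ⁻¹' H) := by
  have hgood : ∀ ζ ∈ H, GoodAt (log : ExpCover φ b → ℂ) ζ := fun ζ hζ => goodAt hφ (hg _ (hHΩ ζ hζ))
  obtain ⟨ζ, hζ⟩ := hHne
  obtain ⟨δ, hδ, hc⟩ := isPreconnected_preimage_of_goodAt hφ hΩ hΩc hg hw₀ hε h₀ (hHΩ ζ hζ)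
  have hcont : Continuous fun ζ => b + Complex.exp ζ := by fun_prop
  obtain ⟨r, hr, hrs⟩ := Metric.isOpen_iff.1 (((isOpen_ball (x := b + Complex.exp ζ)
    (ε := δ)).preimage hcont).inter hH) ζ ⟨mem_ball_self hδ, hζ⟩
  set ρ := min r Real.pi with hρdef
  have hρ : 0 < ρ := lt_min hr Real.pi_pos
  have hρπ : ρ ≤ Real.pi := min_le_right _ _
  have hρs := (ball_subset_ball (x := ζ) (min_le_left r Real.pi)).trans hrs
  refine (isPreconnected_preimage_iff (W := ball ζ ρ) continuous_log hH hHc.isPreconnected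
    (uniqueExt_of_goodAt continuous_log hgood) (existsExt_of_goodAt continuous_log hH hHc hgood)
    isOpen_ball (hρs.trans inter_subset_right) (nonempty_ball.2 hρ)
    (convex_ball _ _).isPreconnected).1 ?_
  refine isPreconnected_of_clopenIn (isOpen_ball.preimage continuous_log) fun A hA ⟨x, hx⟩ => ?_
  obtain ⟨hA1, hA2⟩ := clopenIn_image_of_subset_ball hφ hρπ subset_rfl hA
  have hpre := hc _ (isOpenMap_add_exp (b := b) _ (isOpen_ball (x := ζ) (ε := ρ)))
    (image_subset_iff.2 (hρs.trans inter_subset_left)) ((nonempty_ball.2 hρ).image _)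
    ((convex_ball _ _).isPreconnected.image _ hcont.continuousOn)
  have hsub := hA1.subset_of_isPreconnected hpre subset_rfl
    ⟨pr x, hA1.subset ⟨x, hx, rfl⟩, ⟨x, hx, rfl⟩⟩
  intro y hy
  exact (hA2 y hy).1 (hsub ⟨log y, hy, (map_pr y).symm⟩)

end ExpCover

theorem Polynomial.Monic.eq_of_pow_eq_pow {P Q : ℂ[X]} (hP : P.Monic) (hQ : Q.Monic) {k : ℕ}
    (hk : k ≠ 0) (h : P ^ k = Q ^ k) : P = Q := by
  have hroots : P.roots = Q.roots := by
    have h' := congrArg Polynomial.roots h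
    rw [roots_pow, roots_pow] at h'
    ext a
    have := congrArg (Multiset.count a) h'
    rw [Multiset.count_nsmul, Multiset.count_nsmul] at this
    exact Nat.eq_of_mul_eq_mul_left (Nat.pos_of_ne_zero hk) this
  rw [(IsAlgClosed.splits P).eq_prod_roots_of_monic hP,
    (IsAlgClosed.splits Q).eq_prod_roots_of_monic hQ, hroots]

/-- A polynomial all of whose root multiplicities are divisible by `k` is, up to a constant,
a `k`-th power. -/
theorem Polynomial.exists_eq_C_mul_pow (q : ℂ[X]) {k : ℕ} (h : ∀ r, k ∣ q.rootMultiplicity r) :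
    ∃ s : ℂ[X], s.Monic ∧ q = C q.leadingCoeff * s ^ k := by
  refine ⟨∏ r ∈ q.roots.toFinset, (X - C r) ^ (q.rootMultiplicity r / k),
    monic_prod_of_monic _ _ fun r _ => (monic_X_sub_C r).pow _, ?_⟩
  conv_lhs => rw [(IsAlgClosed.splits q).eq_prod_roots]
  rw [Finset.prod_multiset_map_count, ← Finset.prod_pow]
  congr 1
  refine Finset.prod_congr rfl fun r _ => ?_
  rw [← pow_mul, Nat.div_mul_cancel (h r), count_roots]

/-- A locally bounded function with closed graph is continuous. -/
theorem continuous_of_closed_graph {Z W : Type*} [TopologicalSpace Z] [TopologicalSpace W]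
    {a : Z → W} {K : Z → Set W} (hK : ∀ z, IsCompact (K z)) (hb : ∀ z, ∀ᶠ z' in 𝓝 z, a z' ∈ K z)
    {Γ : Set (Z × W)} (hΓ : IsClosed Γ) (ha : ∀ z, (z, a z) ∈ Γ)
    (hu : ∀ z w, (z, w) ∈ Γ → w = a z) : Continuous a := by
  rw [continuous_iff_continuousAt]
  intro z
  rw [ContinuousAt, Filter.tendsto_iff_ultrafilter]
  intro G hG
  obtain ⟨w, -, hw⟩ := (hK z).ultrafilter_le_nhds (G.map a) (by
    rw [Filter.le_principal_iff]; exact hG (hb z))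
  have hmem : (z, w) ∈ Γ := by
    refine hΓ.mem_of_tendsto (b := (G : Filter Z)) (f := fun z' => (z', a z')) ?_
      (Filter.Eventually.of_forall ha)
    rw [nhds_prod_eq]
    exact Filter.Tendsto.prodMk hG hw
  rw [← hu z w hmem]
  exact hw

namespace Pencil

variable {Z : Type*} [NormedAddCommGroup Z] [NormedSpace ℂ Z] {f : Z → ℂ} {v : Z} {N : ℕ} {c : ℂ}

/-- If all multiplicities of the value `b` along the lines are divisible by `k`, then `f - b` has a
continuous `k`-th root. -/
theorem exists_continuous_root (hf : Pencil f v N c) {b : ℂ} {k : ℕ} (hk : k ≠ 0)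
    (h : ∀ (z : Z) (q : ℂ[X]), (∀ t, f (z + t • v) = q.eval t) →
      ∀ r, k ∣ (q - C b).rootMultiplicity r) :
    ∃ σ : Z → ℂ, Continuous σ ∧ ∀ z, c * σ z ^ k = f z - b := by
  have hex : ∀ z, ∃ s : ℂ[X], s.Monic ∧ s.natDegree = N / k ∧
      ∀ t, c * s.eval t ^ k = f (z + t • v) - b := by
    intro z
    obtain ⟨q, hqN, hqc, hq⟩ := hf.line z
    have hdeg : (C b).degree < q.degree := by
      refine lt_of_le_of_lt degree_C_le (natDegree_pos_iff_degree_pos.1 ?_)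
      rw [hqN]; exact hf.one_le
    obtain ⟨s, hs, hqs⟩ := (q - C b).exists_eq_C_mul_pow (h z q hq)
    rw [leadingCoeff_sub_of_degree_lt hdeg, hqc] at hqs
    refine ⟨s, hs, ?_, fun t => ?_⟩
    · have := congrArg natDegree hqs
      rw [natDegree_sub_C, natDegree_C_mul hf.ne_zero, natDegree_pow, hqN] at this
      rw [this, Nat.mul_div_cancel_left _ (Nat.pos_of_ne_zero hk)]
    · have := congrArg (eval t) hqs
      simp only [eval_sub, eval_C, eval_mul, eval_pow] at this
      rw [← this, hq]
  choose s hs hsd hse using hex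
  set M := N / k
  let I : (Fin (M + 1) → ℂ) → ℂ[X] := fun w =>
    Lagrange.interpolate Finset.univ (fun i : Fin (M + 1) => ((i : ℕ) : ℂ)) w
  have hinj : Set.InjOn (fun i : Fin (M + 1) => ((i : ℕ) : ℂ)) (Finset.univ : Finset (Fin (M + 1))) := by
    intro i _ j _ hij
    exact Fin.ext (Nat.cast_injective (R := ℂ) hij)
  have hIdeg : ∀ w, (I w).degree < (M + 1 : ℕ) := fun w => by
    have := Lagrange.degree_interpolate_lt w hinj
    rwa [Finset.card_univ, Fintype.card_fin] at this
  let a : Z → Fin (M + 1) → ℂ := fun z i => (s z).eval ((i : ℕ) : ℂ)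
  have hIa : ∀ z, I (a z) = s z := by
    intro z
    refine (Lagrange.eq_interpolate_of_eval_eq (fun i : Fin (M + 1) => (s z).eval ((i : ℕ) : ℂ)) hinj
      ?_ fun i _ => rfl).symm
    rw [Finset.card_univ, Fintype.card_fin, degree_eq_natDegree (hs z).ne_zero, hsd]
    exact_mod_cast Nat.lt_succ_self M
  have hIeval : ∀ w t, (I w).eval t = ∑ i, w i * (Lagrange.basis Finset.univ
      (fun i : Fin (M + 1) => ((i : ℕ) : ℂ)) i).eval t := by
    intro w t
    simp [I, Lagrange.interpolate_apply, eval_finsetSum]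
  have hIcoeff : ∀ w, (I w).coeff M = ∑ i, w i * (Lagrange.basis Finset.univ
      (fun i : Fin (M + 1) => ((i : ℕ) : ℂ)) i).coeff M := by
    intro w
    simp [I, Lagrange.interpolate_apply, finsetSum_coeff]
  have hfc := hf.continuous
  have hcont : Continuous a := by
    refine continuous_of_closed_graph
      (K := fun z => Set.pi univ fun i => closedBall 0 (‖(a z) i‖ ^ k + 1)) ?_ ?_
      (Γ := {x | (∀ t, c * (I x.2).eval t ^ k = f (x.1 + t • v) - b) ∧ (I x.2).coeff M = 1}) ?_ ?_ ?_
    · exact fun z => isCompact_univ_pi fun i => isCompact_closedBall _ _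
    · intro z
      simp only [Set.mem_pi, mem_univ, forall_true_left, mem_closedBall_zero_iff]
      rw [Filter.eventually_all]
      intro i
      have hz : ∀ z', ‖a z' i‖ ^ k = ‖(f (z' + ((i : ℕ) : ℂ) • v) - b) / c‖ := by
        intro z'
        rw [← hse z', mul_div_cancel_left₀ _ hf.ne_zero, norm_pow]
      have hco : ContinuousAt (fun z' => ‖a z' i‖ ^ k) z := by
        simp only [hz]
        have : Continuous fun z' => ‖(f (z' + ((i : ℕ) : ℂ) • v) - b) / c‖ := by fun_prop
        exact this.continuousAt
      have hlt := hco.eventually (gt_mem_nhds (show ‖a z i‖ ^ k < ‖a z i‖ ^ k + 1 by linarith))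
      filter_upwards [hlt] with z' hz'
      by_contra hcon
      push Not at hcon
      have h1 : (1 : ℝ) ≤ ‖a z' i‖ := le_trans (by linarith [pow_nonneg (norm_nonneg (a z i)) k]) hcon.le
      have := le_self_pow₀ h1 hk
      linarith
    · rw [show {x : Z × (Fin (M + 1) → ℂ) | (∀ t, c * (I x.2).eval t ^ k = f (x.1 + t • v) - b) ∧
          (I x.2).coeff M = 1} = (⋂ t, {x | c * (I x.2).eval t ^ k = f (x.1 + t • v) - b}) ∩
          {x | (I x.2).coeff M = 1} by ext; simp]
      refine IsClosed.inter ?_ ?_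
      · refine isClosed_iInter fun t => isClosed_eq ?_ (by fun_prop)
        simp only [hIeval]; fun_prop
      · refine isClosed_eq ?_ continuous_const
        simp only [hIcoeff]; fun_prop
    · intro z
      simp only [mem_ofPred_eq, hIa]
      refine ⟨hse z, ?_⟩
      rw [← hsd z]; exact hs z
    · rintro z w ⟨h1, h2⟩
      simp only at h1 h2
      have hmon : (I w).Monic := by
        refine monic_of_natDegree_le_of_coeff_eq_one M ?_ h2
        exact Nat.lt_succ_iff.1 ((natDegree_lt_iff_degree_lt fun h0 => by simp [h0] at h2).2 (hIdeg w))
      have heq : I w = s z := hmon.eq_of_pow_eq_pow (hs z) hk (Polynomial.funext fun t => by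
        rw [eval_pow, eval_pow]
        exact mul_left_cancel₀ hf.ne_zero ((h1 t).trans (hse z t).symm))
      funext i
      change w i = (s z).eval _
      rw [← heq]
      exact (Lagrange.eval_interpolate_at_node w hinj (Finset.mem_univ i)).symm
  refine ⟨fun z => a z 0, by fun_prop, fun z => ?_⟩
  have := hse z 0
  simpa [a] using this

end Pencil

theorem Complex.re_lt_of_norm_exp_lt {ζ : ℂ} {R : ℝ} (h : ‖Complex.exp ζ‖ < Real.exp R) : ζ.re < R := by
  rwa [Complex.norm_exp, Real.exp_lt_exp] at h

/-- The left half-plane `re < R`. -/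
def leftHalfPlane (R : ℝ) : Set ℂ := {ζ | ζ.re < R}

theorem isOpen_leftHalfPlane (R : ℝ) : IsOpen (leftHalfPlane R) :=
  isOpen_lt Complex.continuous_re continuous_const

theorem convex_leftHalfPlane (R : ℝ) : Convex ℝ (leftHalfPlane R) :=
  convex_halfSpace_re_lt R

theorem add_mem_leftHalfPlane {R : ℝ} {ζ : ℂ} (m : ℤ) :
    ζ + m * (2 * Real.pi * Complex.I) ∈ leftHalfPlane R ↔ ζ ∈ leftHalfPlane R := by
  simp [leftHalfPlane]

theorem nonempty_leftHalfPlane (R : ℝ) : (leftHalfPlane R).Nonempty :=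
  ⟨((R - 1 : ℝ) : ℂ), by simp [leftHalfPlane]⟩

theorem CoveringOnto.locallyConnectedSpace {E Z : Type*} [TopologicalSpace E] [TopologicalSpace Z]
    [LocallyConnectedSpace Z] {p : E → Z} {U : Set Z} (hp : CoveringOnto p U) (hU : IsOpen U) :
    LocallyConnectedSpace E := by
  rw [locallyConnectedSpace_iff_subsets_isOpen_isConnected]
  intro e O hO
  obtain ⟨N, hN, heN, -, σ, hσ, hσe, -, hop, hmaps⟩ := hp.exists_section_nhds hU hO
  obtain ⟨N', hN'N, hN', heN', hc⟩ := locallyConnectedSpace_iff_subsets_isOpen_isConnected.1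
    (inferInstanceAs (LocallyConnectedSpace Z)) (p e) N (hN.mem_nhds heN)
  exact ⟨σ '' N', image_subset_iff.2 (hN'N.trans hmaps), hop N' hN'N hN', ⟨p e, heN', hσe⟩,
    hc.image _ (hσ.mono hN'N)⟩

theorem coveringOnto_subtype_val {Z : Type*} [TopologicalSpace Z] (U : Set Z) :
    CoveringOnto (Subtype.val : U → Z) U where
  mem e := e.2
  cov := by
    intro x
    refine IsEvenlyCovered.to_isEvenlyCovered_preimage (I := Unit)
      ⟨inferInstance, univ, mem_univ _, isOpen_univ, isOpen_univ,
        (Homeomorph.prodUnique (univ : Set U) Unit).symm, fun _ => rfl⟩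

namespace Pencil

variable {Z : Type*} [NormedAddCommGroup Z] [NormedSpace ℂ Z] {f : Z → ℂ} {v : Z} {N : ℕ} {c : ℂ}
  {E : Type*} [TopologicalSpace E] {p : E → Z}

open ExpCover

/-- A loop around a point of multiplicity `m` shifts the logarithm `m` times. -/
theorem exists_shift_rootMultiplicity (hf : Pencil f v N c) (hp : CoveringOnto p {z | f z ≠ 0})
    {b : ℂ} (hb : b ≠ 0) {R : ℝ} {L : Set (ExpCover (fun e => f (p e)) b)}
    (hL : ClopenIn L (log ⁻¹' leftHalfPlane R)) {z : Z} {q : ℂ[X]}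
    (hq : ∀ t, f (z + t • v) = q.eval t) (hqb : q - C b ≠ 0) {r : ℂ} (hr : q.eval r = b) :
    ∃ ζ ∈ leftHalfPlane R, ∃ z', Complex.exp ζ = f z' - b ∧ f z' ≠ 0 ∧
      ∀ y : ExpCover (fun e => f (p e)) b, log y = ζ → p (pr y) = z' →
        (y ∈ L ↔ shift ((q - C b).rootMultiplicity r) y ∈ L) := by
  set m := (q - C b).rootMultiplicity r with hm
  obtain ⟨u, hu, hur⟩ := exists_eq_pow_rootMultiplicity_mul_and_not_dvd (q - C b) hqb r
  rw [← hm] at hu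
  have hur : u.eval r ≠ 0 := fun h => hur (dvd_iff_isRoot.2 h)
  have hfac : ∀ t, q.eval t - b = (t - r) ^ m * u.eval t := by
    intro t
    have := congrArg (eval t) hu
    simpa using this
  obtain ⟨O, hO, hrO, hOU, hsec⟩ := hp.exists_sections hf.isOpen_ne_zero
    (show z + r • v ∈ {z | f z ≠ 0} by rw [mem_ofPred_eq, hq, hr]; exact hb)
  have hc1 : Continuous fun t : ℂ => z + t • v := by fun_prop
  have hc2 : Continuous fun t : ℂ => u.eval t / u.eval r := by fun_prop
  have hc3 : Continuous fun t : ℂ => ‖q.eval t - b‖ := by fun_prop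
  obtain ⟨ρ, hρ, hρs⟩ := Metric.isOpen_iff.1 (((hO.preimage hc1).inter
    (Complex.isOpen_slitPlane.preimage hc2)).inter (isOpen_Iio.preimage hc3)) r
    (show r ∈ ((fun t : ℂ => z + t • v) ⁻¹' O ∩ (fun t : ℂ => u.eval t / u.eval r) ⁻¹'
      Complex.slitPlane) ∩ (fun t : ℂ => ‖q.eval t - b‖) ⁻¹' Iio (Real.exp R) from
      ⟨⟨hrO, by simp [div_self hur]⟩, by simp [hr, Real.exp_pos]⟩)
  set K := leftHalfPlane (Real.log ρ) with hK
  have hball : ∀ η ∈ K, r + Complex.exp η ∈ ball r ρ := by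
    intro η hη
    rw [mem_ball, dist_eq_norm, add_sub_cancel_left, Complex.norm_exp]
    calc Real.exp η.re < Real.exp (Real.log ρ) := Real.exp_lt_exp.2 hη
      _ = ρ := Real.exp_log hρ
  let Λ : ℂ → ℂ := fun η => m * η + Complex.log (u.eval r) +
    Complex.log (u.eval (r + Complex.exp η) / u.eval r)
  have hΛexp : ∀ η ∈ K, Complex.exp (Λ η) = f (z + (r + Complex.exp η) • v) - b := by
    intro η hη
    have hs := (hρs (hball η hη)).1.2
    have h0 := Complex.slitPlane_ne_zero hs
    simp only [Λ]
    rw [Complex.exp_add, Complex.exp_add, Complex.exp_log hur, Complex.exp_log h0, hq, hfac,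
      add_sub_cancel_left, ← Complex.exp_nat_mul]
    field_simp
  have hΛK : ∀ η ∈ K, Λ η ∈ leftHalfPlane R := by
    intro η hη
    refine Complex.re_lt_of_norm_exp_lt ?_
    rw [hΛexp η hη, hq]
    exact (hρs (hball η hη)).2
  have hΛc : ContinuousOn Λ K := by
    refine ContinuousOn.add (by fun_prop) ?_
    refine ContinuousOn.clog (by fun_prop) fun η hη => (hρs (hball η hη)).1.2
  obtain ⟨η₀, hη₀⟩ := nonempty_leftHalfPlane (Real.log ρ)
  have hη₁ : η₀ + 2 * Real.pi * Complex.I ∈ K := by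
    have := (add_mem_leftHalfPlane (ζ := η₀) (R := Real.log ρ) 1).2 hη₀
    simpa using this
  refine ⟨Λ η₀, hΛK η₀ hη₀, z + (r + Complex.exp η₀) • v, hΛexp η₀ hη₀,
    hOU (hρs (hball η₀ hη₀)).1.1, fun y hy1 hy2 => ?_⟩
  obtain ⟨σ, hσ, hσe, hpσ, -⟩ := hsec (pr y) (by rw [hy2]; exact (hρs (hball η₀ hη₀)).1.1)
  let Φ : K → ExpCover (fun e => f (p e)) b := fun η =>
    ⟨(Λ η, σ (z + (r + Complex.exp η) • v)), by
      simp only [hpσ _ (hρs (hball η η.2)).1.1]; exact hΛexp η η.2⟩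
  have hΦ : Continuous Φ := by
    refine Continuous.subtype_mk (Continuous.prodMk ?_ ?_) _
    · exact continuousOn_iff_continuous_domRestrict.1 hΛc
    · exact hσ.comp_continuous (by fun_prop) fun η => (hρs (hball η η.2)).1.1
  have hKc : IsPreconnected (univ : Set K) :=
    (isPreconnected_iff_preconnectedSpace.1 (convex_leftHalfPlane (Real.log ρ)).isPreconnected).isPreconnected_univ
  have hrange : IsPreconnected (Φ '' univ) := hKc.image _ hΦ.continuousOn
  have hrs : Φ '' univ ⊆ log ⁻¹' leftHalfPlane R := by
    rintro _ ⟨η, -, rfl⟩; exact hΛK η η.2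
  have hexp1 : Complex.exp (η₀ + 2 * Real.pi * Complex.I) = Complex.exp η₀ := Complex.exp_periodic η₀
  have e0 : Φ ⟨η₀, hη₀⟩ = y := ext' hy1.symm (by
    change σ _ = pr y; rw [← hσe, hy2])
  have e1 : Φ ⟨η₀ + 2 * Real.pi * Complex.I, hη₁⟩ = shift m y := by
    refine ext' ?_ ?_
    · rw [log_shift, hy1]
      change Λ (η₀ + 2 * Real.pi * Complex.I) = _
      simp only [Λ, hexp1]; push_cast; ring
    · change σ (z + (r + Complex.exp (η₀ + 2 * Real.pi * Complex.I)) • v) = pr y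
      rw [hexp1, ← hσe, hy2]
  constructor
  · intro hy
    exact hL.subset_of_isPreconnected hrange hrs ⟨y, ⟨_, mem_univ _, e0⟩, hy⟩ ⟨_, mem_univ _, e1⟩
  · intro hy
    exact hL.subset_of_isPreconnected hrange hrs ⟨_, ⟨_, mem_univ _, e1⟩, hy⟩ ⟨_, mem_univ _, e0⟩

end Pencil

namespace Pencil

variable {Z : Type*} [NormedAddCommGroup Z] [NormedSpace ℂ Z] {f : Z → ℂ} {v : Z} {N : ℕ} {c : ℂ}
  {E : Type*} [TopologicalSpace E] {p : E → Z}

open ExpCover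

theorem eq_empty_of_fiber (hf : Pencil f v N c) (hp : CoveringOnto p {z | f z ≠ 0})
    {b : ℂ} {H : Set ℂ} (hH : IsOpen H)
    (hconn : IsPreconnected ((log : ExpCover (fun u : {z | f z ≠ 0} => f u) b → ℂ) ⁻¹' H))
    {A : Set (ExpCover (fun e => f (p e)) b)} (hA : ClopenIn A (log ⁻¹' H))
    {ζ : ℂ} (hζ : ζ ∈ H) {z : Z} (hz : Complex.exp ζ = f z - b) (hz0 : f z ≠ 0)
    (h : ∀ y ∈ A, log y = ζ → p (pr y) ≠ z) : A = ∅ := by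
  by_contra hne
  obtain ⟨y, hy⟩ := nonempty_iff_ne_empty.2 hne
  have hfc := hf.continuous
  have hfU : Continuous fun u : {z | f z ≠ 0} => f u := by fun_prop
  have : LocallyConnectedSpace {z | f z ≠ 0} :=
    (coveringOnto_subtype_val {z | f z ≠ 0}).locallyConnectedSpace hf.isOpen_ne_zero
  have : LocallyConnectedSpace (ExpCover (fun u : {z | f z ≠ 0} => f u) b) :=
    (ExpCover.coveringOnto hfU).locallyConnectedSpace (isOpen_ne_fun (by fun_prop) continuous_const)
  have hφ : Continuous fun x : ExpCover (fun u : {z | f z ≠ 0} => f u) b => (x.1.2 : Z) :=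
    continuous_subtype_val.comp continuous_pr
  have hpull := hp.pullback hφ
  let τ : {x : E × ExpCover (fun u : {z | f z ≠ 0} => f u) b // p x.1 = (x.2.1.2 : Z)} →
      ExpCover (fun e => f (p e)) b := fun x => ⟨(log x.1.2, x.1.1), by
        simp only [x.2]; exact x.1.2.2⟩
  have hτ : Continuous τ := by
    refine Continuous.subtype_mk (Continuous.prodMk ?_ ?_) _
    · exact continuous_log.comp continuous_subtype_val.snd
    · exact continuous_subtype_val.fst
  have hA' := hpull.clopenIn_image (hf.isOpen_ne_zero.preimage hφ) (hH.preimage continuous_log)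
    (fun x _ => x.1.2.2) (hA.preimage hτ)
  have hy0 : f (p (pr y)) ≠ 0 := hp.mem _
  have hsub := hA'.subset_of_isPreconnected hconn subset_rfl
    ⟨⟨(log y, ⟨p (pr y), hy0⟩), exp_log y⟩, hA.subset hy,
      ⟨⟨(pr y, ⟨(log y, ⟨p (pr y), hy0⟩), exp_log y⟩), rfl⟩, hy, rfl⟩⟩
  obtain ⟨⟨⟨e, x⟩, hx⟩, hxA, hxe⟩ := hsub
    (show (⟨(ζ, ⟨z, hz0⟩), hz⟩ : ExpCover (fun u : {z | f z ≠ 0} => f u) b) ∈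
      (log : ExpCover (fun u : {z | f z ≠ 0} => f u) b → ℂ) ⁻¹' H from hζ)
  simp only at hxe
  subst hxe
  exact h _ hxA rfl hx

theorem forall_shift_iff (hf : Pencil f v N c) (hp : CoveringOnto p {z | f z ≠ 0})
    {b : ℂ} {R : ℝ} (hconn : IsPreconnected
      ((log : ExpCover (fun u : {z | f z ≠ 0} => f u) b → ℂ) ⁻¹' leftHalfPlane R))
    {L : Set (ExpCover (fun e => f (p e)) b)} (hL : ClopenIn L (log ⁻¹' leftHalfPlane R))
    {m : ℤ} (h : ∃ ζ ∈ leftHalfPlane R, ∃ z', Complex.exp ζ = f z' - b ∧ f z' ≠ 0 ∧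
      ∀ y : ExpCover (fun e => f (p e)) b, log y = ζ → p (pr y) = z' → (y ∈ L ↔ shift m y ∈ L))
    (y : ExpCover (fun e => f (p e)) b) : y ∈ L ↔ shift m y ∈ L := by
  obtain ⟨ζ, hζ, z', hz', hz0, hyy⟩ := h
  have hL' : ClopenIn (shift m ⁻¹' L) (log ⁻¹' leftHalfPlane R) := by
    have := hL.preimage (continuous_shift m)
    convert this using 1
    ext y; exact (add_mem_leftHalfPlane m).symm
  have h1 := hf.eq_empty_of_fiber hp (isOpen_leftHalfPlane R) hconn (hL.sdiff hL') hζ hz' hz0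
    fun y hy h1 h2 => hy.2 ((hyy y h1 h2).1 hy.1)
  have h2 := hf.eq_empty_of_fiber hp (isOpen_leftHalfPlane R) hconn (hL'.sdiff hL) hζ hz' hz0
    fun y hy h1 h2 => hy.2 ((hyy y h1 h2).2 hy.1)
  rw [sdiff_eq_empty] at h1 h2
  exact ⟨fun h => h1 h, fun h => h2 h⟩

theorem not_forall_dvd (hf : Pencil f v N c)
    {b : ℂ} {R : ℝ} (hconn : IsPreconnected
      ((log : ExpCover (fun u : {z | f z ≠ 0} => f u) b → ℂ) ⁻¹' leftHalfPlane R))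
    (hne : ((log : ExpCover (fun u : {z | f z ≠ 0} => f u) b → ℂ) ⁻¹' leftHalfPlane R).Nonempty)
    {k : ℕ} (hk : k ≠ 0)
    (h : ∀ (z : Z) (q : ℂ[X]), (∀ t, f (z + t • v) = q.eval t) →
      ∀ r, k ∣ (q - C b).rootMultiplicity r) : k = 1 := by
  obtain ⟨σ, hσ, hσk⟩ := hf.exists_continuous_root hk h
  let g : ExpCover (fun u : {z | f z ≠ 0} => f u) b → ℂ := fun x =>
    σ x.1.2 * Complex.exp (-(log x) / k)
  have hg : Continuous g := by
    have h1 : Continuous fun x : ExpCover (fun u : {z | f z ≠ 0} => f u) b => (x.1.2 : Z) :=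
      continuous_subtype_val.comp continuous_pr
    have h2 : Continuous (log : ExpCover (fun u : {z | f z ≠ 0} => f u) b → ℂ) := continuous_log
    fun_prop
  have hk' : (k : ℂ) ≠ 0 := by exact_mod_cast hk
  have hgk : ∀ x, c * g x ^ k = 1 := by
    intro x
    have he := exp_log x
    have h1 : Complex.exp (-(log x) / k) ^ k = (Complex.exp (log x))⁻¹ := by
      rw [← Complex.exp_nat_mul, ← Complex.exp_neg]; congr 1; field_simp
    simp only [g, mul_pow, ← mul_assoc, hσk, h1]
    rw [he]
    simp only [pr] at he ⊢
    refine mul_inv_cancel₀ ?_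
    have := Complex.exp_ne_zero (log x)
    rwa [he] at this
  have hfin : (g '' (log ⁻¹' leftHalfPlane R)).Finite := by
    have hP0 : (C c * X ^ k - 1 : ℂ[X]) ≠ 0 := by
      intro h0
      have := congrArg (eval 0) h0
      simp [hk] at this
    refine (Polynomial.finite_setOfPred_isRoot hP0).subset ?_
    rintro _ ⟨x, -, rfl⟩
    simp [IsRoot, hgk x]
  obtain ⟨x, hx⟩ := hne
  have hsub := hfin.countable.isTotallyDisconnected _ subset_rfl (hconn.image _ hg.continuousOn)
    ⟨x, hx, rfl⟩ ⟨shift 1 x, (add_mem_leftHalfPlane 1).2 hx, rfl⟩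
  have hgx : g x ≠ 0 := by
    intro h0; have := hgk x; rw [h0, zero_pow hk] at this; simp at this
  have hsh : g (shift 1 x) = g x * Complex.exp (-(2 * Real.pi * Complex.I) / k) := by
    simp only [g, log_shift]
    change σ x.1.2 * _ = _
    rw [mul_assoc (σ _), ← Complex.exp_add]; congr 2; push_cast; ring
  rw [hsh] at hsub
  have h1 : Complex.exp (-(2 * Real.pi * Complex.I) / k) = 1 := by
    have : g x * Complex.exp (-(2 * Real.pi * Complex.I) / k) = g x * 1 := by rw [← hsub, mul_one]
    exact mul_left_cancel₀ hgx this
  obtain ⟨j, hj⟩ := Complex.exp_eq_one_iff.1 h1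
  have h2pi : (2 * Real.pi * Complex.I : ℂ) ≠ 0 := Complex.two_pi_I_ne_zero
  have hjk : (-1 : ℂ) = j * k := by
    rw [neg_div, div_eq_mul_inv] at hj
    have : (2 * Real.pi * Complex.I) * (-1 : ℂ) = (2 * Real.pi * Complex.I) * (j * k) := by
      calc (2 * Real.pi * Complex.I) * (-1 : ℂ) = -(2 * Real.pi * Complex.I * (k : ℂ)⁻¹) * k := by
            field_simp
        _ = _ := by rw [hj]; ring
    exact mul_left_cancel₀ h2pi this
  have hjk' : (-1 : ℤ) = j * k := by exact_mod_cast hjk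
  have : (k : ℤ) ∣ 1 := ⟨-j, by linarith⟩
  exact_mod_cast Int.eq_one_of_dvd_one (by positivity) this

/-- Clopen sets over a punctured neighbourhood of `b` have no monodromy. -/
theorem shift_one_iff (hf : Pencil f v N c) (hp : CoveringOnto p {z | f z ≠ 0})
    {b : ℂ} (hb : b ≠ 0) {R : ℝ} (hconn : IsPreconnected
      ((log : ExpCover (fun u : {z | f z ≠ 0} => f u) b → ℂ) ⁻¹' leftHalfPlane R))
    (hne : ((log : ExpCover (fun u : {z | f z ≠ 0} => f u) b → ℂ) ⁻¹' leftHalfPlane R).Nonempty)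
    {L : Set (ExpCover (fun e => f (p e)) b)} (hL : ClopenIn L (log ⁻¹' leftHalfPlane R))
    (m : ℤ) (y : ExpCover (fun e => f (p e)) b) : y ∈ L ↔ shift m y ∈ L := by
  let Γ : AddSubgroup ℤ :=
    { carrier := {m | ∀ y, y ∈ L ↔ shift m y ∈ L}
      zero_mem' := fun y => by rw [shift_zero]
      add_mem' := fun {m m'} hm hm' y => by
        rw [← shift_shift]; exact (hm' y).trans (hm _)
      neg_mem' := fun {m} hm y => by
        have := hm (shift (-m) y)
        rw [shift_shift, add_neg_cancel, shift_zero] at this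
        exact this.symm }
  have hmult : ∀ (z : Z) (q : ℂ[X]), (∀ t, f (z + t • v) = q.eval t) → ∀ r,
      ((q - C b).rootMultiplicity r : ℤ) ∈ Γ ∧ (q.eval r = b → 0 < (q - C b).rootMultiplicity r) := by
    intro z q hq r
    have hqb : q - C b ≠ 0 := by
      intro h0
      obtain ⟨t, ht⟩ := hf.exists_eq z (b + 1)
      have := congrArg (eval t) h0
      rw [eval_sub, ← hq, ht] at this
      simp at this
    by_cases hr : q.eval r = b
    · refine ⟨fun y => hf.forall_shift_iff hp hconn hL
        (hf.exists_shift_rootMultiplicity hp hb hL hq hqb hr) y, fun _ => ?_⟩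
      rw [rootMultiplicity_pos hqb]; simp [IsRoot, hr]
    · refine ⟨?_, fun h => absurd h hr⟩
      rw [rootMultiplicity_eq_zero (by simpa [IsRoot, sub_eq_zero] using hr)]
      exact Γ.zero_mem
  obtain ⟨k, hk⟩ := Int.subgroup_cyclic Γ
  have hΓ : ∀ j, j ∈ Γ ↔ k ∣ j := by
    intro j; rw [hk, AddSubgroup.mem_closure_singleton]
    simp only [smul_eq_mul]
    exact ⟨fun ⟨a, ha⟩ => ⟨a, by rw [← ha, mul_comm]⟩, fun ⟨a, ha⟩ => ⟨a, by rw [ha, mul_comm]⟩⟩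
  have hk0 : k.natAbs ≠ 0 := by
    intro h0
    obtain ⟨q, hN, -, hq⟩ := hf.line 0
    obtain ⟨t, ht⟩ := hf.exists_eq 0 b
    rw [hq] at ht
    obtain ⟨h1, h2⟩ := hmult 0 q hq t
    rw [hΓ, Int.natAbs_eq_zero.1 h0, zero_dvd_iff] at h1
    have := h2 ht
    omega
  have h1 := hf.not_forall_dvd hconn hne hk0 fun z q hq r => by
    have := (hΓ _).1 (hmult z q hq r).1
    exact Int.natAbs_dvd_natAbs.2 this
  have : m ∈ Γ := (hΓ m).2 (Int.natAbs_dvd.1 (by rw [h1]; simp))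
  exact this y

end Pencil

theorem image_add_exp_leftHalfPlane (b : ℂ) {δ : ℝ} (hδ : 0 < δ) :
    (fun ζ => b + Complex.exp ζ) '' leftHalfPlane (Real.log δ) = ball b δ \ {b} := by
  ext w
  constructor
  · rintro ⟨ζ, hζ, rfl⟩
    refine ⟨?_, by simp⟩
    rw [mem_ball, dist_eq_norm, add_sub_cancel_left, Complex.norm_exp]
    calc Real.exp ζ.re < Real.exp (Real.log δ) := Real.exp_lt_exp.2 hζ
      _ = δ := Real.exp_log hδ
  · rintro ⟨hw, hwb⟩
    have h0 : w - b ≠ 0 := sub_ne_zero.2 hwb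
    refine ⟨Complex.log (w - b), ?_, by simp [Complex.exp_log h0]⟩
    refine Complex.re_lt_of_norm_exp_lt ?_
    rw [Complex.exp_log h0, Real.exp_log hδ, ← dist_eq_norm]
    exact hw

namespace Pencil

variable {Z : Type*} [NormedAddCommGroup Z] [NormedSpace ℂ Z] {f : Z → ℂ} {v : Z} {N : ℕ} {c : ℂ}
  {E : Type*} [TopologicalSpace E] {p : E → Z}

open ExpCover

theorem goodAt_of_ne_zero (hf : Pencil f v N c) (hp : CoveringOnto p {z | f z ≠ 0}) {ε : ℝ}
    (hε : 0 < ε)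
    (hε' : ∀ w r, ball w r ⊆ ball (0 : ℂ) ε → (0 : ℂ) ∉ ball w r → IsPreconnected (f ⁻¹' ball w r))
    {b : ℂ} (hb : b ≠ 0) : GoodAt (fun e => f (p e)) b := by
  have hfc := hf.continuous
  have hpc := hp.continuous
  have hgc : Continuous fun e => f (p e) := hfc.comp hpc
  obtain ⟨B₁, hB₁, hgood₁⟩ := hf.exists_finite_goodAt
  obtain ⟨B₂, hB₂, hgood₂⟩ := hf.exists_finite_goodAt
  have hg₁ := hgood₁ hp
  have hg₂ := hgood₂ (coveringOnto_subtype_val {z | f z ≠ 0})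
  set S : Set ℂ := insert 0 (B₁ ∪ B₂) with hSdef
  have hS : S.Finite := (hB₁.union hB₂).insert 0
  have hfU : Continuous fun u : {z | f z ≠ 0} => f u := by fun_prop
  have hΩo : IsOpen (univ \ S) := isOpen_univ.sdiff hS.isClosed
  have hΩc : IsPreconnected (univ \ S) := isPreconnected_univ.diff_finite_complex isOpen_univ hS
  have hΩ₁ : ∀ w ∈ univ \ S, GoodAt (fun e => f (p e)) w := fun w hw =>
    hg₁ w (fun h => hw.2 (h ▸ mem_insert _ _)) fun h => hw.2 (mem_insert_of_mem _ (Or.inl h))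
  have hΩ₂ : ∀ w ∈ univ \ S, GoodAt (fun u : {z | f z ≠ 0} => f u) w := fun w hw =>
    hg₂ w (fun h => hw.2 (h ▸ mem_insert _ _)) fun h => hw.2 (mem_insert_of_mem _ (Or.inr h))
  obtain ⟨w₀, hw₀ε, hw₀S⟩ : (ball (0 : ℂ) ε \ S).Nonempty :=
    ((infinite_of_mem_nhds (0 : ℂ) (ball_mem_nhds 0 hε)).sdiff hS).nonempty
  have hw₀0 : w₀ ≠ 0 := fun h => hw₀S (h ▸ mem_insert _ _)
  obtain ⟨r₀, hr₀, hr₀s⟩ := Metric.isOpen_iff.1 ((isOpen_ball (x := (0 : ℂ)) (ε := ε)).sdiff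
    (isClosed_singleton (x := (0 : ℂ)))) w₀ ⟨hw₀ε, hw₀0⟩
  have h₀ : ∀ r, 0 < r → r ≤ r₀ →
      IsPreconnected ((fun u : {z | f z ≠ 0} => f u) ⁻¹' ball w₀ r) := by
    intro r hr hrr
    have hsub := (ball_subset_ball hrr).trans hr₀s
    have h1 := hε' w₀ r (hsub.trans sdiff_subset) fun h => (hsub h).2 rfl
    rw [← IsInducing.subtypeVal.isPreconnected_image]
    convert h1 using 1
    ext z
    constructor
    · rintro ⟨u, hu, rfl⟩; exact hu
    · intro hz
      exact ⟨⟨z, fun h => (hsub hz).2 h⟩, hz, rfl⟩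
  obtain ⟨δ, hδ, hδs⟩ := Metric.isOpen_iff.1 (hS.subset (sdiff_subset (t := {b}))).isClosed.isOpen_compl
    b (fun h => h.2 rfl)
  have hδS : ball b δ \ {b} ⊆ univ \ S := fun w hw => ⟨mem_univ _, fun h => hδs hw.1 ⟨h, hw.2⟩⟩
  have h0δ : (0 : ℂ) ∉ ball b δ := fun h => hδs h ⟨mem_insert _ _, hb.symm⟩
  have himg := image_add_exp_leftHalfPlane b hδ
  set H := leftHalfPlane (Real.log δ) with hH
  have hψc : Continuous fun ζ => b + Complex.exp ζ := by fun_prop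
  have hHΩ : ∀ ζ ∈ H, b + Complex.exp ζ ∈ univ \ S := fun ζ hζ => hδS (himg ▸ ⟨ζ, hζ, rfl⟩)
  have hconn : IsPreconnected ((log : ExpCover (fun u : {z | f z ≠ 0} => f u) b → ℂ) ⁻¹' H) :=
    ExpCover.isPreconnected_preimage hfU hΩo hΩc hΩ₂ ⟨mem_univ _, hw₀S⟩ hr₀ h₀ (isOpen_leftHalfPlane _)
      (convex_leftHalfPlane _) (nonempty_leftHalfPlane _) hHΩ
  have hne : ((log : ExpCover (fun u : {z | f z ≠ 0} => f u) b → ℂ) ⁻¹' H).Nonempty := by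
    obtain ⟨ζ, hζ⟩ := nonempty_leftHalfPlane (Real.log δ)
    obtain ⟨t, ht⟩ := hf.exists_eq 0 (b + Complex.exp ζ)
    exact ⟨⟨(ζ, ⟨0 + t • v, fun h => (hHΩ ζ hζ).2 (by rw [← ht, h]; exact mem_insert _ _)⟩), by
      simp only [ht]; ring⟩, hζ⟩
  have hgood : ∀ ζ ∈ H, GoodAt (log : ExpCover (fun e => f (p e)) b → ℂ) ζ := fun ζ hζ =>
    ExpCover.goodAt hgc (hΩ₁ _ (hHΩ ζ hζ))
  have hHo : IsOpen H := isOpen_leftHalfPlane _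
  refine ⟨δ, hδ, hf.uniqueExt hp h0δ, ?_⟩
  intro W' hW' hW'Ω hne' L hL
  obtain ⟨w₁, hw₁, hw₁b⟩ : (W' \ {b}).Nonempty := by
    obtain ⟨x, hx⟩ := hne'
    exact ((infinite_of_mem_nhds x (hW'.mem_nhds hx)).sdiff (finite_singleton b)).nonempty
  obtain ⟨ζ₁, hζ₁, rfl⟩ : w₁ ∈ (fun ζ => b + Complex.exp ζ) '' H := himg ▸ ⟨hW'Ω hw₁, hw₁b⟩
  obtain ⟨r, hr, hrs⟩ := Metric.isOpen_iff.1 ((hW'.preimage hψc).inter hHo) ζ₁ ⟨hw₁, hζ₁⟩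
  have hL₀ : ClopenIn ((pr : ExpCover (fun e => f (p e)) b → E) ⁻¹' L ∩ log ⁻¹' ball ζ₁ r)
      (log ⁻¹' ball ζ₁ r) := by
    refine (hL.preimage continuous_pr).restrict (isOpen_ball.preimage continuous_log) fun x hx => ?_
    change f (p (pr x)) ∈ W'
    rw [map_pr (φ := fun e => f (p e)) x]
    exact (hrs hx).1
  obtain ⟨Lt, hLt, hLLt⟩ := (existsExt_of_goodAt continuous_log hHo (convex_leftHalfPlane _)
    hgood).exists_eq (uniqueExt_of_goodAt continuous_log hgood) continuous_log isOpen_ball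
    (hrs.trans inter_subset_right) (nonempty_ball.2 hr) (convex_ball _ _).isPreconnected hL₀
  obtain ⟨hL₁, hL₁'⟩ := ExpCover.clopenIn_image hgc hLt fun x y _ _ hxy hx => by
    obtain ⟨m, rfl⟩ := exists_shift_eq hxy
    exact (hf.shift_one_iff hp hb hconn hne hLt m x).1 hx
  rw [himg] at hL₁
  obtain ⟨t, ht⟩ := hf.exists_eq 0 (b + 1)
  obtain ⟨L', hL', hLL'⟩ := hL₁.exists_extend_thin (isOpen_ball.preimage hgc)
    (preimage_mono sdiff_subset) (hp.thin hf.isOpen_ne_zero (G := fun z => f z + -b)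
      (hf.polyLike.add (PolyLike.const _)) (z := 0 + t • v) (by simp only [ht]; simp)
      (isOpen_ball.preimage hgc) fun e he => by
        change (f (p e) ∈ ball b δ ∧ f (p e) ≠ b) ↔ _
        rw [← sub_eq_add_neg, sub_ne_zero]
        exact ⟨fun h => h.2, fun h => ⟨he, h⟩⟩)
  have hsubb : (fun ζ => b + Complex.exp ζ) '' ball ζ₁ r ⊆ ball b δ \ {b} := by
    rw [← himg]; exact image_mono (hrs.trans inter_subset_right)
  refine ⟨(fun ζ => b + Complex.exp ζ) '' ball ζ₁ r,
    image_subset_iff.2 (hrs.trans inter_subset_left), isOpenMap_add_exp _ isOpen_ball,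
    (nonempty_ball.2 hr).image _, L', hL', ?_⟩
  ext y
  refine and_congr_left fun hy => ?_
  have h1 : y ∈ L' ↔ y ∈ pr '' Lt := by
    rw [← hLL']; exact ⟨fun h => ⟨h, hsubb hy⟩, fun h => h.1⟩
  obtain ⟨ζ, hζ, hζy⟩ := hy
  simp only at hζy
  let x : ExpCover (fun e => f (p e)) b := ⟨(ζ, y), by simp only [← hζy]; ring⟩
  have h2 : y ∈ pr '' Lt ↔ x ∈ Lt := hL₁' x (hrs hζ).2
  have h3 : x ∈ Lt ↔ y ∈ L := by
    constructor
    · intro h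
      have : x ∈ Lt ∩ log ⁻¹' ball ζ₁ r := ⟨h, hζ⟩
      rw [hLLt] at this
      exact this.1
    · intro h
      have : x ∈ (pr : ExpCover (fun e => f (p e)) b → E) ⁻¹' L ∩ log ⁻¹' ball ζ₁ r := ⟨h, hζ⟩
      rw [← hLLt] at this
      exact this.1
  rw [h1, h2, h3]

/-- Clopen sets over a punctured neighbourhood of `0` extend globally. -/
theorem exists_extend_univ (hf : Pencil f v N c) (hp : CoveringOnto p {z | f z ≠ 0})
    (hgood : ∀ w ≠ 0, GoodAt (fun e => f (p e)) w) {ε : ℝ} (hε : 0 < ε) {L : Set E}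
    (hL : ClopenIn L ((fun e => f (p e)) ⁻¹' (ball 0 ε \ {0}))) :
    ∃ L', IsClopen L' ∧ L' ∩ (fun e => f (p e)) ⁻¹' (ball 0 ε \ {0}) = L := by
  have hgc : Continuous fun e => f (p e) := hf.continuous.comp hp.continuous
  have himg := image_add_exp_leftHalfPlane 0 hε
  set H := leftHalfPlane (Real.log ε) with hH
  have hHo : IsOpen H := isOpen_leftHalfPlane _
  have hgood' : ∀ ζ ∈ (univ : Set ℂ), GoodAt (log : ExpCover (fun e => f (p e)) 0 → ℂ) ζ :=
    fun ζ _ => ExpCover.goodAt hgc (hgood _ (by simp))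
  have hu := uniqueExt_of_goodAt continuous_log hgood'
  have hmem : ∀ x : ExpCover (fun e => f (p e)) 0, log x ∈ H →
      pr x ∈ (fun e => f (p e)) ⁻¹' (ball 0 ε \ {0}) := by
    intro x hx
    rw [← himg]
    exact ⟨log x, hx, (map_pr x).symm⟩
  have hL₀ : ClopenIn ((pr : ExpCover (fun e => f (p e)) 0 → E) ⁻¹' L ∩ log ⁻¹' H) (log ⁻¹' H) :=
    (hL.preimage continuous_pr).restrict (hHo.preimage continuous_log) hmem
  obtain ⟨Lt, hLt, hLLt⟩ := (existsExt_of_goodAt continuous_log isOpen_univ convex_univ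
    hgood').exists_eq hu continuous_log hHo (subset_univ _) (nonempty_leftHalfPlane _)
    (convex_leftHalfPlane _).isPreconnected hL₀
  have hiff : ∀ x : ExpCover (fun e => f (p e)) 0, log x ∈ H → (x ∈ Lt ↔ pr x ∈ L) := by
    intro x hx
    have : x ∈ Lt ∩ log ⁻¹' H ↔ x ∈ pr ⁻¹' L ∩ log ⁻¹' H := by rw [hLLt]
    exact ⟨fun h => (this.1 ⟨h, hx⟩).1, fun h => (this.2 ⟨h, hx⟩).1⟩
  have hshift : ∀ m : ℤ, shift m ⁻¹' Lt = Lt := by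
    intro m
    refine hu.eq (W := univ) isOpen_univ subset_rfl isPreconnected_univ (subset_univ H) hHo
      (nonempty_leftHalfPlane _) (hLt.preimage (continuous_shift m)) hLt ?_
    ext x
    refine and_congr_left fun hx => ?_
    rw [mem_preimage, hiff x hx, hiff (shift m x) ((add_mem_leftHalfPlane m).2 hx), pr_shift]
  obtain ⟨hL₁, hL₁'⟩ := ExpCover.clopenIn_image hgc hLt fun x y _ _ hxy hx => by
    obtain ⟨m, rfl⟩ := exists_shift_eq hxy
    rw [← hshift m] at hx
    exact hx
  have huniv : (fun e => f (p e)) ⁻¹' ((fun ζ => 0 + Complex.exp ζ) '' univ) = univ := by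
    refine eq_univ_of_forall fun e => ⟨Complex.log (f (p e)), mem_univ _, ?_⟩
    simp only [zero_add]
    exact Complex.exp_log (hp.mem e)
  rw [huniv] at hL₁
  refine ⟨pr '' Lt, ⟨⟨by rw [compl_eq_univ_sdiff]; exact hL₁.isOpen_diff⟩, hL₁.isOpen⟩, ?_⟩
  ext e
  constructor
  · rintro ⟨h, he⟩
    rw [← himg] at he
    obtain ⟨ζ, hζ, hζe⟩ := he
    simp only at hζe
    let x : ExpCover (fun e => f (p e)) 0 := ⟨(ζ, e), by simp only [← hζe]; ring⟩
    exact (hiff x hζ).1 ((hL₁' x (mem_univ _)).1 h)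
  · intro h
    have he := hL.subset h
    refine ⟨?_, he⟩
    rw [← himg] at he
    obtain ⟨ζ, hζ, hζe⟩ := he
    simp only at hζe
    let x : ExpCover (fun e => f (p e)) 0 := ⟨(ζ, e), by simp only [← hζe]; ring⟩
    exact ⟨x, (hiff x hζ).2 h, rfl⟩

end Pencil

section Sections

variable {E Z : Type*} [TopologicalSpace E]

theorem CoveringOnto.clopenIn_eqLocus [TopologicalSpace Z] {p : E → Z} {U : Set Z}
    (hp : CoveringOnto p U) {Y : Type*} [TopologicalSpace Y] {T : Set Y} (hT : IsOpen T)
    {g₁ g₂ : Y → E} (h₁ : ContinuousOn g₁ T) (h₂ : ContinuousOn g₂ T)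
    (he : ∀ y ∈ T, p (g₁ y) = p (g₂ y)) : ClopenIn {y | y ∈ T ∧ g₁ y = g₂ y} T := by
  have c₁ : Continuous fun y : T => g₁ y := continuousOn_iff_continuous_domRestrict.1 h₁
  have c₂ : Continuous fun y : T => g₂ y := continuousOn_iff_continuous_domRestrict.1 h₂
  have hcomp : U.codRestrict p hp.mem ∘ (fun y : T => g₁ y) =
      U.codRestrict p hp.mem ∘ (fun y : T => g₂ y) :=
    funext fun y => Subtype.ext (he y y.2)
  have hclosed := hp.cov.isSeparatedMap.isClosed_eqLocus c₁ c₂ hcomp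
  have hopen := hp.cov.isLocalHomeomorph.isLocallyInjective.isOpen_eqLocus c₁ c₂ hcomp
  refine ⟨fun y hy => hy.1, ?_, ?_⟩
  · convert hT.isOpenMap_subtype_val _ hopen using 1
    ext y; constructor
    · exact fun h => ⟨⟨y, h.1⟩, h.2, rfl⟩
    · rintro ⟨z, hz, rfl⟩; exact ⟨z.2, hz⟩
  · convert hT.isOpenMap_subtype_val _ hclosed.isOpen_compl using 1
    ext y; constructor
    · exact fun h => ⟨⟨y, h.1⟩, fun h' => h.2 ⟨h.1, h'⟩, rfl⟩
    · rintro ⟨z, hz, rfl⟩; exact ⟨z.2, fun h => hz h.2⟩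

variable [NormedAddCommGroup Z] [NormedSpace ℂ Z] {f : Z → ℂ} {p : E → Z}

theorem PolyLike.thin (hf : PolyLike f) {z : Z} (hz : f z ≠ 0) {T : Set Z} (hT : IsOpen T) :
    ∀ y ∈ T, ∀ O ∈ 𝓝 y, ∃ O' ∈ 𝓝 y, O' ⊆ O ∧ (O' ∩ (T ∩ {z | f z ≠ 0})).Nonempty ∧
      IsPreconnected (O' ∩ (T ∩ {z | f z ≠ 0})) := by
  intro y hy O hO
  obtain ⟨r, hr, hrO⟩ := Metric.mem_nhds_iff.1 (Filter.inter_mem hO (hT.mem_nhds hy))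
  have heq : ball y r ∩ (T ∩ {z | f z ≠ 0}) = ball y r ∩ {z | f z ≠ 0} := by
    rw [← inter_assoc, inter_eq_left.2 (hrO.trans inter_subset_right)]
  refine ⟨ball y r, ball_mem_nhds y hr, hrO.trans inter_subset_left, ?_⟩
  rw [heq]
  have hconv : Convex ℝ (ball y r) := by
    let _ : NormedSpace ℝ Z := NormedSpace.restrictScalars ℝ ℂ Z
    exact convex_ball y r
  obtain ⟨x, hx, hx'⟩ := hf.exists_ne_zero isOpen_ball (mem_ball_self hr) hz
  exact ⟨⟨x, hx, hx'⟩, hf.isPreconnected_inter isOpen_ball hconv⟩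

/-- If through every point over a ball there is a section over the part of the ball lying
outside the zero set, then relatively clopen sets extend uniquely at the centre of the ball. -/
theorem CoveringOnto.goodAt_of_sections (hp : CoveringOnto p {z | f z ≠ 0}) (hfc : Continuous f)
    (hf : PolyLike f) {z₁ : Z} (hz₁ : f z₁ ≠ 0) {z : Z} {ρ : ℝ} (hρ : 0 < ρ)
    (hsec : ∀ e, p e ∈ ball z ρ → ∃ σ : Z → E, ContinuousOn σ (ball z ρ ∩ {z | f z ≠ 0}) ∧
      σ (p e) = e ∧ ∀ x ∈ ball z ρ ∩ {z | f z ≠ 0}, p (σ x) = x) : GoodAt p z := by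
  let _ : NormedSpace ℝ Z := NormedSpace.restrictScalars ℝ ℂ Z
  have hU : IsOpen {z | f z ≠ 0} := isOpen_ne_fun hfc continuous_const
  have hS : IsOpen (ball z ρ ∩ {z | f z ≠ 0}) := isOpen_ball.inter hU
  have hconn : ∀ W, IsOpen W → IsPreconnected W → IsPreconnected (W ∩ {z | f z ≠ 0}) :=
    fun W hW hWc => hWc.of_thin hW (hW.inter hU) inter_subset_left (hf.thin hz₁ hW)
  refine ⟨ρ, hρ, ?_, ?_⟩
  · intro W W' hW hWΩ hWc hW'W hW' ⟨w, hw⟩ A hA hAW'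
    rw [eq_empty_iff_forall_notMem]
    intro e he
    have heW : p e ∈ W := hA.subset he
    obtain ⟨σ, hσ, hσe, hpσ⟩ := hsec e (hWΩ heW)
    have hsub : W ∩ {z | f z ≠ 0} ⊆ ball z ρ ∩ {z | f z ≠ 0} := inter_subset_inter_left _ hWΩ
    have himg : σ '' (W ∩ {z | f z ≠ 0}) ⊆ A := by
      refine hA.subset_of_isPreconnected ((hconn W hW hWc).image σ (hσ.mono hsub)) ?_
        ⟨e, ⟨p e, ⟨heW, hp.mem e⟩, hσe⟩, he⟩
      rintro _ ⟨x, hx, rfl⟩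
      rw [mem_preimage, hpσ x (hsub hx)]
      exact hx.1
    obtain ⟨x, hx, hx'⟩ := hf.exists_ne_zero hW' hw hz₁
    have : σ x ∈ A ∩ p ⁻¹' W' := by
      refine ⟨himg ⟨x, ⟨hW'W hx, hx'⟩, rfl⟩, ?_⟩
      rw [mem_preimage, hpσ x (hsub ⟨hW'W hx, hx'⟩)]
      exact hx
    rw [hAW'] at this
    exact this
  · intro W' hW' hW'Ω ⟨w, hw⟩ L hL
    obtain ⟨w₁, hw₁, hfw₁⟩ := hf.exists_ne_zero hW' hw hz₁
    obtain ⟨r, hr, hrW⟩ := Metric.isOpen_iff.1 (hW'.inter hU) w₁ ⟨hw₁, hfw₁⟩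
    have hrS : ball w₁ r ⊆ ball z ρ ∩ {z | f z ≠ 0} :=
      hrW.trans (inter_subset_inter_left _ hW'Ω)
    have hw₁S := hrS (mem_ball_self hr)
    have hsec' : ∀ e, ∃ σ : Z → E, p e ∈ ball z ρ → ContinuousOn σ (ball z ρ ∩ {z | f z ≠ 0}) ∧
        σ (p e) = e ∧ ∀ x ∈ ball z ρ ∩ {z | f z ≠ 0}, p (σ x) = x := by
      intro e
      by_cases he : p e ∈ ball z ρ
      · exact (hsec e he).imp fun σ h _ => h
      · exact ⟨fun _ => e, fun h => absurd h he⟩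
    choose σ hσ' using hsec'
    have hσ := fun e he => (hσ' e he).1
    have hσe := fun e he => (hσ' e he).2.1
    have hpσ := fun e he => (hσ' e he).2.2
    have hloc : ∀ e, p e ∈ ball z ρ → ∀ᶠ e' in 𝓝 e, p e' ∈ ball z ρ ∧ σ e' w₁ = σ e w₁ := by
      intro e he
      have hT : IsOpen (p ⁻¹' ball z ρ) := isOpen_ball.preimage hp.continuous
      have hcl := hp.clopenIn_eqLocus hT (g₁ := fun e' => σ e (p e')) (g₂ := id)
        ((hσ e he).comp hp.continuous.continuousOn fun e' he' => ⟨he', hp.mem e'⟩)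
        continuousOn_id fun e' he' => hpσ e he _ ⟨he', hp.mem e'⟩
      filter_upwards [hcl.isOpen.mem_nhds ⟨he, hσe e he⟩] with e' he'
      refine ⟨he'.1, ?_⟩
      have hp' : p e' ∈ ball z ρ ∩ {z | f z ≠ 0} := ⟨he'.1, hp.mem e'⟩
      exact hp.eqOn_of_comp_eqOn (hconn _ isOpen_ball (convex_ball z ρ).isPreconnected)
        (hσ e' he'.1) (hσ e he) (fun a ha => (hpσ e' he'.1 a ha).trans (hpσ e he a ha).symm)
        hp' ((hσe e' he'.1).trans (show σ e (p e') = e' from he'.2).symm) hw₁S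
    refine ⟨ball w₁ r, hrW.trans inter_subset_left, isOpen_ball, ⟨w₁, mem_ball_self hr⟩,
      {e | p e ∈ ball z ρ ∧ σ e w₁ ∈ L}, ⟨fun e he => he.1, ?_, ?_⟩, ?_⟩
    · rw [isOpen_iff_mem_nhds]
      rintro e ⟨he, heL⟩
      filter_upwards [hloc e he] with e' he'
      exact ⟨he'.1, he'.2 ▸ heL⟩
    · rw [isOpen_iff_mem_nhds]
      rintro e ⟨he, heL⟩
      filter_upwards [hloc e he] with e' he'
      exact ⟨he'.1, fun h => heL ⟨he, he'.2 ▸ h.2⟩⟩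
    · have key : ∀ e, p e ∈ ball w₁ r → ∀ M, ClopenIn M (p ⁻¹' W') → ∀ x ∈ ball w₁ r,
          σ e x ∈ M → ∀ y ∈ ball w₁ r, σ e y ∈ M := by
        intro e he M hM x hx hxM y hy
        have he' := (hrS he).1
        refine hM.subset_of_isPreconnected ((convex_ball w₁ r).isPreconnected.image (σ e)
          ((hσ e he').mono hrS)) ?_ ⟨σ e x, ⟨x, hx, rfl⟩, hxM⟩ ⟨y, hy, rfl⟩
        rintro _ ⟨x, hx, rfl⟩
        rw [mem_preimage, hpσ e he' x (hrS hx)]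
        exact (hrW hx).1
      ext e; constructor
      · rintro ⟨⟨he, heL⟩, heW⟩
        refine ⟨?_, heW⟩
        rw [← hσe e he]
        exact key e heW L hL w₁ (mem_ball_self hr) heL _ heW
      · rintro ⟨heL, heW⟩
        have he := (hrS heW).1
        refine ⟨⟨he, ?_⟩, heW⟩
        exact key e heW L hL (p e) heW ((hσe e he).symm ▸ heL) w₁ (mem_ball_self hr)

end Sections

/-- `f` is a product over the ball of radius `ε` about `0`: `r` projects the preimage of the ball
to the zero fibre, and `a` is the inverse of the trivialisation `z ↦ (f z, r z)`. -/
structure ProductNear {Z : Type*} [TopologicalSpace Z] (f : Z → ℂ) (ε : ℝ) (r : Z → Z)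
    (a : ℂ × Z → Z) : Prop where
  pos : 0 < ε
  continuousOn_proj : ContinuousOn r (f ⁻¹' ball 0 ε)
  map_proj : ∀ z, f z ∈ ball 0 ε → f (r z) = 0
  continuousOn_inv : ContinuousOn a (ball 0 ε ×ˢ {z | f z = 0})
  map_inv : ∀ w ∈ ball 0 ε, ∀ y, f y = 0 → f (a (w, y)) = w
  proj_inv : ∀ w ∈ ball 0 ε, ∀ y, f y = 0 → r (a (w, y)) = y
  inv_proj : ∀ z, f z ∈ ball 0 ε → a (f z, r z) = z

namespace ProductNear

section Topological

variable {E Z : Type*} [TopologicalSpace E] [TopologicalSpace Z] {f : Z → ℂ} {ε : ℝ} {r : Z → Z}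
  {a : ℂ × Z → Z} {p : E → Z}

theorem continuous_inv (h : ProductNear f ε r a) {A : Type*} [TopologicalSpace A] {φ : A → ℂ}
    {ψ : A → Z} (hφ : Continuous φ) (hψ : Continuous ψ) (hφ' : ∀ x, φ x ∈ ball 0 ε)
    (hψ' : ∀ x, f (ψ x) = 0) : Continuous fun x => a (φ x, ψ x) :=
  h.continuousOn_inv.comp_continuous (hφ.prodMk hψ) fun x => ⟨hφ' x, hψ' x⟩

theorem continuous_proj (h : ProductNear f ε r a) {A : Type*} [TopologicalSpace A]
    {ψ : A → Z} (hψ : Continuous ψ) (hψ' : ∀ x, f (ψ x) ∈ ball 0 ε) :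
    Continuous fun x => r (ψ x) :=
  h.continuousOn_proj.comp_continuous hψ hψ'

theorem isPreconnected_preimage (h : ProductNear f ε r a) (hD : IsPreconnected {z | f z = 0})
    {S : Set ℂ} (hS : IsPreconnected S) (hSε : S ⊆ ball 0 ε) : IsPreconnected (f ⁻¹' S) := by
  have : f ⁻¹' S = a '' (S ×ˢ {z | f z = 0}) := by
    ext z; constructor
    · intro hz
      exact ⟨(f z, r z), ⟨hz, h.map_proj z (hSε hz)⟩, h.inv_proj z (hSε hz)⟩
    · rintro ⟨⟨w, y⟩, ⟨hw, hy⟩, rfl⟩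
      rw [mem_preimage, h.map_inv w (hSε hw) y hy]
      exact hw
  rw [this]
  exact (hS.prod hD).image a (h.continuousOn_inv.mono (prod_mono_left hSε))

theorem exp_mul_mem_ball {w : ℂ} (hw : w ∈ ball (0 : ℂ) ε) (s : ℝ) :
    Complex.exp (s * (2 * Real.pi * Complex.I)) * w ∈ ball (0 : ℂ) ε := by
  have : (s : ℂ) * (2 * Real.pi * Complex.I) = ((s * (2 * Real.pi) : ℝ) : ℂ) * Complex.I := by
    push_cast; ring
  rw [mem_ball_zero_iff] at hw ⊢
  rwa [norm_mul, this, Complex.norm_exp_ofReal_mul_I, one_mul]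

/-- The monodromy of a covering of the complement of the zero fibre, near the zero fibre. -/
theorem exists_monodromy (h : ProductNear f ε r a) (hp : CoveringOnto p {z | f z ≠ 0})
    (hf : Continuous f) : ∃ c : E → E, ContinuousOn c {e | f (p e) ∈ ball 0 ε} ∧
      ∀ e, f (p e) ∈ ball 0 ε → p (c e) = p e ∧ ∃ γ : unitInterval → E, Continuous γ ∧ γ 0 = e ∧
        γ 1 = c e ∧ ∀ s : unitInterval, p (γ s) =
          a (Complex.exp ((s : ℝ) * (2 * Real.pi * Complex.I)) * f (p e), r (p e)) := by
  have hpc := hp.continuous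
  let H : unitInterval × {e | f (p e) ∈ ball 0 ε} → Z := fun x =>
    a (Complex.exp ((x.1 : ℝ) * (2 * Real.pi * Complex.I)) * f (p x.2), r (p x.2))
  have hH : Continuous H := by
    refine h.continuous_inv (by fun_prop) (h.continuous_proj (by fun_prop) fun x => x.2.2)
      (fun x => exp_mul_mem_ball x.2.2 _) fun x => h.map_proj _ x.2.2
  obtain ⟨K, hK, hpK, hK0, -⟩ := hp.exists_lift H hH (fun x => by
      change f (a _) ≠ 0
      rw [h.map_inv _ (exp_mul_mem_ball x.2.2 _) _ (h.map_proj _ x.2.2)]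
      exact mul_ne_zero (Complex.exp_ne_zero _) (hp.mem _)) Subtype.val continuous_subtype_val
    (fun e => by simp [H, h.inv_proj _ e.2])
  classical
  refine ⟨fun e => if he : f (p e) ∈ ball 0 ε then K (1, ⟨e, he⟩) else e, ?_, ?_⟩
  · rw [continuousOn_iff_continuous_domRestrict]
    have : ({e | f (p e) ∈ ball 0 ε} : Set E).domRestrict
        (fun e => if he : f (p e) ∈ ball 0 ε then K (1, ⟨e, he⟩) else e) = fun e => K (1, e) := by
      funext e; exact dif_pos e.2
    rw [this]; fun_prop
  · intro e he
    simp only [dif_pos he]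
    refine ⟨?_, fun s => K (s, ⟨e, he⟩), by fun_prop, hK0 _, rfl, fun s => hpK _⟩
    rw [hpK]
    simp [H, h.inv_proj _ he]

/-- A function with trivial monodromy descends to the punctured disc. -/
theorem exists_punctured_section (h : ProductNear f ε r a) (hp : CoveringOnto p {z | f z ≠ 0})
    (hmono : ∀ e, f (p e) ∈ ball 0 ε → ∀ γ : unitInterval → E, Continuous γ → γ 0 = e →
      (∀ s : unitInterval, p (γ s) =
        a (Complex.exp ((s : ℝ) * (2 * Real.pi * Complex.I)) * f (p e), r (p e))) → γ 1 = e)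
    {e : E} (he : f (p e) ∈ ball 0 ε) :
    ∃ σ : ℂ → E, ContinuousOn σ (ball 0 ε \ {0}) ∧
      (∀ w ∈ ball (0 : ℂ) ε \ {0}, p (σ w) = a (w, r (p e))) ∧ σ (f (p e)) = e := by
  have hy : f (r (p e)) = 0 := h.map_proj _ he
  set y := r (p e) with hydef
  have hfe : f (p e) ≠ 0 := hp.mem e
  have hball : ∀ ζ ∈ leftHalfPlane (Real.log ε), Complex.exp ζ ∈ ball (0 : ℂ) ε := by
    intro ζ hζ
    rw [mem_ball_zero_iff, Complex.norm_exp, ← Real.exp_log h.pos]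
    exact Real.exp_lt_exp.2 hζ
  have hlog : ∀ w ∈ ball (0 : ℂ) ε \ {0}, Complex.log w ∈ leftHalfPlane (Real.log ε) := by
    intro w hw
    change (Complex.log w).re < _
    rw [Complex.log_re]
    exact Real.log_lt_log (norm_pos_iff.2 hw.2) (mem_ball_zero_iff.1 hw.1)
  set ζ₀ := Complex.log (f (p e)) with hζ₀
  have hζ₀mem : ζ₀ ∈ leftHalfPlane (Real.log ε) := hlog _ ⟨he, hfe⟩
  have hexp₀ : Complex.exp ζ₀ = f (p e) := Complex.exp_log hfe
  let H : unitInterval × leftHalfPlane (Real.log ε) → Z := fun x =>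
    a (Complex.exp (ζ₀ + (x.1 : ℝ) • ((x.2 : ℂ) - ζ₀)), y)
  have hmem : ∀ x : unitInterval × leftHalfPlane (Real.log ε),
      ζ₀ + (x.1 : ℝ) • ((x.2 : ℂ) - ζ₀) ∈ leftHalfPlane (Real.log ε) := fun x =>
    (convex_leftHalfPlane _).add_smul_sub_mem hζ₀mem x.2.2 x.1.2
  have hH : Continuous H := h.continuous_inv (by fun_prop) continuous_const
    (fun x => hball _ (hmem x)) fun _ => hy
  obtain ⟨K, hK, hpK, -, hKst⟩ := hp.exists_lift H hH (fun x => by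
      change f (a _) ≠ 0
      rw [h.map_inv _ (hball _ (hmem x)) _ hy]
      exact Complex.exp_ne_zero _) (fun _ => e) continuous_const (fun ζ => by
      simp [H, hexp₀, hydef, h.inv_proj _ he])
  let g : leftHalfPlane (Real.log ε) → E := fun ζ => K (1, ζ)
  have hg : Continuous g := by fun_prop
  have hpg : ∀ ζ, p (g ζ) = a (Complex.exp ζ, y) := fun ζ => by
    rw [hpK]; simp [H]
  have hg₀ : g ⟨ζ₀, hζ₀mem⟩ = e := hKst _ (fun s => by simp [H]) 1
  have hper : ∀ ζ (hζ : ζ ∈ leftHalfPlane (Real.log ε))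
      (hζ' : ζ + 2 * Real.pi * Complex.I ∈ leftHalfPlane (Real.log ε)),
      g ⟨ζ + 2 * Real.pi * Complex.I, hζ'⟩ = g ⟨ζ, hζ⟩ := by
    intro ζ hζ hζ'
    have hmem' : ∀ s : unitInterval,
        ζ + (s : ℝ) * (2 * Real.pi * Complex.I) ∈ leftHalfPlane (Real.log ε) := by
      intro s
      change (ζ + (s : ℝ) * (2 * Real.pi * Complex.I)).re < _
      simpa [leftHalfPlane] using hζ
    have hfg : f (p (g ⟨ζ, hζ⟩)) = Complex.exp ζ := by
      rw [hpg]; exact h.map_inv _ (hball _ hζ) _ hy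
    have := hmono (g ⟨ζ, hζ⟩) (by rw [hfg]; exact hball _ hζ)
      (fun s => g ⟨ζ + (s : ℝ) * (2 * Real.pi * Complex.I), hmem' s⟩) (by fun_prop)
      (by simp) (fun s => by
        rw [hpg, hfg, hpg, h.proj_inv _ (hball _ hζ) _ hy, ← Complex.exp_add,
          add_comm ((s : ℝ) * (2 * Real.pi * Complex.I) : ℂ)])
    simpa using this
  have hperZ : ∀ (m : ℤ) ζ (hζ : ζ ∈ leftHalfPlane (Real.log ε))
      (hζ' : ζ + m * (2 * Real.pi * Complex.I) ∈ leftHalfPlane (Real.log ε)),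
      g ⟨ζ + m * (2 * Real.pi * Complex.I), hζ'⟩ = g ⟨ζ, hζ⟩ := by
    intro m
    induction m with
    | zero => intro ζ hζ hζ'; simp
    | succ m ih =>
      intro ζ hζ hζ'
      have h1 := (add_mem_leftHalfPlane (m : ℤ)).2 hζ
      rw [← ih ζ hζ h1]
      refine Eq.trans ?_ (hper _ h1 (by simpa [leftHalfPlane] using hζ))
      congr 2; push_cast; ring
    | pred m ih =>
      intro ζ hζ hζ'
      have h1 := (add_mem_leftHalfPlane (-(m : ℤ))).2 hζ
      rw [← ih ζ hζ h1]
      refine (hper _ hζ' (by simpa [leftHalfPlane] using hζ)).symm.trans ?_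
      congr 2; push_cast; ring
  classical
  let σ : ℂ → E := fun w => if hw : Complex.log w ∈ leftHalfPlane (Real.log ε) then
    g ⟨Complex.log w, hw⟩ else e
  have hσ : ∀ ζ (hζ : ζ ∈ leftHalfPlane (Real.log ε)), σ (Complex.exp ζ) = g ⟨ζ, hζ⟩ := by
    intro ζ hζ
    have hl := hlog _ ⟨hball ζ hζ, Complex.exp_ne_zero ζ⟩
    change (if hw : _ then _ else _) = _
    rw [dif_pos hl]
    obtain ⟨m, hm⟩ := Complex.exp_eq_exp_iff_exists_int.1
      (Complex.exp_log (Complex.exp_ne_zero ζ))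
    rw [← hperZ m ζ hζ (hm ▸ hl)]
    congr 2
  have hcov : ∀ w ∈ ball (0 : ℂ) ε \ {0}, ∃ ζ ∈ leftHalfPlane (Real.log ε), Complex.exp ζ = w :=
    fun w hw => ⟨Complex.log w, hlog w hw, Complex.exp_log hw.2⟩
  refine ⟨σ, ?_, ?_, ?_⟩
  · intro w hw
    obtain ⟨ζ, hζ, rfl⟩ := hcov w hw
    refine ContinuousAt.continuousWithinAt ?_
    have hcomp : ContinuousAt (σ ∘ Complex.exp) ζ := by
      have : ContinuousOn (σ ∘ Complex.exp) (leftHalfPlane (Real.log ε)) := by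
        rw [continuousOn_iff_continuous_domRestrict]
        convert hg using 1
        funext x; exact hσ x x.2
      exact this.continuousAt ((isOpen_leftHalfPlane _).mem_nhds hζ)
    have h2 : Filter.Tendsto σ (Filter.map Complex.exp (𝓝 ζ)) (𝓝 (σ (Complex.exp ζ))) :=
      Filter.tendsto_map'_iff.2 hcomp
    exact h2.mono_left (Complex.isOpenMap_exp.nhds_le ζ)
  · intro w hw
    obtain ⟨ζ, hζ, rfl⟩ := hcov w hw
    rw [hσ ζ hζ, hpg]
  · rw [← hexp₀, hσ ζ₀ hζ₀mem, hg₀]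

/-- If `f ∘ p` has a logarithm then the covering `p` has infinitely many sheets. -/
theorem infinite_preimage (h : ProductNear f ε r a) (hf : Continuous f)
    (hp : CoveringOnto p {z | f z ≠ 0}) {l : E → ℂ} (hl : Continuous l)
    (hexp : ∀ e, Complex.exp (l e) = f (p e)) {e : E} (he : f (p e) ∈ ball 0 ε) :
    (p ⁻¹' {p e}).Infinite := by
  obtain ⟨c, -, hmono⟩ := h.exists_monodromy hp hf
  have hstep : ∀ e, f (p e) ∈ ball 0 ε → l (c e) = l e + 2 * Real.pi * Complex.I := by
    intro e he
    obtain ⟨-, γ, hγ, hγ0, hγ1, hpγ⟩ := hmono e he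
    have hcov := ExpCover.coveringOnto_exp
    have := hcov.eqOn_of_comp_eqOn (s := univ) isPreconnected_univ
      (g₁ := fun s : unitInterval => l (γ s))
      (g₂ := fun s : unitInterval => l e + (s : ℝ) * (2 * Real.pi * Complex.I))
      (by fun_prop) (by fun_prop) (fun s _ => by
        rw [hexp, hpγ, h.map_inv _ (exp_mul_mem_ball he _) _ (h.map_proj _ he), Complex.exp_add,
          hexp, mul_comm]) (mem_univ 0) (by simp [hγ0]) (mem_univ 1)
    simpa [hγ1] using this
  have hiter : ∀ m : ℕ, p (c^[m] e) = p e ∧ l (c^[m] e) = l e + m * (2 * Real.pi * Complex.I) := by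
    intro m
    induction m with
    | zero => simp
    | succ m ih =>
      have hm : f (p (c^[m] e)) ∈ ball 0 ε := by rw [ih.1]; exact he
      rw [Function.iterate_succ_apply']
      refine ⟨(hmono _ hm).1.trans ih.1, ?_⟩
      rw [hstep _ hm, ih.2]; push_cast; ring
  refine infinite_of_injective_forall_mem (f := fun m : ℕ => c^[m] e) ?_ fun m => (hiter m).1
  intro m m' hmm
  have h1 : l (c^[m] e) = l (c^[m'] e) := congrArg l hmm
  rw [(hiter m).2, (hiter m').2, add_right_inj,
    mul_left_inj' Complex.two_pi_I_ne_zero] at h1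
  exact_mod_cast h1

end Topological

end ProductNear

namespace ProductNear

variable {E Z : Type*} [TopologicalSpace E] [NormedAddCommGroup Z] [NormedSpace ℂ Z]
  {f : Z → ℂ} {ε : ℝ} {r : Z → Z} {a : ℂ × Z → Z} {p : E → Z}

/-- If the monodromy is trivial, there are sections over the complement of the zero fibre in a
neighbourhood of every point of the zero fibre. -/
theorem exists_sections (h : ProductNear f ε r a) (hp : CoveringOnto p {z | f z ≠ 0})
    (hf : Continuous f)
    (hmono : ∀ e, f (p e) ∈ ball 0 ε → ∀ γ : unitInterval → E, Continuous γ → γ 0 = e →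
      (∀ s : unitInterval, p (γ s) =
        a (Complex.exp ((s : ℝ) * (2 * Real.pi * Complex.I)) * f (p e), r (p e))) → γ 1 = e)
    {z₀ : Z} (hz₀ : f z₀ = 0) :
    ∃ ρ > 0, ∀ e, p e ∈ ball z₀ ρ → ∃ σ : Z → E, ContinuousOn σ (ball z₀ ρ ∩ {z | f z ≠ 0}) ∧
      σ (p e) = e ∧ ∀ x ∈ ball z₀ ρ ∩ {z | f z ≠ 0}, p (σ x) = x := by
  obtain ⟨ρ, hρ, hρε⟩ := Metric.isOpen_iff.1 ((isOpen_ball (x := (0 : ℂ)) (ε := ε)).preimage hf) z₀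
    (show f z₀ ∈ ball 0 ε by rw [hz₀]; exact mem_ball_self h.pos)
  refine ⟨ρ, hρ, fun e he => ?_⟩
  have hmem : ∀ (s : unitInterval), ∀ z ∈ ball z₀ ρ,
      f (z₀ + ((s : ℝ) : ℂ) • (z - z₀)) ∈ ball 0 ε := by
    intro s z hz
    refine hρε ?_
    rw [mem_ball_iff_norm, add_sub_cancel_left, norm_smul, Complex.norm_real,
      Real.norm_of_nonneg s.2.1]
    exact (mul_le_of_le_one_left (norm_nonneg _) s.2.2).trans_lt (mem_ball_iff_norm.1 hz)
  have hconv : ∀ (s : unitInterval), ∀ z ∈ ball z₀ ρ, f z ≠ 0 →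
      f (a (f z, r (z₀ + ((s : ℝ) : ℂ) • (z - z₀)))) ≠ 0 := by
    intro s z hz hfz
    rwa [h.map_inv _ (hρε hz) _ (h.map_proj _ (hmem s z hz))]
  let H : unitInterval × ↥(ball z₀ ρ ∩ {z | f z ≠ 0}) → Z := fun x =>
    a (f x.2, r (z₀ + ((x.1 : ℝ) : ℂ) • ((x.2 : Z) - z₀)))
  have hH : Continuous H := h.continuous_inv (by fun_prop)
    (h.continuous_proj (by fun_prop) fun x => hmem x.1 _ x.2.2.1) (fun x => hρε x.2.2.1)
    fun x => h.map_proj _ (hmem x.1 _ x.2.2.1)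
  have heS : p e ∈ ball z₀ ρ ∩ {z | f z ≠ 0} := ⟨he, hp.mem e⟩
  obtain ⟨G, hG, hpG, hG0, -⟩ := hp.exists_lift (A := Unit)
    (fun x => H (unitInterval.symm x.1, ⟨p e, heS⟩)) (by fun_prop)
    (fun x => hconv _ _ he (hp.mem e)) (fun _ => e) continuous_const (fun _ => by
      simp [H, h.inv_proj _ (hρε he)])
  have hfz₀ : f z₀ ∈ ball 0 ε := by rw [hz₀]; exact mem_ball_self h.pos
  have hry : f (r z₀) = 0 := h.map_proj _ hfz₀
  have hpG1 : p (G (1, ())) = a (f (p e), r z₀) := by rw [hpG]; simp [H]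
  have hfG1 : f (p (G (1, ()))) = f (p e) := by rw [hpG1, h.map_inv _ (hρε he) _ hry]
  have hrG1 : r (p (G (1, ()))) = r z₀ := by rw [hpG1, h.proj_inv _ (hρε he) _ hry]
  obtain ⟨σ₀, hσ₀, hpσ₀, hσ₀e⟩ := h.exists_punctured_section hp hmono (e := G (1, ()))
    (by rw [hfG1]; exact hρε he)
  rw [hfG1] at hσ₀e
  rw [hrG1] at hpσ₀
  obtain ⟨K, hK, hpK, hK0, -⟩ := hp.exists_lift H hH (fun x => hconv _ _ x.2.2.1 x.2.2.2)
    (fun x => σ₀ (f x)) (hσ₀.comp_continuous (by fun_prop) fun x => ⟨hρε x.2.1, x.2.2⟩)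
    (fun x => by rw [hpσ₀ _ ⟨hρε x.2.1, x.2.2⟩]; simp [H])
  have hend : K (1, ⟨p e, heS⟩) = e := by
    have := hp.eqOn_of_comp_eqOn (s := univ) isPreconnected_univ
      (g₁ := fun s : unitInterval => K (s, ⟨p e, heS⟩))
      (g₂ := fun s => G (unitInterval.symm s, ())) (by fun_prop) (by fun_prop)
      (fun s _ => by rw [hpK, hpG]; simp) (mem_univ 0) (by simp [hK0, hσ₀e])
    simpa [hG0] using this (mem_univ 1)
  classical
  refine ⟨fun x => if hx : x ∈ ball z₀ ρ ∩ {z | f z ≠ 0} then K (1, ⟨x, hx⟩) else e, ?_, ?_, ?_⟩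
  · rw [continuousOn_iff_continuous_domRestrict]
    have : (ball z₀ ρ ∩ {z | f z ≠ 0}).domRestrict (fun x =>
        if hx : x ∈ ball z₀ ρ ∩ {z | f z ≠ 0} then K (1, ⟨x, hx⟩) else e) = fun x => K (1, x) := by
      funext x; exact dif_pos x.2
    rw [this]; fun_prop
  · simp only [dif_pos heS, hend]
  · intro x hx
    simp only [dif_pos hx]
    rw [hpK]
    simp [H, h.inv_proj _ (hρε hx.1)]

variable {v : Z} {N : ℕ} {k : ℂ}

/-- If the total space is connected and there is one section near a point of the zero fibre,
then the monodromy is trivial. -/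
theorem monodromy_trivial (h : ProductNear f ε r a) (hf : Pencil f v N k)
    (hp : CoveringOnto p {z | f z ≠ 0}) (hD : IsPreconnected {z | f z = 0}) [PreconnectedSpace E]
    {z₀ : Z} (hz₀ : f z₀ = 0) {M : Set Z} (hM : M ∈ 𝓝 z₀) {σ : Z → E}
    (hσ : ContinuousOn σ (M ∩ {z | f z ≠ 0})) (hpσ : ∀ x ∈ M ∩ {z | f z ≠ 0}, p (σ x) = x)
    {e : E} (he : f (p e) ∈ ball 0 ε) {γ : unitInterval → E} (hγ : Continuous γ) (hγ0 : γ 0 = e)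
    (hpγ : ∀ s : unitInterval, p (γ s) =
      a (Complex.exp ((s : ℝ) * (2 * Real.pi * Complex.I)) * f (p e), r (p e))) : γ 1 = e := by
  have hfc := hf.continuous
  obtain ⟨c, hc, hmono⟩ := h.exists_monodromy hp hfc
  have hT : {e | f (p e) ∈ ball 0 ε} = (fun e => f (p e)) ⁻¹' (ball 0 ε \ {0}) := by
    ext e; exact ⟨fun he => ⟨he, hp.mem e⟩, fun he => he.1⟩
  have hTo : IsOpen {e | f (p e) ∈ ball 0 ε} := isOpen_ball.preimage (hfc.comp hp.continuous)
  have hL := hp.clopenIn_eqLocus hTo hc continuousOn_id fun e he => (hmono e he).1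
  set L := {e | e ∈ {e | f (p e) ∈ ball 0 ε} ∧ c e = id e} with hLdef
  have huniq : ∀ e, f (p e) ∈ ball 0 ε → ∀ γ : unitInterval → E, Continuous γ → γ 0 = e →
      (∀ s : unitInterval, p (γ s) =
        a (Complex.exp ((s : ℝ) * (2 * Real.pi * Complex.I)) * f (p e), r (p e))) →
      γ 1 = c e := by
    intro e he γ hγ hγ0 hpγ
    obtain ⟨-, γ', hγ', hγ'0, hγ'1, hpγ'⟩ := hmono e he
    rw [← hγ'1]
    exact hp.eqOn_of_comp_eqOn isPreconnected_univ hγ.continuousOn hγ'.continuousOn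
      (fun s _ => (hpγ s).trans (hpγ' s).symm) (mem_univ 0) (hγ0.trans hγ'0.symm) (mem_univ 1)
  have hne : L.Nonempty := by
    have hfz₀ : f z₀ ∈ ball 0 ε := by rw [hz₀]; exact mem_ball_self h.pos
    have hry : f (r z₀) = 0 := h.map_proj _ hfz₀
    have ha0 : a (0, r z₀) = z₀ := by
      have := h.inv_proj _ hfz₀; rwa [hz₀] at this
    have hcont : ContinuousOn (fun w => a (w, r z₀)) (ball 0 ε) :=
      h.continuousOn_inv.comp (by fun_prop) fun w hw => ⟨hw, hry⟩
    have hca : ContinuousAt (fun w => a (w, r z₀)) 0 :=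
      hcont.continuousAt (ball_mem_nhds 0 h.pos)
    obtain ⟨δ, hδ, hδM⟩ := Metric.mem_nhds_iff.1 (Filter.inter_mem
      (hca.preimage_mem_nhds (by rw [ha0]; exact hM)) (ball_mem_nhds 0 h.pos))
    obtain ⟨w, hw, hw0⟩ : ∃ w ∈ ball (0 : ℂ) δ, w ≠ 0 := by
      refine ⟨((δ / 2 : ℝ) : ℂ), ?_, by simp [hδ.ne']⟩
      rw [mem_ball_zero_iff, Complex.norm_real, Real.norm_of_nonneg (by positivity)]
      linarith
    have hS : ∀ w ∈ ball (0 : ℂ) δ, w ≠ 0 → a (w, r z₀) ∈ M ∩ {z | f z ≠ 0} := by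
      intro w hw hw0
      refine ⟨(hδM hw).1, ?_⟩
      change f _ ≠ 0
      rwa [h.map_inv _ (hδM hw).2 _ hry]
    have hpe := hpσ _ (hS w hw hw0)
    have hfe : f (p (σ (a (w, r z₀)))) = w := by rw [hpe, h.map_inv _ (hδM hw).2 _ hry]
    have hre : r (p (σ (a (w, r z₀)))) = r z₀ := by rw [hpe, h.proj_inv _ (hδM hw).2 _ hry]
    have hexp : ∀ s : ℝ, a (Complex.exp (s * (2 * Real.pi * Complex.I)) * w, r z₀) ∈
        M ∩ {z | f z ≠ 0} := fun s =>
      hS _ (exp_mul_mem_ball hw s) (mul_ne_zero (Complex.exp_ne_zero _) hw0)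
    refine ⟨σ (a (w, r z₀)), by rw [mem_ofPred_eq, hfe]; exact (hδM hw).2, ?_⟩
    have := huniq _ (by rw [hfe]; exact (hδM hw).2)
      (fun s => σ (a (Complex.exp ((s : ℝ) * (2 * Real.pi * Complex.I)) * w, r z₀)))
      (hσ.comp_continuous (h.continuous_inv (by fun_prop) continuous_const
        (fun s => (hδM (exp_mul_mem_ball hw _)).2) fun _ => hry) fun s => hexp _)
      (by simp) (fun s => by rw [hfe, hre, hpσ _ (hexp _)])
    simpa using this.symm
  have hgood : ∀ w ≠ 0, GoodAt (fun e => f (p e)) w := fun w hw =>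
    hf.goodAt_of_ne_zero hp h.pos (fun w r hr _ =>
      h.isPreconnected_preimage hD (convex_ball w r).isPreconnected hr) hw
  rw [hT] at hL
  obtain ⟨L', hL', hLL'⟩ := hf.exists_extend_univ hp hgood h.pos hL
  have hL'u : L' = univ := hL'.eq_univ (by
    obtain ⟨x, hx⟩ := hne
    rw [← hLL'] at hx
    exact ⟨x, hx.1⟩)
  rw [huniq e he γ hγ hγ0 hpγ]
  have : e ∈ L := by
    rw [← hLL', hL'u]; exact ⟨mem_univ _, he, hp.mem e⟩
  exact this.2

/-- A connected covering of the complement of the zero fibre which has a section near some point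
of the zero fibre has one sheet. -/
theorem exists_preimage_eq_singleton (h : ProductNear f ε r a) (hf : Pencil f v N k)
    (hp : CoveringOnto p {z | f z ≠ 0}) (hD : IsPreconnected {z | f z = 0}) [ConnectedSpace E]
    {z₀ : Z} (hz₀ : f z₀ = 0) {M : Set Z} (hM : M ∈ 𝓝 z₀) {σ : Z → E}
    (hσ : ContinuousOn σ (M ∩ {z | f z ≠ 0})) (hpσ : ∀ x ∈ M ∩ {z | f z ≠ 0}, p (σ x) = x) :
    ∃ z e, f z ≠ 0 ∧ p ⁻¹' {z} = {e} := by
  let _ : NormedSpace ℝ Z := NormedSpace.restrictScalars ℝ ℂ Z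
  have hfc := hf.continuous
  have hU := hf.isOpen_ne_zero
  obtain ⟨e₀⟩ := (inferInstance : Nonempty E)
  have hgood : ∀ z ∈ (univ : Set Z), GoodAt p z := by
    intro z _
    by_cases hz : f z = 0
    · obtain ⟨ρ, hρ, hsec⟩ := h.exists_sections hp hfc (fun e he γ hγ hγ0 hpγ =>
        h.monodromy_trivial hf hp hD hz₀ hM hσ hpσ he hγ hγ0 hpγ) hz
      exact hp.goodAt_of_sections hfc hf.polyLike (hp.mem e₀) hρ hsec
    · obtain ⟨N', hN', hzN', hN'U, hsec⟩ := hp.exists_sections hU hz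
      obtain ⟨ρ, hρ, hρN⟩ := Metric.isOpen_iff.1 hN' z hzN'
      refine hp.goodAt_of_sections hfc hf.polyLike (hp.mem e₀) hρ fun e he => ?_
      obtain ⟨τ, hτ, hτe, hpτ, -⟩ := hsec e (hρN he)
      exact ⟨τ, hτ.mono (inter_subset_left.trans hρN), hτe, fun x hx => hpτ x (hρN hx.1)⟩
  obtain ⟨N', hN', hzN', hN'U, hsec⟩ := hp.exists_sections hU (hp.mem e₀)
  obtain ⟨τ, hτ, hτe, hpτ, -⟩ := hsec e₀ hzN'
  have hL := hp.clopenIn_eqLocus (hN'.preimage hp.continuous) (g₁ := fun e => τ (p e)) (g₂ := id)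
    (hτ.comp hp.continuous.continuousOn fun e he => he) continuousOn_id fun e he => hpτ _ he
  obtain ⟨W, hWN', hW, ⟨w, hw⟩, L', hL', hLL'⟩ := existsExt_of_goodAt hp.continuous isOpen_univ
    convex_univ hgood N' hN' (subset_univ _) ⟨_, hzN'⟩ _ hL
  have hpw : p (τ w) = w := hpτ w (hWN' hw)
  have hL'u : L' = univ := by
    refine IsClopen.eq_univ ⟨isOpen_compl_iff.1 (by
      rw [compl_eq_univ_sdiff]; exact hL'.isOpen_diff), hL'.isOpen⟩ ⟨τ w, ?_⟩
    have : τ w ∈ L' ∩ p ⁻¹' W := by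
      rw [hLL']
      refine ⟨⟨?_, ?_⟩, ?_⟩
      · rw [mem_preimage, hpw]; exact hWN' hw
      · simp only [hpw, id]
      · rw [mem_preimage, hpw]; exact hw
    exact this.1
  refine ⟨w, τ w, hN'U (hWN' hw), ?_⟩
  ext e; constructor
  · intro he
    rw [mem_preimage, mem_singleton_iff] at he
    have : e ∈ L' ∩ p ⁻¹' W := ⟨hL'u ▸ mem_univ e, by rw [mem_preimage, he]; exact hw⟩
    rw [hLL'] at this
    have h2 : τ (p e) = e := this.1.2
    rw [mem_singleton_iff, ← h2, he]
  · rintro rfl; exact hpw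

end ProductNear

section PolynomialPencil

/-- Restriction of a monomial to an affine family of lines: degree and top coefficient. -/
theorem natDegree_prod_line_le {R ι : Type*} [CommRing R] (A B : ι → R) (d : ι → ℕ)
    (T : Finset ι) :
    (∏ i ∈ T, (C (A i) + X * C (B i)) ^ d i : R[X]).natDegree ≤ ∑ i ∈ T, d i ∧
    (∏ i ∈ T, (C (A i) + X * C (B i)) ^ d i : R[X]).coeff (∑ i ∈ T, d i) =
      ∏ i ∈ T, B i ^ d i := by
  classical
  have hlin : ∀ i, (C (A i) + X * C (B i) : R[X]).natDegree ≤ 1 := by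
    intro i
    compute_degree
  induction T using Finset.induction_on with
  | empty => simp
  | insert i T hi ih =>
    have hpow : ((C (A i) + X * C (B i)) ^ d i : R[X]).natDegree ≤ d i := by
      simpa using natDegree_pow_le_of_le (d i) (hlin i)
    have hcoeff : ((C (A i) + X * C (B i)) ^ d i : R[X]).coeff (d i) = B i ^ d i := by
      have := coeff_pow_of_natDegree_le (m := d i) (hlin i)
      simpa using this
    rw [Finset.prod_insert hi, Finset.sum_insert hi, Finset.prod_insert hi]
    exact ⟨natDegree_mul_le_of_le hpow ih.1, by
      rw [coeff_mul_add_eq_of_natDegree_le hpow ih.1, hcoeff, ih.2]⟩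

variable {n : ℕ} (f : MvPolynomial (Fin n) ℂ)

theorem mvPolynomial_coeff_aeval_line (A : Fin n → ℂ[X]) (v : Fin n → ℂ) :
    (MvPolynomial.aeval (fun i => (C (A i) + X * C (C (v i)) : ℂ[X][X])) f).natDegree ≤
      f.totalDegree ∧
    (MvPolynomial.aeval (fun i => (C (A i) + X * C (C (v i)) : ℂ[X][X])) f).coeff f.totalDegree =
      C (MvPolynomial.eval v (MvPolynomial.homogeneousComponent f.totalDegree f)) := by
  set N := f.totalDegree with hN
  have hle : ∀ d ∈ f.support, ∑ i ∈ d.support, d i ≤ N := fun d hd =>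
    MvPolynomial.le_totalDegree hd
  rw [MvPolynomial.aeval_def, MvPolynomial.eval₂_eq]
  constructor
  · refine natDegree_sum_le_of_forall_le _ _ fun d hd => ?_
    change natDegree (C (C (MvPolynomial.coeff d f)) * _) ≤ N
    exact (natDegree_C_mul_le _ _).trans
      ((natDegree_prod_line_le A (fun i => C (v i)) d d.support).1.trans (hle d hd))
  · rw [finsetSum_coeff, MvPolynomial.homogeneousComponent_apply, map_sum, map_sum,
      Finset.sum_filter]
    refine Finset.sum_congr rfl fun d hd => ?_
    change coeff (C (C (MvPolynomial.coeff d f)) * _) N = _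
    have key := natDegree_prod_line_le A (fun i => C (v i)) d d.support
    rw [coeff_C_mul]
    split_ifs with h
    · have h' : ∑ i ∈ d.support, d i = N := h
      rw [← h', key.2, MvPolynomial.eval_monomial, Finsupp.prod]
      simp
    · have h' : ∑ i ∈ d.support, d i < N := lt_of_le_of_ne (hle d hd) h
      rw [coeff_eq_zero_of_natDegree_lt (key.1.trans_lt h'), mul_zero]

theorem homogeneousComponent_totalDegree_ne_zero (hf : f ≠ 0) :
    MvPolynomial.homogeneousComponent f.totalDegree f ≠ 0 := by
  obtain ⟨d, hd, hdeg⟩ := Finset.exists_mem_eq_sup f.support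
    (MvPolynomial.support_nonempty.2 hf) fun s => s.sum fun _ e => e
  intro h
  have := MvPolynomial.coeff_homogeneousComponent f.totalDegree f d
  rw [h, MvPolynomial.coeff_zero, if_pos (show Finsupp.degree d = f.totalDegree from hdeg.symm)] at this
  exact MvPolynomial.mem_support_iff.1 hd this.symm

theorem polyLike_mvPolynomial_eval : PolyLike fun z : Fin n → ℂ => MvPolynomial.eval z f := by
  intro x v
  refine ⟨MvPolynomial.aeval (fun i => (C (x i) + X * C (v i) : ℂ[X])) f, fun t => ?_⟩
  rw [← Polynomial.coe_evalRingHom, MvPolynomial.aeval_def, MvPolynomial.hom_eval₂]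
  change MvPolynomial.eval₂ _ _ _ = _
  congr 1
  · ext; simp
  · ext i; simp; ring

theorem exists_pencil_mvPolynomial_eval (hf : 1 ≤ f.totalDegree) :
    ∃ v c, Pencil (fun z : Fin n → ℂ => MvPolynomial.eval z f) v f.totalDegree c := by
  have hf0 : f ≠ 0 := by rintro rfl; simp at hf
  obtain ⟨v, hv⟩ : ∃ v, MvPolynomial.eval v
      (MvPolynomial.homogeneousComponent f.totalDegree f) ≠ 0 := by
    by_contra! h
    exact homogeneousComponent_totalDegree_ne_zero f hf0
      (MvPolynomial.funext fun x => by rw [h x, map_zero])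
  refine ⟨v, _, MvPolynomial.continuous_eval f, polyLike_mvPolynomial_eval f, hf, hv,
    fun z u => ?_⟩
  have key := mvPolynomial_coeff_aeval_line f (fun i => C (z i) + X * C (u i)) v
  set H := MvPolynomial.aeval
    (fun i => (C (C (z i) + X * C (u i)) + X * C (C (v i)) : ℂ[X][X])) f with hH
  have hdeg : H.natDegree = f.totalDegree :=
    natDegree_eq_of_le_of_coeff_ne_zero key.1 (by rw [key.2]; simpa using hv)
  refine ⟨H, hdeg, by rw [leadingCoeff, hdeg, key.2], fun τ t => ?_⟩
  let ev : ℂ[X][X] →+* ℂ := (evalRingHom t).comp (mapRingHom (evalRingHom τ))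
  have hev : eval2 H τ t = ev H := by simp [ev, eval2]
  rw [hev, hH, MvPolynomial.aeval_def, MvPolynomial.hom_eval₂, MvPolynomial.eval,
    MvPolynomial.coe_eval₂Hom]
  congr 1
  · ext x
    change x = ev (C (C x))
    simp [ev]
  · ext i; simp [ev]; ring

end PolynomialPencil

section Trivialisation

theorem exists_productNear {Z : Type*} [TopologicalSpace Z] {f : Z → ℂ} {V : Set ℂ}
    (h0 : (0 : ℂ) ∈ V) (hV : IsOpen V) (h : ↥(f ⁻¹' V) ≃ₜ V × ↥{z | f z = 0})
    (hh : ∀ z : ↥(f ⁻¹' V), ((h z).1 : ℂ) = f z) (z₁ : Z) :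
    ∃ ε r a, ProductNear f ε r a := by
  classical
  obtain ⟨ε, hε, hεV⟩ := Metric.isOpen_iff.1 hV 0 h0
  let r : Z → Z := fun z => if hz : f z ∈ V then (h ⟨z, hz⟩).2 else z
  let a : ℂ × Z → Z := fun x => if hx : x.1 ∈ V ∧ f x.2 = 0 then
    h.symm (⟨x.1, hx.1⟩, ⟨x.2, hx.2⟩) else z₁
  have hr : ∀ z (hz : f z ∈ V), r z = (h ⟨z, hz⟩).2 := fun z hz => dif_pos hz
  have ha : ∀ w (hw : w ∈ V) y (hy : f y = 0), a (w, y) = h.symm (⟨w, hw⟩, ⟨y, hy⟩) :=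
    fun w hw y hy => dif_pos (c := w ∈ V ∧ f y = 0) ⟨hw, hy⟩
  have hfa : ∀ w (hw : w ∈ V) y (hy : f y = 0), f (a (w, y)) = w := fun w hw y hy => by
    rw [ha w hw y hy, ← hh, h.apply_symm_apply]
  refine ⟨ε, r, a, hε, ?_, ?_, ?_, fun w hw => hfa w (hεV hw), ?_, ?_⟩
  · refine ContinuousOn.mono ?_ (preimage_mono hεV)
    rw [continuousOn_iff_continuous_domRestrict]
    have : (f ⁻¹' V).domRestrict r = fun z => ((h z).2 : Z) := by
      funext z; exact hr z z.2
    rw [this]; fun_prop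
  · intro z hz
    rw [hr z (hεV hz)]
    exact (h ⟨z, hεV hz⟩).2.2
  · refine ContinuousOn.mono ?_ (prod_mono_left hεV)
    rw [continuousOn_iff_continuous_domRestrict]
    have : (V ×ˢ {z | f z = 0}).domRestrict a = fun x =>
        (h.symm (⟨x.1.1, x.2.1⟩, ⟨x.1.2, x.2.2⟩) : Z) := by
      funext x; exact ha _ x.2.1 _ x.2.2
    rw [this]; fun_prop
  · intro w hw y hy
    rw [hr _ (by rw [hfa w (hεV hw) y hy]; exact hεV hw)]
    have : (⟨a (w, y), by rw [mem_preimage, hfa w (hεV hw) y hy]; exact hεV hw⟩ : ↥(f ⁻¹' V)) =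
        h.symm (⟨w, hεV hw⟩, ⟨y, hy⟩) := Subtype.ext (ha w (hεV hw) y hy)
    rw [this, h.apply_symm_apply]
  · intro z hz
    have hz' : f (r z) = 0 := by rw [hr z (hεV hz)]; exact (h ⟨z, hεV hz⟩).2.2
    rw [ha _ (hεV hz) _ hz']
    have : ((⟨f z, hεV hz⟩, ⟨r z, hz'⟩) : V × ↥{z | f z = 0}) = h ⟨z, hεV hz⟩ :=
      Prod.ext (Subtype.ext (hh ⟨z, hεV hz⟩).symm) (Subtype.ext (hr z (hεV hz)))
    rw [this, h.symm_apply_apply]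

end Trivialisation

section LocalHomeomorph

variable {X Z : Type*} [TopologicalSpace X] [NormedAddCommGroup Z] [NormedSpace ℂ Z] {F : X → Z}
  {f : Z → ℂ}

theorem IsLocalHomeomorph.thin (hF : IsLocalHomeomorph F) (hf : PolyLike f) {z₁ : Z}
    (hz₁ : f z₁ ≠ 0) (x : X) {O : Set X} (hO : O ∈ 𝓝 x) :
    ∃ O' ∈ 𝓝 x, O' ⊆ O ∧ (O' ∩ {x | f (F x) ≠ 0}).Nonempty ∧
      IsPreconnected (O' ∩ {x | f (F x) ≠ 0}) := by
  obtain ⟨e, hxe, rfl⟩ := hF x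
  obtain ⟨O₁, hO₁O, hO₁, hxO₁⟩ := mem_nhds_iff.1 hO
  have hopen : IsOpen (e '' (e.source ∩ O₁)) := e.isOpen_image_source_inter hO₁
  obtain ⟨ρ, hρ, hρO⟩ := Metric.isOpen_iff.1 hopen (e x) ⟨x, ⟨hxe, hxO₁⟩, rfl⟩
  have hsymm : ∀ z ∈ ball (e x) ρ, e.symm z ∈ e.source ∩ O₁ ∧ e (e.symm z) = z := by
    intro z hz
    obtain ⟨y, hy, rfl⟩ := hρO hz
    rw [e.left_inv hy.1]
    exact ⟨hy, rfl⟩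
  have hcont : ContinuousOn e.symm (ball (e x) ρ) := e.continuousOn_symm.mono fun z hz => by
    rw [← (hsymm z hz).2]; exact e.map_source (hsymm z hz).1.1
  have himg : e.symm '' ball (e x) ρ = e.source ∩ e ⁻¹' ball (e x) ρ := by
    ext y; constructor
    · rintro ⟨z, hz, rfl⟩
      exact ⟨(hsymm z hz).1.1, by rw [mem_preimage, (hsymm z hz).2]; exact hz⟩
    · rintro ⟨hy, hy'⟩
      exact ⟨e y, hy', e.left_inv hy⟩
  have heq : e.symm '' ball (e x) ρ ∩ {x | f (e x) ≠ 0} =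
      e.symm '' (ball (e x) ρ ∩ {z | f z ≠ 0}) := by
    ext y; constructor
    · rintro ⟨⟨z, hz, rfl⟩, hy⟩
      rw [mem_ofPred_eq, (hsymm z hz).2] at hy
      exact ⟨z, ⟨hz, hy⟩, rfl⟩
    · rintro ⟨z, ⟨hz, hz'⟩, rfl⟩
      exact ⟨⟨z, hz, rfl⟩, by rw [mem_ofPred_eq, (hsymm z hz).2]; exact hz'⟩
  refine ⟨e.symm '' ball (e x) ρ, ?_, ?_, ?_⟩
  · rw [himg]
    exact (e.isOpen_inter_preimage isOpen_ball).mem_nhds ⟨hxe, mem_ball_self hρ⟩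
  · rintro _ ⟨z, hz, rfl⟩
    exact hO₁O (hsymm z hz).1.2
  · rw [heq]
    have hconv : Convex ℝ (ball (e x) ρ) := by
      let _ : NormedSpace ℝ Z := NormedSpace.restrictScalars ℝ ℂ Z
      exact convex_ball _ ρ
    obtain ⟨z, hz, hz'⟩ := hf.exists_ne_zero isOpen_ball (mem_ball_self hρ) hz₁
    exact ⟨⟨_, z, ⟨hz, hz'⟩, rfl⟩, (hf.isPreconnected_inter isOpen_ball hconv).image _
      (hcont.mono inter_subset_left)⟩

theorem IsLocalHomeomorph.connectedSpace_ne_zero [ConnectedSpace X] (hF : IsLocalHomeomorph F)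
    (hfc : Continuous f) (hf : PolyLike f) {z₁ : Z} (hz₁ : f z₁ ≠ 0) :
    ConnectedSpace {x | f (F x) ≠ 0} := by
  have hS : IsOpen {x | f (F x) ≠ 0} := isOpen_ne_fun (hfc.comp hF.continuous) continuous_const
  refine isConnected_iff_connectedSpace.1 ⟨?_, ?_⟩
  · obtain ⟨x⟩ := (inferInstance : Nonempty X)
    obtain ⟨O, -, -, ⟨y, hy⟩, -⟩ := hF.thin hf hz₁ x Filter.univ_mem
    exact ⟨y, hy.2⟩
  · exact isPreconnected_univ.of_thin isOpen_univ hS (subset_univ _)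
      fun y _ O hO => hF.thin hf hz₁ y hO

end LocalHomeomorph

theorem IsLocalHomeomorph.exists_section_ne_zero {X Z : Type*} [TopologicalSpace X]
    [TopologicalSpace Z] {F : X → Z} {f : Z → ℂ} (hF : IsLocalHomeomorph F)
    (x₀ : X) [Nonempty {x | f (F x) ≠ 0}] :
    ∃ M ∈ 𝓝 (F x₀), ∃ σ : Z → {x | f (F x) ≠ 0}, ContinuousOn σ (M ∩ {z | f z ≠ 0}) ∧
      ∀ z ∈ M ∩ {z | f z ≠ 0}, F (σ z) = z := by
  classical
  obtain ⟨e, hxe, rfl⟩ := hF x₀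
  obtain ⟨y₀⟩ := (inferInstance : Nonempty {x | f (e x) ≠ 0})
  let σ : Z → {x | f (e x) ≠ 0} := fun z =>
    if hz : f (e (e.symm z)) ≠ 0 then ⟨e.symm z, hz⟩ else y₀
  have hσ : ∀ z ∈ e.target ∩ {z | f z ≠ 0}, (σ z : X) = e.symm z := by
    rintro z ⟨hz, hz'⟩
    have : f (e (e.symm z)) ≠ 0 := by rwa [e.right_inv hz]
    simp only [σ, dif_pos this]
  refine ⟨e.target, e.open_target.mem_nhds (e.map_source hxe), σ, ?_, ?_⟩
  · rw [IsInducing.subtypeVal.continuousOn_iff]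
    exact (e.continuousOn_symm.mono inter_subset_left).congr hσ
  · intro z hz
    rw [hσ z hz, e.right_inv hz.1]

/-- A function without zeros on a simply connected, locally path connected space has a logarithm. -/
theorem exists_continuous_log {X : Type*} [TopologicalSpace X] [SimplyConnectedSpace X]
    [LocallyPathConnectedSpace X] {g : X → ℂ} (hg : Continuous g) (hg0 : ∀ x, g x ≠ 0) :
    ∃ l : X → ℂ, Continuous l ∧ ∀ x, Complex.exp (l x) = g x := by
  obtain ⟨x₀⟩ := (inferInstance : Nonempty X)
  obtain ⟨l, ⟨-, hl⟩, -⟩ := ExpCover.coveringOnto_exp.cov.existsUnique_continuousMap_lifts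
    ⟨fun x => (⟨g x, hg0 x⟩ : {w : ℂ | w ≠ 0}), by fun_prop⟩ x₀ (Complex.log (g x₀))
    (Subtype.ext (Complex.exp_log (hg0 x₀)))
  exact ⟨l, l.continuous, fun x => congrArg Subtype.val (congrFun hl x)⟩

theorem one_le_totalDegree_of_pderiv_ne_zero {n : ℕ} {f : MvPolynomial (Fin n) ℂ}
    {z : Fin n → ℂ} {i : Fin n} (h : MvPolynomial.eval z (MvPolynomial.pderiv i f) ≠ 0) :
    1 ≤ f.totalDegree := by
  rw [Nat.one_le_iff_ne_zero]
  intro h0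
  rw [MvPolynomial.totalDegree_eq_zero_iff_eq_C.1 h0, MvPolynomial.pderiv_C, map_zero] at h
  exact h rfl

/-- A local homeomorphism from a simply connected space which is a covering away from the zero
fibre of a pencil, trivial near that fibre, has a one-point fibre or an infinite fibre. -/
theorem exists_singleton_or_infinite_preimage {X Z : Type*} [TopologicalSpace X]
    [SimplyConnectedSpace X] [LocallyPathConnectedSpace X] [NormedAddCommGroup Z] [NormedSpace ℂ Z]
    {F : X → Z} {f : Z → ℂ} {v : Z} {N : ℕ} {k : ℂ} (hf : Pencil f v N k) {ε : ℝ} {r : Z → Z}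
    {a : ℂ × Z → Z} (h : ProductNear f ε r a) (hD : IsConnected {z | f z = 0})
    (hF : IsLocalHomeomorph F)
    (hp : CoveringOnto (fun x : {x | f (F x) ≠ 0} => F x) {z | f z ≠ 0})
    (hsurj : (∃ x, f (F x) ≠ 0) → ∀ z, f z ≠ 0 → ∃ x, F x = z) :
    ∃ z, f z ≠ 0 ∧ ((∃ e, (fun x : {x | f (F x) ≠ 0} => F x) ⁻¹' {z} = {e}) ∨
      ((fun x : {x | f (F x) ≠ 0} => F x) ⁻¹' {z}).Infinite) := by
  obtain ⟨t, ht⟩ := hf.exists_eq 0 1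
  have hz₁ : f (0 + t • v) ≠ 0 := by rw [ht]; exact one_ne_zero
  have := hF.connectedSpace_ne_zero hf.continuous hf.polyLike hz₁
  by_cases hx : ∃ x, f (F x) = 0
  · obtain ⟨x₀, hx₀⟩ := hx
    obtain ⟨M, hM, σ, hσ, hpσ⟩ := hF.exists_section_ne_zero (f := f) x₀
    obtain ⟨z, e, hz, he⟩ := h.exists_preimage_eq_singleton hf hp hD.isPreconnected hx₀ hM hσ hpσ
    exact ⟨z, hz, Or.inl ⟨e, he⟩⟩
  · push Not at hx
    obtain ⟨l, hl, hexp⟩ := exists_continuous_log (hf.continuous.comp hF.continuous) hx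
    obtain ⟨y, hy⟩ := hD.nonempty
    have hw : ((ε / 2 : ℝ) : ℂ) ∈ ball (0 : ℂ) ε := by
      rw [mem_ball_zero_iff, Complex.norm_real, Real.norm_of_nonneg (by linarith [h.pos])]
      linarith [h.pos]
    have hw0 : ((ε / 2 : ℝ) : ℂ) ≠ 0 := by simp [h.pos.ne']
    have hfa := h.map_inv _ hw y hy
    obtain ⟨x₁⟩ := (inferInstance : Nonempty X)
    obtain ⟨x, hxa⟩ := hsurj ⟨x₁, hx x₁⟩ (a (((ε / 2 : ℝ) : ℂ), y)) (by rwa [hfa])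
    refine ⟨F x, hx x, Or.inr ?_⟩
    exact h.infinite_preimage hf.continuous hp (l := fun e => l e) (by fun_prop)
      (fun e => hexp e) (e := ⟨x, hx x⟩) (by simp only [hxa, hfa]; exact hw)

end Preliminaries

/-- **Main theorem.**  Fix `n ≥ 2` and let `D ⊂ ℂⁿ` be a smooth connected non-bifurcated
hypersurface: `D` is the zero set of a polynomial `f` of minimal degree, its points are all
regular points of `f`, `D` is connected, and `f` is a (locally) trivial fibration over a
neighborhood of `0 ∈ ℂ`.  If `F : X → ℂⁿ` is a local diffeomorphism of simply connected
manifolds which is a `d`-fold covering map away from `D`, then `d = 1` or `d = ∞`. -/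
theorem birational_or_infinite_degree
    {n : ℕ} (hn : 2 ≤ n)
    (f : MvPolynomial (Fin n) ℂ) (D : Set (Fin n → ℂ))
    (hD : D = {z | polyMap n f z = 0})
    (hmin : ∀ g : MvPolynomial (Fin n) ℂ, g ≠ 0 → {z | polyMap n g z = 0} = D →
      f.totalDegree ≤ g.totalDegree)
    (hsmooth : ∀ z ∈ D, ∃ i : Fin n, MvPolynomial.eval z (MvPolynomial.pderiv i f) ≠ 0)
    (hconn : IsConnected D)
    (hnonbif : ∃ V : Set ℂ, (0 : ℂ) ∈ V ∧ IsOpen V ∧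
      ∃ h : ↥(polyMap n f ⁻¹' V) ≃ₜ V × ↥D,
        ∀ z : ↥(polyMap n f ⁻¹' V), ((h z).1 : ℂ) = polyMap n f (z : Fin n → ℂ))
    {X : Type*} [TopologicalSpace X] [ChartedSpace (Fin n → ℂ) X]
    [SimplyConnectedSpace X]
    (F : X → (Fin n → ℂ))
    (hF : IsLocalDiffeomorph 𝓘(ℝ, Fin n → ℂ) 𝓘(ℝ, Fin n → ℂ) (⊤ : ℕ∞) F)
    (d : ℕ∞)
    (hcov : IsCoveringMap (Dᶜ.restrictPreimage F))
    (hd : ∀ y : ↥(Dᶜ), ((Dᶜ.restrictPreimage F) ⁻¹' {y}).encard = d) :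
    d = 1 ∨ d = ⊤ := by
  have hpos : 1 ≤ f.totalDegree := by
    obtain ⟨z, hz⟩ := hconn.nonempty
    obtain ⟨i, hi⟩ := hsmooth z hz
    exact one_le_totalDegree_of_pderiv_ne_zero hi
  obtain ⟨v, c, hpencil⟩ := exists_pencil_mvPolynomial_eval f hpos
  obtain ⟨V, h0, hV, h, hh⟩ := hnonbif
  subst hD
  obtain ⟨ε, r, a, hprod⟩ := exists_productNear h0 hV h hh 0
  have hp : CoveringOnto (fun x : {x | polyMap n f (F x) ≠ 0} => F x)
      {z | polyMap n f z ≠ 0} := ⟨fun x => x.2, hcov⟩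
  have hfib : ∀ z, polyMap n f z ≠ 0 →
      ((fun x : {x | polyMap n f (F x) ≠ 0} => F x) ⁻¹' {z}).encard = d := by
    intro z hz
    rw [← hd ⟨z, hz⟩]
    congr 1
    ext x
    exact ⟨fun hx => Subtype.ext hx, fun hx => congrArg Subtype.val hx⟩
  have : LocallyPathConnectedSpace X := ChartedSpace.locallyPathConnectedSpace (Fin n → ℂ) X
  obtain ⟨z, hz, ⟨e, he⟩ | hinf⟩ := exists_singleton_or_infinite_preimage hpencil hprod hconn
    hF.isLocalHomeomorph hp fun ⟨x, hx⟩ z hz => by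
      have hd0 : d ≠ 0 := by
        rw [← hfib (F x) hx, encard_ne_zero]
        exact ⟨⟨x, hx⟩, rfl⟩
      rw [← hfib z hz, encard_ne_zero] at hd0
      obtain ⟨y, hy⟩ := hd0
      exact ⟨y, hy⟩
  · left
    exact (hfib z hz).symm.trans ((congrArg encard he).trans (encard_singleton e))
  · right
    exact (hfib z hz).symm.trans hinf.encard_eq
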